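/- Let n ≥ 1. Every loose non-homotopic drawing in the plane with n vertices and m edges satisfies m ≤ 3n − 3. -/

import Mathlib

open unitInterval ENNReal

/-- A drawing in the plane with `n` vertices and `m` edges: a finite set `V ⊆ ℂ` of
`n` vertices together with continuous curves `f e : [0,1] → ℂ` whose endpoints are
vertices and whose interiors avoid the vertices. -/
structure PlaneDrawing (n m : ℕ) where
  V : Set ℂ
  finV : V.Finite
  cardV : V.ncard = n
  f : Fin m → I → ℂ
  cont : ∀ e, Continuous (f e)
  source_mem : ∀ e, f e 0 ∈ V
  target_mem : ∀ e, f e 1 ∈ V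
  interior_not_mem : ∀ e, ∀ t : I, t ≠ 0 → t ≠ 1 → f e t ∉ V

/-- Homotopy between two curves, fixing the endpoints of the first, with interior
avoiding the vertex set `V`. -/
def HomotopicIn (V : Set ℂ) (a b : I → ℂ) : Prop :=
  ∃ g : I × I → ℂ, Continuous g ∧
    (∀ t, g (0, t) = a t) ∧ (∀ t, g (1, t) = b t) ∧
    (∀ s, g (s, 0) = a 0) ∧ (∀ s, g (s, 1) = a 1) ∧
    (∀ s t : I, s ≠ 0 → s ≠ 1 → t ≠ 0 → t ≠ 1 → g (s, t) ∉ V)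

/-- Two edges are homotopic if one is homotopic to the other or to its reversal. -/
def EdgeHomotopic (V : Set ℂ) (a b : I → ℂ) : Prop :=
  HomotopicIn V a b ∨ HomotopicIn V (fun t => a (σ t)) b

/-- An edge is a trivial loop if it is homotopic to the constant map at its endpoint. -/
def IsTrivialLoop (V : Set ℂ) (a : I → ℂ) : Prop :=
  EdgeHomotopic V a fun _ => a 0

/-- A drawing is non-homotopic if no two distinct edges are homotopic and
no edge is a trivial loop. -/
def PlaneDrawing.NonHomotopic {n m : ℕ} (D : PlaneDrawing n m) : Prop :=
  (∀ e e' : Fin m, e ≠ e' → ¬ EdgeHomotopic D.V (D.f e) (D.f e')) ∧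
  (∀ e : Fin m, ¬ IsTrivialLoop D.V (D.f e))

/-- The crossing number: half the cardinality of the set of ordered crossings. -/
noncomputable def PlaneDrawing.crossingNumber {n m : ℕ} (D : PlaneDrawing n m) : ℝ≥0∞ :=
  (({p : (Fin m × I) × (Fin m × I) |
      p.1 ≠ p.2 ∧ p.1.2 ≠ 0 ∧ p.1.2 ≠ 1 ∧ p.2.2 ≠ 0 ∧ p.2.2 ≠ 1 ∧
      D.f p.1.1 p.1.2 = D.f p.2.1 p.2.2}).encard : ℝ≥0∞) / 2

/-- A plane drawing is loose if no two distinct edges cross. -/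
def PlaneDrawing.Loose {n m : ℕ} (D : PlaneDrawing n m) : Prop :=
  ∀ e e' : Fin m, e ≠ e' → ∀ t t' : I, t ≠ 0 → t ≠ 1 → t' ≠ 0 → t' ≠ 1 →
    D.f e t ≠ D.f e' t'

section Development

variable {Γ E D : Type*} [Group Γ] [MulAction Γ E]

/-- Two pairs of labels lie in the same orbit of the diagonal action. -/
def SameOrbit (Γ : Type*) {E : Type*} [Group Γ] [MulAction Γ E] (a b : E × E) : Prop :=
  ∃ γ : Γ, γ • a = b

theorem SameOrbit.refl (a : E × E) : SameOrbit Γ a a := ⟨1, one_smul _ _⟩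

theorem SameOrbit.symm {a b : E × E} (h : SameOrbit Γ a b) : SameOrbit Γ b a := by
  obtain ⟨γ, rfl⟩ := h
  exact ⟨γ⁻¹, inv_smul_smul _ _⟩

theorem SameOrbit.trans {a b c : E × E} (h : SameOrbit Γ a b) (h' : SameOrbit Γ b c) :
    SameOrbit Γ a c := by
  obtain ⟨γ, rfl⟩ := h
  obtain ⟨γ', rfl⟩ := h'
  exact ⟨γ' * γ, mul_smul _ _ _⟩

theorem SameOrbit.swap {a b : E × E} (h : SameOrbit Γ a b) : SameOrbit Γ a.swap b.swap := by
  obtain ⟨γ, rfl⟩ := h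
  exact ⟨γ, rfl⟩

theorem SameOrbit.eq_iff {a b : E × E} (h : SameOrbit Γ a b) : a.1 = a.2 ↔ b.1 = b.2 := by
  obtain ⟨γ, rfl⟩ := h
  simp

/-- A word of darts lifts to a walk of labels from `p` to `q`. -/
def Develops (Γ : Type*) {E D : Type*} [Group Γ] [MulAction Γ E] (lab : D → E × E) :
    List D → E → E → Prop
  | [], p, q => p = q
  | d :: l, p, q => ∃ r, SameOrbit Γ (lab d) (p, r) ∧ Develops Γ lab l r q

theorem develops_append (lab : D → E × E) (l₁ l₂ : List D) (p q : E) :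
    Develops Γ lab (l₁ ++ l₂) p q ↔ ∃ r, Develops Γ lab l₁ p r ∧ Develops Γ lab l₂ r q := by
  induction l₁ generalizing p with
  | nil => simp [Develops]
  | cons d l ih =>
    simp only [List.cons_append, Develops, ih]
    constructor
    · rintro ⟨r, h, r', h1, h2⟩
      exact ⟨r', ⟨r, h, h1⟩, h2⟩
    · rintro ⟨r', ⟨r, h, h1⟩, h2⟩
      exact ⟨r, h, r', h1, h2⟩

theorem develops_filter (lab : D → E × E) (P : D → Prop) [DecidablePred P]
    (hP : ∀ d, ¬ P d → (lab d).1 = (lab d).2) (l : List D) (p q : E)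
    (h : Develops Γ lab l p q) : Develops Γ lab (l.filter P) p q := by
  induction l generalizing p with
  | nil => exact h
  | cons d l ih =>
    obtain ⟨r, hr, h⟩ := h
    by_cases hd : P d
    · rw [List.filter_cons_of_pos (by simpa using hd)]
      exact ⟨r, hr, ih r h⟩
    · rw [List.filter_cons_of_neg (by simpa using hd)]
      have : p = r := (hr.eq_iff).1 (hP d hd)
      subst this
      exact ih p h

end Development

section Reduction

variable {Γ E D : Type*} [Group Γ] [MulAction Γ E]

/-- All letters of a multiset of words. -/
def letters {D : Type*} (F : Multiset (List D)) : Multiset D := F.bind fun l => (l : Multiset D)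

theorem mem_letters {F : Multiset (List D)} {d : D} : d ∈ letters F ↔ ∃ l ∈ F, d ∈ l := by
  simp [letters]

theorem letters_cons (l : List D) (F : Multiset (List D)) :
    letters (l ::ₘ F) = (l : Multiset D) + letters F := by
  simp [letters]

theorem three_mul_card_le_card_letters (F : Multiset (List D)) (h : ∀ l ∈ F, 3 ≤ l.length) :
    3 * F.card ≤ (letters F).card := by
  induction F using Multiset.induction with
  | empty => simp
  | cons l F ih =>
    rw [letters_cons, Multiset.card_add, Multiset.card_cons]
    have := ih fun l' hl' => h l' (Multiset.mem_cons_of_mem hl')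
    have := h l (Multiset.mem_cons_self _ _)
    simp only [Multiset.coe_card]
    omega

/-- The faces of a gluing pattern are connected through the involution `α`. -/
def FacesConnected (α : D → D) (F : Multiset (List D)) : Prop :=
  ∀ P : List D → Prop,
    (∀ l ∈ F, P l → ∀ d ∈ l, ∀ l' ∈ F, α d ∈ l' → P l') → (∀ l ∈ F, P l) ∨ ∀ l ∈ F, ¬ P l

/-- Darts with pairwise inequivalent nontrivial labels. -/
def Independent (Γ : Type*) {E D : Type*} [Group Γ] [MulAction Γ E] (lab : D → E × E)
    (Q : Finset D) : Prop :=
  (∀ d ∈ Q, (lab d).1 ≠ (lab d).2) ∧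
    ∀ d ∈ Q, ∀ d' ∈ Q, d ≠ d' →
      ¬ SameOrbit Γ (lab d) (lab d') ∧ ¬ SameOrbit Γ (lab d) (lab d').swap


theorem develops_smul (lab : D → E × E) (γ : Γ) {l : List D} {p q : E}
    (h : Develops Γ lab l p q) : Develops Γ lab l (γ • p) (γ • q) := by
  induction l generalizing p with
  | nil => exact congrArg _ h
  | cons d l ih =>
    obtain ⟨r, hr, h⟩ := h
    exact ⟨γ • r, hr.trans ⟨γ, rfl⟩, ih h⟩

theorem Independent.image [DecidableEq D] {lab : D → E × E} {Q : Finset D}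
    (hQ : Independent Γ lab Q) (φ : D → D)
    (hφ : ∀ d ∈ Q, SameOrbit Γ (lab (φ d)) (lab d) ∨ SameOrbit Γ (lab (φ d)) (lab d).swap) :
    Independent Γ lab (Q.image φ) ∧ (Q.image φ).card = Q.card := by
  have key : ∀ d ∈ Q, ∀ d' ∈ Q, d ≠ d' → ¬ SameOrbit Γ (lab (φ d)) (lab (φ d')) ∧
      ¬ SameOrbit Γ (lab (φ d)) (lab (φ d')).swap := by
    intro d hd d' hd' hne
    obtain ⟨h1, h2⟩ := hQ.2 d hd d' hd' hne
    have a := hφ d hd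
    have b := hφ d' hd'
    constructor
    · intro h
      rcases a with a | a <;> rcases b with b | b
      · exact h1 (a.symm.trans (h.trans b))
      · exact h2 (a.symm.trans (h.trans b))
      · exact h2 (a.symm.trans (h.trans b)).swap
      · exact h1 (a.symm.trans (h.trans b)).swap
    · intro h
      rcases a with a | a <;> rcases b with b | b
      · exact h2 (a.symm.trans (h.trans b.swap))
      · exact h1 (a.symm.trans (h.trans b.swap))
      · exact h1 (a.symm.trans (h.trans b.swap)).swap
      · exact h2 (a.symm.trans (h.trans b.swap)).swap
  refine ⟨⟨?_, ?_⟩, ?_⟩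
  · intro d hd
    obtain ⟨e, he, rfl⟩ := Finset.mem_image.1 hd
    have := hQ.1 e he
    rcases hφ e he with h | h
    · exact fun h' => this (h.eq_iff.1 h')
    · exact fun h' => this (h.eq_iff.1 h').symm
  · intro d hd d' hd' hne
    obtain ⟨e, he, rfl⟩ := Finset.mem_image.1 hd
    obtain ⟨e', he', rfl⟩ := Finset.mem_image.1 hd'
    exact key e he e' he' fun h => hne (congrArg φ h)
  · refine Finset.card_image_of_injOn fun e he e' he' h => ?_
    by_contra hne
    exact (key e he e' he' hne).1 (h ▸ SameOrbit.refl _)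

theorem FacesConnected.merge {α : D → D} (hα : ∀ d, α (α d) = d) {F : Multiset (List D)}
    {d : D} {x l₁ l₂ : List D}
    (h : FacesConnected α ((d :: x) ::ₘ (l₁ ++ α d :: l₂) ::ₘ F))
    (hd : (letters ((d :: x) ::ₘ (l₁ ++ α d :: l₂) ::ₘ F)).Nodup) :
    FacesConnected α ((l₁ ++ x ++ l₂) ::ₘ F) := by
  classical
  intro P hP
  have hF : ∀ l ∈ F, ∀ e ∈ l, e ≠ d ∧ e ≠ α d := by
    intro l hl e he
    have heF : e ∈ letters F := mem_letters.2 ⟨l, hl, he⟩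
    rw [letters_cons, letters_cons, Multiset.nodup_add, Multiset.nodup_add] at hd
    constructor
    · rintro rfl
      exact Multiset.disjoint_left.1 hd.2.2 (show e ∈ _ from by simp)
        (Multiset.mem_add.2 (.inr heF))
    · rintro rfl
      exact Multiset.disjoint_left.1 hd.2.1.2.2 (by simp) heF
  have hF1 : ∀ l ∈ F, ¬ (l = d :: x ∨ l = l₁ ++ α d :: l₂) := by
    rintro l hl (rfl | rfl)
    · exact (hF _ hl d (by simp)).1 rfl
    · exact (hF _ hl (α d) (by simp)).2 rfl
  have key := h (fun l => if l = d :: x ∨ l = l₁ ++ α d :: l₂ then P (l₁ ++ x ++ l₂) else P l) ?_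
  · rcases key with key | key
    · left
      intro l hl
      rcases Multiset.mem_cons.1 hl with rfl | hl
      · simpa using key (d :: x) (by simp)
      · have := key l (by simp [hl])
        rwa [if_neg (hF1 l hl)] at this
    · right
      intro l hl
      rcases Multiset.mem_cons.1 hl with rfl | hl
      · simpa using key (d :: x) (by simp)
      · have := key l (by simp [hl])
        rwa [if_neg (hF1 l hl)] at this
  · intro l hl hPl e he l' hl' he'
    by_cases hlab : l = d :: x ∨ l = l₁ ++ α d :: l₂
    · rw [if_pos hlab] at hPl
      by_cases hlab' : l' = d :: x ∨ l' = l₁ ++ α d :: l₂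
      · rwa [if_pos hlab']
      · rw [if_neg hlab']
        have hl'F : l' ∈ F := by
          simp only [Multiset.mem_cons] at hl'
          tauto
        have hh := hF l' hl'F _ he'
        have h1 : e ≠ α d := fun h => hh.1 (by rw [h, hα])
        have h2 : e ≠ d := fun h => hh.2 (by rw [h])
        refine hP _ (Multiset.mem_cons_self _ _) hPl e ?_ l' (Multiset.mem_cons_of_mem hl'F) he'
        rcases hlab with rfl | rfl <;> simp at he ⊢ <;> tauto
    · rw [if_neg hlab] at hPl
      have hlF : l ∈ F := by
        simp only [Multiset.mem_cons] at hl
        tauto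
      by_cases hlab' : l' = d :: x ∨ l' = l₁ ++ α d :: l₂
      · rw [if_pos hlab']
        have hh := hF l hlF _ he
        have h1 : α e ≠ α d := fun h => hh.1 (by rw [← hα e, h, hα])
        have h2 : α e ≠ d := fun h => hh.2 (by rw [← h, hα])
        refine hP l (Multiset.mem_cons_of_mem hlF) hPl e he _ (Multiset.mem_cons_self _ _) ?_
        rcases hlab' with rfl | rfl <;> simp at he' ⊢ <;> tauto
      · rw [if_neg hlab']
        have hl'F : l' ∈ F := by
          simp only [Multiset.mem_cons] at hl'
          tauto
        exact hP l (Multiset.mem_cons_of_mem hlF) hPl e he l' (Multiset.mem_cons_of_mem hl'F) he'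

/-- A labelled gluing pattern of words, each of which lifts to closed walks of labels. -/
structure FlatPattern (Γ : Type*) {E D : Type*} [Group Γ] [MulAction Γ E] (α : D → D)
    (lab : D → E × E) (F : Multiset (List D)) : Prop where
  nodup : (letters F).Nodup
  closed : ∀ d ∈ letters F, α d ∈ letters F
  flat : ∀ l ∈ F, ∃ p, Develops Γ lab l p p
  conn : FacesConnected α F

theorem letters_merge {d e : D} {x l₁ l₂ : List D} {F : Multiset (List D)} :
    letters ((d :: x) ::ₘ (l₁ ++ e :: l₂) ::ₘ F) =
      d ::ₘ e ::ₘ letters ((l₁ ++ x ++ l₂) ::ₘ F) := by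
  simp only [letters_cons]
  simp only [← Multiset.cons_coe, ← Multiset.coe_add, ← Multiset.singleton_add]
  abel

theorem FlatPattern.merge {α : D → D} (hα : ∀ d, α (α d) = d)
    {lab : D → E × E} (hlab : ∀ d, SameOrbit Γ (lab (α d)) (lab d).swap)
    {F : Multiset (List D)} {d : D} {x l₁ l₂ : List D}
    (h : FlatPattern Γ α lab ((d :: x) ::ₘ (l₁ ++ α d :: l₂) ::ₘ F)) :
    FlatPattern Γ α lab ((l₁ ++ x ++ l₂) ::ₘ F) := by
  have hn := h.nodup
  rw [letters_merge, Multiset.nodup_cons, Multiset.nodup_cons] at hn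
  obtain ⟨hn1, hn2, hn3⟩ := hn
  refine ⟨hn3, ?_, ?_, h.conn.merge hα h.nodup⟩
  · intro e he
    have := h.closed e (by rw [letters_merge, Multiset.mem_cons, Multiset.mem_cons]; exact .inr (.inr he))
    rw [letters_merge, Multiset.mem_cons, Multiset.mem_cons] at this
    rcases this with h' | h' | h'
    · exact absurd (by rwa [← h', hα]) hn2
    · rw [← hα e, h', hα] at he
      exact absurd (Multiset.mem_cons_of_mem he) hn1
    · exact h'
  · intro l hl
    rcases Multiset.mem_cons.1 hl with rfl | hl
    · obtain ⟨p, r, hr, hx⟩ := h.flat (d :: x) (by simp)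
      obtain ⟨q, hq⟩ := h.flat (l₁ ++ α d :: l₂) (by simp)
      rw [develops_append] at hq
      obtain ⟨s, hs, t, ht, hq⟩ := hq
      obtain ⟨γ, hγ⟩ := (hr.swap.symm.trans (hlab d).symm).trans ht
      have hγ1 : γ • r = s := congrArg Prod.fst hγ
      have hγ2 : γ • p = t := congrArg Prod.snd hγ
      have := develops_smul lab γ hx
      rw [hγ1, hγ2] at this
      refine ⟨q, ?_⟩
      rw [develops_append]
      refine ⟨t, ?_, hq⟩
      rw [develops_append]
      exact ⟨s, hs, this⟩
    · exact h.flat l (by simp [hl])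

theorem FlatPattern.two_mul_card_le {α : D → D} (hα : ∀ d, α (α d) = d)
    (hα' : ∀ d, α d ≠ d)
    {lab : D → E × E} (hlab : ∀ d, SameOrbit Γ (lab (α d)) (lab d).swap)
    {F : Multiset (List D)} (h : FlatPattern Γ α lab F)
    {Q : Finset D} (hQF : ∀ d ∈ Q, d ∈ letters F) (hQ : Independent Γ lab Q) :
    2 * Q.card ≤ (letters F).card := by
  classical
  have hinj : Function.Injective α := fun a b hab => by rw [← hα a, hab, hα]
  have hdisj : Disjoint Q (Q.image α) := by
    rw [Finset.disjoint_left]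
    intro d hd hd'
    obtain ⟨e, he, rfl⟩ := Finset.mem_image.1 hd'
    exact (hQ.2 _ hd _ he (hα' e)).2 (hlab e)
  have hsub : Q ∪ Q.image α ⊆ (letters F).toFinset := by
    intro d hd
    rw [Multiset.mem_toFinset]
    rcases Finset.mem_union.1 hd with hd | hd
    · exact hQF d hd
    · obtain ⟨e, he, rfl⟩ := Finset.mem_image.1 hd
      exact h.closed e (hQF e he)
  have := Finset.card_le_card hsub
  rw [Finset.card_union_of_disjoint hdisj, Finset.card_image_of_injective _ hinj,
    Multiset.toFinset_card_of_nodup h.nodup] at this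
  omega

theorem FlatPattern.card_bound {α : D → D} (hα : ∀ d, α (α d) = d)
    (hα' : ∀ d, α d ≠ d)
    {lab : D → E × E} (hlab : ∀ d, SameOrbit Γ (lab (α d)) (lab d).swap)
    {F : Multiset (List D)} (h : FlatPattern Γ α lab F) {k : ℕ}
    (hk : (letters F).card + 4 = 2 * k + 2 * F.card)
    {Q : Finset D} (hQF : ∀ d ∈ Q, d ∈ letters F) (hQ : Independent Γ lab Q) :
    Q.card = 0 ∨ (Q.card ≤ 1 ∧ k = 2) ∨ Q.card + 6 ≤ 3 * k := by
  classical
  induction hN : (letters F).card using Nat.strong_induction_on generalizing F Q with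
  | _ N ih =>
    subst hN
    -- eliminate a word `d :: x` whose partner lies in another word
    have step : ∀ d x, (d :: x) ∈ F → α d ∉ x →
        ∃ F', FlatPattern Γ α lab F' ∧ letters F = d ::ₘ α d ::ₘ letters F' ∧
          F.card = F'.card + 1 := by
      intro d x hdx hd
      obtain ⟨F₁, rfl⟩ := Multiset.exists_cons_of_mem hdx
      have h1 := h.closed d (mem_letters.2 ⟨_, hdx, by simp⟩)
      obtain ⟨l, hl, hdl⟩ := mem_letters.1 h1
      have hl' : l ∈ F₁ := by
        rcases Multiset.mem_cons.1 hl with rfl | hl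
        · simp only [List.mem_cons, hα' d, false_or] at hdl
          exact absurd hdl hd
        · exact hl
      obtain ⟨F₂, rfl⟩ := Multiset.exists_cons_of_mem hl'
      obtain ⟨l₁, l₂, rfl⟩ := List.append_of_mem hdl
      exact ⟨_, h.merge hα hlab, letters_merge, by simp⟩
    by_cases h0 : [] ∈ F
    · rcases h.conn (fun l => l = []) (by simp +contextual) with h1 | h1
      · left
        rw [Finset.card_eq_zero, Finset.eq_empty_iff_forall_notMem]
        intro d hd
        obtain ⟨l, hl, hdl⟩ := mem_letters.1 (hQF d hd)
        simp [h1 l hl] at hdl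
      · exact absurd rfl (h1 _ h0)
    by_cases h1 : ∃ d, [d] ∈ F
    · obtain ⟨d, hd⟩ := h1
      obtain ⟨F', hF', hl, hc⟩ := step d [] hd (by simp)
      obtain ⟨p, r, hr, hpr⟩ := h.flat _ hd
      have hpr' : r = p := hpr
      subst hpr'
      have hd1 : (lab d).1 = (lab d).2 := hr.eq_iff.2 rfl
      have hd2 : (lab (α d)).1 = (lab (α d)).2 := (hlab d).eq_iff.2 hd1.symm
      refine ih (letters F').card ?_ hF' ?_ ?_ hQ rfl
      · rw [hl]; simp
      · rw [hl] at hk; simp at hk; omega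
      · intro e he
        have := hQF e he
        rw [hl, Multiset.mem_cons, Multiset.mem_cons] at this
        rcases this with rfl | rfl | this
        · exact absurd hd1 (hQ.1 _ he)
        · exact absurd hd2 (hQ.1 _ he)
        · exact this
    by_cases h2 : ∃ d d', [d, d'] ∈ F
    · obtain ⟨d, d', hd⟩ := h2
      by_cases hdd : d' = α d
      · subst hdd
        have hco : ∀ l ∈ F, l = [d, α d] → ∀ e ∈ l, ∀ l' ∈ F, α e ∈ l' → l' = [d, α d] := by
          rintro l hl rfl e he l' hl' he'
          have he2 : α e ∈ [d, α d] := by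
            simp only [List.mem_cons, List.not_mem_nil, or_false] at he ⊢
            rcases he with rfl | rfl <;> simp [hα]
          by_contra hne
          obtain ⟨F₁, rfl⟩ := Multiset.exists_cons_of_mem hd
          have hn := h.nodup
          rw [letters_cons, Multiset.nodup_add] at hn
          refine Multiset.disjoint_left.1 hn.2.2 he2 (mem_letters.2 ⟨l', ?_, he'⟩)
          exact (Multiset.mem_cons.1 hl').resolve_left hne
        rcases h.conn (fun l => l = [d, α d]) hco with h3 | h3
        · obtain ⟨F₁, rfl⟩ := Multiset.exists_cons_of_mem hd
          have hF₁ : F₁ = 0 := by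
            refine Multiset.eq_zero_of_forall_notMem fun l hl => ?_
            have := h3 l (Multiset.mem_cons_of_mem hl)
            subst this
            have hn := h.nodup
            rw [letters_cons, Multiset.nodup_add] at hn
            exact Multiset.disjoint_left.1 hn.2.2 (show d ∈ _ by simp) (mem_letters.2 ⟨_, hl, by simp⟩)
          subst hF₁
          have := h.two_mul_card_le hα hα' hlab hQF hQ
          simp [letters] at hk this
          right; left
          omega
        · exact absurd rfl (h3 _ hd)
      · obtain ⟨F', hF', hl, hc⟩ := step d [d'] hd (by simpa using Ne.symm hdd)
        have hne : d ≠ d' := by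
          rintro rfl
          obtain ⟨F₁, rfl⟩ := Multiset.exists_cons_of_mem hd
          have hn := h.nodup
          rw [letters_cons, Multiset.nodup_add] at hn
          simp at hn
        have hd'F : d' ∈ letters F' := by
          have := mem_letters.2 ⟨_, hd, show d' ∈ [d, d'] by simp⟩
          rw [hl, Multiset.mem_cons, Multiset.mem_cons] at this
          tauto
        obtain ⟨p, r, hr, p', hp', hpp'⟩ := h.flat _ hd
        have hpp : p' = p := hpp'
        subst hpp
        have hdd1 : SameOrbit Γ (lab d') (lab d).swap := hp'.trans hr.swap.symm
        have hdd2 : SameOrbit Γ (lab d') (lab (α d)) := hdd1.trans (hlab d).symm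
        obtain ⟨hI, hIc⟩ := hQ.image (fun e => if e = d ∨ e = α d then d' else e) (by
          intro e he
          split_ifs with h
          · rcases h with rfl | rfl
            · exact Or.inr hdd1
            · exact Or.inl hdd2
          · exact Or.inl (SameOrbit.refl _))
        have := ih (letters F').card (by rw [hl]; simp) hF'
          (by rw [hl] at hk; simp at hk; omega) ?_ hI rfl
        · rwa [hIc] at this
        · intro e he
          obtain ⟨e, he', rfl⟩ := Finset.mem_image.1 he
          split_ifs with h
          · exact hd'F
          · have := hQF e he'
            rw [hl, Multiset.mem_cons, Multiset.mem_cons] at this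
            tauto
    have h3 := three_mul_card_le_card_letters F (by
      intro l hl
      match l, hl with
      | [], hl => exact absurd hl h0
      | [d], hl => exact absurd ⟨d, hl⟩ h1
      | [d, d'], hl => exact absurd ⟨d, d', hl⟩ h2
      | _ :: _ :: _ :: _, _ => simp)
    have h4 := h.two_mul_card_le hα hα' hlab hQF hQ
    omega

end Reduction

section Contraction

variable {Γ E D W Y : Type*} [Group Γ] [MulAction Γ E]

theorem eq_of_mem_letters {F : Multiset (List D)} (h : (letters F).Nodup) {l l' : List D}
    (hl : l ∈ F) (hl' : l' ∈ F) {e : D} (he : e ∈ l) (he' : e ∈ l') : l = l' := by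
  by_contra hne
  obtain ⟨F₁, rfl⟩ := Multiset.exists_cons_of_mem hl
  rw [letters_cons, Multiset.nodup_add] at h
  exact Multiset.disjoint_left.1 h.2.2 he
    (mem_letters.2 ⟨l', (Multiset.mem_cons.1 hl').resolve_left (Ne.symm hne), he'⟩)

/-- Every word of `F` is a sum of closed walks: each vertex is left as often as it is entered. -/
def WordsBalanced (α : D → D) (s : D → W) (F : Multiset (List D)) : Prop :=
  ∀ l ∈ F, ∀ f : W → ℤ, (l.map fun e => f (s e) - f (s (α e))).sum = 0

theorem WordsBalanced.sum_letters {α : D → D} {s : D → W} {F : Multiset (List D)}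
    (h : WordsBalanced α s F) (f : W → ℤ) :
    ((letters F).map fun e => f (s e) - f (s (α e))).sum = 0 := by
  induction F using Multiset.induction with
  | empty => simp [letters]
  | cons l F ih =>
    rw [letters_cons, Multiset.map_add, Multiset.sum_add,
      ih fun l' hl' => h l' (Multiset.mem_cons_of_mem hl')]
    simpa using h l (Multiset.mem_cons_self _ _) f

theorem letters_filter (F : Multiset (List D)) (P : D → Prop) [DecidablePred P] :
    letters (F.map fun l => l.filter P) = (letters F).filter P := by
  induction F using Multiset.induction with
  | empty => simp [letters]
  | cons l F ih => rw [Multiset.map_cons, letters_cons, letters_cons, Multiset.filter_add, ih]; simp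

theorem FacesConnected.contract {α : D → D} (hα : ∀ d, α (α d) = d) (hα' : ∀ d, α d ≠ d)
    {F : Multiset (List D)} (hn : (letters F).Nodup) (hcl : ∀ d ∈ letters F, α d ∈ letters F)
    (h : FacesConnected α F) {s : D → W} (hb : WordsBalanced α s F)
    {d : D} (hd : s d ≠ s (α d)) [DecidablePred fun e => e ≠ d ∧ e ≠ α d] :
    FacesConnected α (F.map fun l => l.filter fun e => e ≠ d ∧ e ≠ α d) := by
  classical
  intro P hP
  set φ : List D → List D := fun l => l.filter fun e => e ≠ d ∧ e ≠ α d with hφ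
  have hP1 : ∀ l ∈ F, P (φ l) → ∀ e ∈ l, e ≠ d → e ≠ α d → ∀ l' ∈ F, α e ∈ l' → P (φ l') := by
    intro l hl hPl e he h1 h2 l' hl' he'
    refine hP _ (Multiset.mem_map_of_mem _ hl) hPl e (by simp [hφ, he, h1, h2]) _
      (Multiset.mem_map_of_mem _ hl') ?_
    have h3 : α e ≠ d := fun h => h2 (by rw [← h, hα])
    have h4 : α e ≠ α d := fun h => h1 (by rw [← hα e, h, hα])
    simp [hφ, he', h3, h4]
  have hP2 : ∀ c, c = d ∨ c = α d → s c ≠ s (α c) → ∀ l ∈ F, P (φ l) → c ∈ l → ∀ l' ∈ F,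
      α c ∈ l' → P (φ l') := by
    intro c hc hs l hl hPl hcl' l' hl' hc'
    by_contra hPl'
    set G := F.filter fun l => P (φ l) with hG
    have hGF : ∀ {l}, l ∈ G → l ∈ F := fun hl => (Multiset.mem_filter.1 hl).1
    have hGle : letters G ≤ letters F := by
      have : G ≤ F := Multiset.filter_le _ _
      obtain ⟨H, hH⟩ := Multiset.le_iff_exists_add.1 this
      rw [hH, letters, letters, Multiset.add_bind]
      exact Multiset.le_add_right _ _
    have hGn : (letters G).Nodup := Multiset.nodup_of_le hGle hn
    have hcG : c ∈ letters G := mem_letters.2 ⟨l, Multiset.mem_filter.2 ⟨hl, hPl⟩, hcl'⟩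
    have hcG' : α c ∉ letters G := by
      intro hh
      obtain ⟨l'', hl'', hcl''⟩ := mem_letters.1 hh
      have := eq_of_mem_letters hn hl' (hGF hl'') hc' hcl''
      subst this
      exact hPl' (Multiset.mem_filter.1 hl'').2
    have hclG : ∀ e ∈ letters G, e ≠ c → α e ∈ letters G := by
      intro e he hec
      obtain ⟨l₁, hl₁, hel₁⟩ := mem_letters.1 he
      have hec' : e ≠ α c := by rintro rfl; exact hcG' he
      obtain ⟨l₂, hl₂, hel₂⟩ := mem_letters.1 (hcl e (mem_letters.2 ⟨l₁, hGF hl₁, hel₁⟩))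
      refine mem_letters.2 ⟨l₂, Multiset.mem_filter.2 ⟨hl₂, ?_⟩, hel₂⟩
      refine hP1 l₁ (hGF hl₁) (Multiset.mem_filter.1 hl₁).2 e hel₁ ?_ ?_ l₂ hl₂ hel₂
      · rcases hc with rfl | rfl
        · exact hec
        · rwa [hα] at hec'
      · rcases hc with rfl | rfl
        · exact hec'
        · exact hec
    have hbG : WordsBalanced α s G := fun l hl => hb l (hGF hl)
    have h0 := hbG.sum_letters (fun w => if w = s c then 1 else 0)
    have h1 : ((letters G).map fun e => (if s e = s c then (1:ℤ) else 0) -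
        (if s (α e) = s c then 1 else 0)).sum = ∑ e ∈ (letters G).toFinset,
        ((if s e = s c then (1:ℤ) else 0) - (if s (α e) = s c then 1 else 0)) := by
      rw [Finset.sum, Multiset.toFinset_val, hGn.dedup]
    rw [h1, ← Finset.add_sum_erase _ _ (Multiset.mem_toFinset.2 hcG)] at h0
    rw [Finset.sum_involution (fun e _ => α e)] at h0
    · simp [hs.symm] at h0
    · intro e _
      rw [hα]
      ring
    · intro e _ _
      exact hα' e
    · intro e he
      rw [Finset.mem_erase, Multiset.mem_toFinset] at he ⊢
      refine ⟨?_, hclG e he.2 he.1⟩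
      intro hh
      refine hcG' ?_
      rw [← hh, hα]
      exact he.2
    · intro e _
      exact hα e
  have key := h (fun l => P (φ l)) (by
    intro l hl hPl e he l' hl' he'
    by_cases h1 : e = d
    · subst h1
      exact hP2 e (.inl rfl) hd l hl hPl he l' hl' he'
    by_cases h2 : e = α d
    · subst h2
      exact hP2 (α d) (.inr rfl) (by rw [hα]; exact hd.symm) l hl hPl he l' hl' he'
    exact hP1 l hl hPl e he h1 h2 l' hl' he')
  simpa only [Multiset.mem_map, forall_exists_index, and_imp, forall_apply_eq_imp_iff₂] using key

theorem FlatPattern.typed_bound [DecidableEq Y] {α : D → D} (hα : ∀ d, α (α d) = d)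
    (hα' : ∀ d, α d ≠ d)
    {lab : D → E × E} (hlab : ∀ d, SameOrbit Γ (lab (α d)) (lab d).swap)
    {F : Multiset (List D)} (h : FlatPattern Γ α lab F)
    {s : D → W} (hb : WordsBalanced α s F) {Vs : Finset W} (hs : ∀ d ∈ letters F, s d ∈ Vs)
    (hχ : 2 * Vs.card + 2 * F.card = (letters F).card + 4)
    (ty : W → Y)
    (hty : ∀ d ∈ letters F, (lab d).1 = (lab d).2 → ty (s d) = ty (s (α d)))
    (hconn : ∀ a ∈ Vs, ∀ b ∈ Vs, ty a = ty b → Relation.ReflTransGen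
      (fun a b => ∃ d ∈ letters F, s d = a ∧ s (α d) = b ∧ (lab d).1 = (lab d).2) a b)
    {Q : Finset D} (hQF : ∀ d ∈ Q, d ∈ letters F) (hQ : Independent Γ lab Q) :
    Q.card = 0 ∨ (Q.card ≤ 1 ∧ (Vs.image ty).card = 2) ∨ Q.card + 6 ≤ 3 * (Vs.image ty).card := by
  classical
  induction hN : Vs.card using Nat.strong_induction_on generalizing F s Vs with
  | _ N ih =>
    subst hN
    by_cases hinj : Set.InjOn ty Vs
    · refine h.card_bound hα hα' hlab ?_ hQF hQ
      rw [Finset.card_image_of_injOn hinj]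
      omega
    · simp only [Set.InjOn, not_forall] at hinj
      obtain ⟨a, ha, b, hb', hab, hne⟩ := hinj
      have hd : ∃ d ∈ letters F, s d ≠ s (α d) ∧ (lab d).1 = (lab d).2 := by
        by_contra! hcon
        refine hne ?_
        have := hconn a ha b hb' hab
        clear hab hb' hne
        induction this with
        | refl => rfl
        | tail _ h1 ih' =>
          obtain ⟨d, hd, rfl, rfl, h2⟩ := h1
          rw [ih']
          by_contra h3
          exact hcon d hd h3 h2
      obtain ⟨d, hdF, hds, hdl⟩ := hd
      have hαF := h.closed d hdF
      set π : W → W := fun w => if w = s (α d) then s d else w with hπ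
      set F' := F.map fun l => l.filter fun e => e ≠ d ∧ e ≠ α d with hF'
      have hαl : (lab (α d)).1 = (lab (α d)).2 := (hlab d).eq_iff.2 hdl.symm
      have hletters : letters F' = (letters F).filter fun e => e ≠ d ∧ e ≠ α d :=
        letters_filter _ _
      have hmem : ∀ e, e ∈ letters F' ↔ e ∈ letters F ∧ e ≠ d ∧ e ≠ α d := by
        intro e; rw [hletters, Multiset.mem_filter]
      have hcard : (letters F').card + 2 = (letters F).card := by
        have h1 : letters F = d ::ₘ α d ::ₘ letters F' := by
          have hn' : (letters F').Nodup := by rw [hletters]; exact h.nodup.filter _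
          rw [Multiset.Nodup.ext h.nodup]
          · intro e
            rw [Multiset.mem_cons, Multiset.mem_cons, hmem]
            constructor
            · tauto
            · rintro (rfl | rfl | h) <;> tauto
          · rw [Multiset.nodup_cons, Multiset.nodup_cons]
            refine ⟨?_, ?_, hn'⟩
            · rw [Multiset.mem_cons, hmem]
              have := hα' d
              tauto
            · rw [hmem]; tauto
        rw [h1]; simp
      have hπd : π (s d) = π (s (α d)) := by simp [hπ]
      have hπt : ∀ w, ty (π w) = ty w := by
        intro w
        simp only [hπ]
        split_ifs with h1
        · rw [h1, hty d hdF hdl]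
        · rfl
      have hπV : ∀ w ∈ Vs, π w ∈ Vs.erase (s (α d)) := by
        intro w hw
        simp only [hπ]
        split_ifs with h1
        · exact Finset.mem_erase.2 ⟨hds, hs d hdF⟩
        · exact Finset.mem_erase.2 ⟨h1, hw⟩
      have hπid : ∀ w ∈ Vs.erase (s (α d)), π w = w := by
        intro w hw
        simp [hπ, (Finset.mem_erase.1 hw).1]
      have himg : (Vs.erase (s (α d))).image ty = Vs.image ty := by
        apply Finset.Subset.antisymm (Finset.image_subset_image (Finset.erase_subset _ _))
        intro y hy
        obtain ⟨w, hw, rfl⟩ := Finset.mem_image.1 hy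
        exact Finset.mem_image.2 ⟨π w, hπV w hw, hπt w⟩
      have hpat : FlatPattern Γ α lab F' := by
        refine ⟨by rw [hletters]; exact h.nodup.filter _, ?_, ?_,
          h.conn.contract hα hα' h.nodup h.closed hb hds⟩
        · intro e he
          rw [hmem] at he ⊢
          refine ⟨h.closed e he.1, fun h1 => he.2.2 (by rw [← h1, hα]), fun h1 => he.2.1 ?_⟩
          rw [← hα e, h1, hα]
        · intro l hl
          obtain ⟨l, hlF, rfl⟩ := Multiset.mem_map.1 hl
          obtain ⟨p, hp⟩ := h.flat l hlF
          refine ⟨p, develops_filter lab _ ?_ l p p hp⟩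
          intro e he
          by_cases h1 : e = d
          · rwa [h1]
          · have : e = α d := by tauto
            rwa [this]
      have := ih (Vs.erase (s (α d))).card (Finset.card_erase_lt_of_mem (hs _ hαF)) hpat
        (s := fun e => π (s e)) (Vs := Vs.erase (s (α d))) ?_ ?_ ?_ ?_ ?_ ?_ rfl
      · rwa [himg] at this
      · intro l hl f
        obtain ⟨l, hlF, rfl⟩ := Multiset.mem_map.1 hl
        rw [← hb l hlF fun w => f (π w)]
        clear hl hlF
        induction l with
        | nil => rfl
        | cons e l ihl =>
          by_cases he : e ≠ d ∧ e ≠ α d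
          · rw [List.filter_cons_of_pos (by simpa using he)]
            simp only [List.map_cons, List.sum_cons, ihl]
          · rw [List.filter_cons_of_neg (by simpa using he), ihl, List.map_cons, List.sum_cons]
            have : f (π (s e)) - f (π (s (α e))) = 0 := by
              by_cases h1 : e = d
              · rw [h1, hπd, sub_self]
              · have : e = α d := by tauto
                rw [this, hα, hπd, sub_self]
            rw [this, zero_add]
      · intro e he
        exact hπV _ (hs e ((hmem e).1 he).1)
      · rw [Finset.card_erase_of_mem (hs _ hαF), hF', Multiset.card_map, ← hF']
        have : 0 < Vs.card := Finset.card_pos.2 ⟨_, hs _ hαF⟩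
        omega
      · intro e he hl
        rw [hπt, hπt]
        exact hty e ((hmem e).1 he).1 hl
      · intro a ha b hb hab
        rw [← hπid a ha, ← hπid b hb]
        have := hconn a (Finset.mem_of_mem_erase ha) b (Finset.mem_of_mem_erase hb) hab
        clear hab hb ha
        induction this with
        | refl => exact .refl
        | tail _ h1 ih' =>
          obtain ⟨e, he, rfl, rfl, h2⟩ := h1
          by_cases h3 : e = d
          · rwa [h3, ← hπd, ← h3]
          by_cases h4 : e = α d
          · rw [h4] at ih'
            rwa [h4, hα, hπd]
          exact ih'.tail ⟨e, (hmem e).2 ⟨he, h3, h4⟩, rfl, rfl, h2⟩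
      · intro e he
        refine (hmem e).2 ⟨hQF e he, ?_, ?_⟩
        · rintro rfl; exact hQ.1 _ he hdl
        · rintro rfl; exact hQ.1 _ he hαl

end Contraction

section Labellings

open Relation

theorem reflTransGen_mono {A : Type*} {r p : A → A → Prop} (h : ∀ a b, r a b → p a b) {a b : A}
    (hab : ReflTransGen r a b) : ReflTransGen p a b := by
  induction hab with
  | refl => exact .refl
  | tail _ h' ih => exact ih.tail (h _ _ h')

/-- A combinatorial cell structure on the sphere: `α` reverses darts, `s` is the source map
and `F` lists the boundary words of the faces. -/
structure SphereComplex (W D : Type*) [Fintype W] where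
  α : D → D
  s : D → W
  F : Multiset (List D)
  invol : ∀ d, α (α d) = d
  nofix : ∀ d, α d ≠ d
  nodup : (letters F).Nodup
  mem_all : ∀ d, d ∈ letters F
  balanced : WordsBalanced α s F
  faces : FacesConnected α F
  euler : 2 * Fintype.card W + 2 * F.card = (letters F).card + 4
  graph : ∀ a b, ReflTransGen (fun a b => ∃ d, s d = a ∧ s (α d) = b) a b

variable {W D : Type*} [Fintype W]

/-- Steps along darts with equal end labels. -/
def SphereComplex.TrivStep (C : SphereComplex W D) {E : Type*} (lab : D → E × E) (a b : W) : Prop :=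
  ∃ d, C.s d = a ∧ C.s (C.α d) = b ∧ (lab d).1 = (lab d).2

/-- A flat equivariant labelling of the darts, with typed labels, such that vertices of the same
type are joined by trivially labelled darts. -/
structure Labelling (C : SphereComplex W D) (Γ E Y : Type*) [Group Γ] [MulAction Γ E] where
  lab : D → E × E
  tyE : E → Y
  ty : W → Y
  tyE_smul : ∀ (γ : Γ) e, tyE (γ • e) = tyE e
  tyE_fst : ∀ d, tyE (lab d).1 = ty (C.s d)
  tyE_snd : ∀ d, tyE (lab d).2 = ty (C.s (C.α d))
  symm : ∀ d, SameOrbit Γ (lab (C.α d)) (lab d).swap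
  flat : ∀ l ∈ C.F, ∃ p, Develops Γ lab l p p
  triv : ∀ a b, ty a = ty b → ReflTransGen (C.TrivStep lab) a b

variable {C : SphereComplex W D} {Γ E E' Y : Type*} [Group Γ] [MulAction Γ E] [MulAction Γ E']

namespace Labelling

variable (L : Labelling C Γ E Y)

/-- Two labels are linked if some dart carries them. -/
def Link (e e' : E) : Prop := ∃ d, SameOrbit Γ (L.lab d) (e, e')

variable {L}

theorem Link.symm {e e' : E} (h : L.Link e e') : L.Link e' e := by
  obtain ⟨d, hd⟩ := h
  exact ⟨C.α d, (L.symm d).trans hd.swap⟩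

theorem Link.smul {e e' : E} (h : L.Link e e') (γ : Γ) : L.Link (γ • e) (γ • e') := by
  obtain ⟨d, hd⟩ := h
  exact ⟨d, hd.trans ⟨γ, rfl⟩⟩

theorem tyE_eq_of_sameOrbit {a b : E × E} (h : SameOrbit Γ a b) :
    L.tyE a.1 = L.tyE b.1 ∧ L.tyE a.2 = L.tyE b.2 := by
  obtain ⟨γ, rfl⟩ := h
  exact ⟨(L.tyE_smul _ _).symm, (L.tyE_smul _ _).symm⟩

theorem Link.exists_dart {e e' : E} (h : L.Link e e') :
    ∃ d, L.ty (C.s d) = L.tyE e ∧ L.ty (C.s (C.α d)) = L.tyE e' := by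
  obtain ⟨d, hd⟩ := h
  have := L.tyE_eq_of_sameOrbit hd
  exact ⟨d, by rw [← L.tyE_fst, this.1], by rw [← L.tyE_snd, this.2]⟩

theorem flatPattern (L : Labelling C Γ E Y) : FlatPattern Γ C.α L.lab C.F :=
  ⟨C.nodup, fun _ _ => C.mem_all _, L.flat, C.faces⟩

theorem card_bound [DecidableEq Y] (L : Labelling C Γ E Y) {Q : Finset D}
    (hQ : Independent Γ L.lab Q) :
    Q.card = 0 ∨ (Q.card ≤ 1 ∧ (Finset.univ.image L.ty).card = 2) ∨
      Q.card + 6 ≤ 3 * (Finset.univ.image L.ty).card := by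
  refine L.flatPattern.typed_bound C.invol C.nofix L.symm C.balanced (fun _ _ => Finset.mem_univ _)
    C.euler L.ty ?_ ?_ (fun _ _ => C.mem_all _) hQ
  · intro d _ h
    rw [← L.tyE_fst, ← L.tyE_snd, h]
  · intro a _ b _ hab
    refine reflTransGen_mono ?_ (L.triv a b hab)
    rintro a b ⟨d, h⟩
    exact ⟨d, C.mem_all _, h⟩

theorem link_eq_of_two [DecidableEq Y] (L : Labelling C Γ E Y)
    (h2 : (Finset.univ.image L.ty).card = 2) {e e' : E} (h : L.Link e e')
    (hty : L.tyE e = L.tyE e') : e = e' := by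
  classical
  by_contra hne
  obtain ⟨d, hd⟩ := h
  have hd1 : (L.lab d).1 ≠ (L.lab d).2 := fun h => hne (hd.eq_iff.1 h)
  have hdt : L.tyE (L.lab d).1 = L.tyE (L.lab d).2 := by
    have := L.tyE_eq_of_sameOrbit hd
    rw [this.1, this.2, hty]
  obtain ⟨d', hd'⟩ : ∃ d', L.ty (C.s d') ≠ L.ty (C.s (C.α d')) := by
    by_contra! hcon
    obtain ⟨y, z, hyz, himg⟩ := Finset.card_eq_two.1 h2
    obtain ⟨a, -, rfl⟩ := Finset.mem_image.1 (show y ∈ Finset.univ.image L.ty by simp [himg])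
    obtain ⟨b, -, rfl⟩ := Finset.mem_image.1 (show z ∈ Finset.univ.image L.ty by simp [himg])
    refine hyz ?_
    have := C.graph a b
    clear hyz himg
    induction this with
    | refl => rfl
    | tail _ h ih =>
      obtain ⟨d, rfl, rfl⟩ := h
      rw [ih, hcon]
  rw [← L.tyE_fst, ← L.tyE_snd] at hd'
  have hdd : d ≠ d' := by rintro rfl; exact hd' hdt
  have h3 : ¬ SameOrbit Γ (L.lab d) (L.lab d') := fun h => by
    have := L.tyE_eq_of_sameOrbit h
    exact hd' (by rw [← this.1, ← this.2, hdt])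
  have h4 : ¬ SameOrbit Γ (L.lab d) (L.lab d').swap := fun h => by
    have := L.tyE_eq_of_sameOrbit h
    exact hd' (this.2.symm.trans (hdt.symm.trans this.1))
  have hI : Independent Γ L.lab {d, d'} := by
    refine ⟨?_, ?_⟩
    · intro x hx
      simp only [Finset.mem_insert, Finset.mem_singleton] at hx
      rcases hx with rfl | rfl
      · exact hd1
      · exact fun h => hd' (by rw [h])
    · intro x hx y hy hxy
      simp only [Finset.mem_insert, Finset.mem_singleton] at hx hy
      rcases hx with rfl | rfl <;> rcases hy with rfl | rfl
      · exact absurd rfl hxy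
      · exact ⟨h3, h4⟩
      · exact ⟨fun h => h3 h.symm, fun h => h4 h.swap.symm⟩
      · exact absurd rfl hxy
  have := L.card_bound hI
  rw [Finset.card_pair hdd, h2] at this
  omega

/-- Transport of a labelling along an equivariant map. -/
def map (L : Labelling C Γ E Y) (f : E → E') (hf : ∀ (γ : Γ) e, f (γ • e) = γ • f e)
    (tyE' : E' → Y) (hinv : ∀ (γ : Γ) e, tyE' (γ • e) = tyE' e) (g : Y → Y)
    (hg : ∀ e, tyE' (f e) = g (L.tyE e))
    (htriv : ∀ a b, g (L.ty a) = g (L.ty b) →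
      ReflTransGen (C.TrivStep fun d => (L.lab d).map f f) a b) : Labelling C Γ E' Y where
  lab d := (L.lab d).map f f
  tyE := tyE'
  ty w := g (L.ty w)
  tyE_smul := hinv
  tyE_fst d := by simp [hg, L.tyE_fst]
  tyE_snd d := by simp [hg, L.tyE_snd]
  symm d := by
    obtain ⟨γ, h⟩ := L.symm d
    refine ⟨γ, ?_⟩
    have h1 := congrArg (Prod.map f f) h
    simpa [Prod.ext_iff, hf] using h1
  flat l hl := by
    obtain ⟨p, hp⟩ := L.flat l hl
    refine ⟨f p, ?_⟩
    suffices ∀ (l : List D) p q, Develops Γ L.lab l p q →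
        Develops Γ (fun d => (L.lab d).map f f) l (f p) (f q) from this l p p hp
    intro l
    induction l with
    | nil => exact fun p q h => congrArg f h
    | cons d l ih =>
      rintro p q ⟨r, ⟨γ, h⟩, h'⟩
      refine ⟨f r, ⟨γ, ?_⟩, ih r q h'⟩
      have h1 := congrArg (Prod.map f f) h
      simpa [Prod.ext_iff, hf] using h1
  triv := htriv

theorem Link.map {f : E → E'} (hf : ∀ (γ : Γ) e, f (γ • e) = γ • f e)
    {tyE' : E' → Y} {hinv : ∀ (γ : Γ) e, tyE' (γ • e) = tyE' e} {g : Y → Y}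
    {hg : ∀ e, tyE' (f e) = g (L.tyE e)} {htriv} {e e' : E} (h : L.Link e e') :
    (L.map f hf tyE' hinv g hg htriv).Link (f e) (f e') := by
  obtain ⟨d, γ, h⟩ := h
  refine ⟨d, γ, ?_⟩
  have h1 := congrArg (Prod.map f f) h
  simpa [Prod.ext_iff, hf, Labelling.map] using h1

theorem trivStep_map (f : E → E') {a b : W} (h : ReflTransGen (C.TrivStep L.lab) a b) :
    ReflTransGen (C.TrivStep fun d => (L.lab d).map f f) a b :=
  reflTransGen_mono (fun _ _ ⟨d, h1, h2, h3⟩ => ⟨d, h1, h2, congrArg f h3⟩) h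

/-- The types in `B` span a connected part of the complex. -/
def ConnOn (L : Labelling C Γ E Y) (B : Finset Y) : Prop :=
  ∀ a b, L.ty a ∈ B → L.ty b ∈ B →
    ReflTransGen (fun a b => ∃ d, C.s d = a ∧ C.s (C.α d) = b ∧ L.ty a ∈ B ∧ L.ty b ∈ B) a b

section Collapse

variable [DecidableEq Y]

open Classical in
/-- The map sending labels of type in `B` to a single point. -/
noncomputable def pinch (L : Labelling C Γ E Y) (B : Finset Y) (e : E) : Option E :=
  if L.tyE e ∈ B then none else some e

theorem pinch_smul (L : Labelling C Γ E Y) (B : Finset Y) (γ : Γ) (e : E) :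
    L.pinch B (γ • e) = γ • L.pinch B e := by
  unfold pinch
  rw [L.tyE_smul]
  split_ifs <;> rfl

/-- Collapse the connected part of type in `B` to a single fixed label of type `b`. -/
noncomputable def collapse (L : Labelling C Γ E Y) (B : Finset Y) (b : Y) (hb : b ∈ B)
    (hB : L.ConnOn B) : Labelling C Γ (Option E) Y :=
  L.map (L.pinch B) (L.pinch_smul B) (fun o => o.elim b L.tyE)
    (by
      rintro γ (_ | e)
      · rfl
      · exact L.tyE_smul γ e)
    (fun y => if y ∈ B then b else y)
    (by
      intro e
      unfold pinch
      split_ifs <;> rfl)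
    (by
      intro a a' h
      by_cases h1 : L.ty a ∈ B <;> by_cases h2 : L.ty a' ∈ B
      · refine reflTransGen_mono ?_ (hB a a' h1 h2)
        rintro x y ⟨d, rfl, rfl, hx, hy⟩
        refine ⟨d, rfl, rfl, ?_⟩
        simp [pinch, L.tyE_fst, L.tyE_snd, hx, hy]
      · rw [if_pos h1, if_neg h2] at h
        exact absurd (h ▸ hb) h2
      · rw [if_neg h1, if_pos h2] at h
        exact absurd (h ▸ hb) h1
      · rw [if_neg h1, if_neg h2] at h
        exact trivStep_map _ (L.triv a a' h))

theorem Link.collapse {B : Finset Y} {b : Y} {hb : b ∈ B} {hB : L.ConnOn B} {e e' : E}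
    (h : L.Link e e') : (L.collapse B b hb hB).Link (L.pinch B e) (L.pinch B e') :=
  Link.map (L.pinch_smul B) h

theorem image_collapse {B : Finset Y} {b : Y} {hb : b ∈ B} {hB : L.ConnOn B} {T : Finset Y}
    (hT : Finset.univ.image L.ty = T) (hBT : B ⊆ T) :
    Finset.univ.image (L.collapse B b hb hB).ty = insert b (T \ B) := by
  subst hT
  ext y
  simp only [collapse, map, Finset.mem_image, Finset.mem_univ, true_and, Finset.mem_insert,
    Finset.mem_sdiff]
  constructor
  · rintro ⟨w, rfl⟩
    split_ifs with h
    · exact .inl rfl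
    · exact .inr ⟨⟨w, rfl⟩, h⟩
  · rintro (rfl | ⟨⟨w, rfl⟩, h⟩)
    · obtain ⟨w, -, hw⟩ := Finset.mem_image.1 (hBT hb)
      exact ⟨w, by rw [hw, if_pos hb]⟩
    · exact ⟨w, if_neg h⟩

end Collapse

end Labelling

end Labellings

section Arcs

open Relation

variable {W D : Type*} [Fintype W] {C : SphereComplex W D}
variable {Γ E E' Y : Type*} [Group Γ] [MulAction Γ E] [MulAction Γ E'] [DecidableEq Y]

/-- The combinatorial trace of an edge: it starts at the label `u`, enters its own region with
base label `xt`, follows the loop `γ` there, and leaves towards `γ • v`. -/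
structure Arc (Γ E : Type*) where
  u : E
  xt : E
  v : E
  γ : Γ

/-- The label pair joined by an arc. -/
def Arc.ends (a : Arc Γ E) : E × E := (a.u, a.γ • a.v)

/-- `a` is an arc with its own region of type `x`, between labels of types in `S`. -/
structure Labelling.IsArc (L : Labelling C Γ E Y) (S : Finset Y) (x : Y) (a : Arc Γ E) : Prop where
  ty_xt : L.tyE a.xt = x
  ty_u : L.tyE a.u ∈ S
  ty_v : L.tyE a.v ∈ S
  link_u : L.Link a.u a.xt
  link_v : L.Link a.xt a.v
  mem_closure : a.γ ∈ Subgroup.closure {γ : Γ | L.Link a.xt (γ • a.xt)}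
  transitive : ∀ e, L.tyE e = x → ∃ γ : Γ, γ • a.xt = e
  free : ∀ γ : Γ, γ • a.xt = a.xt → γ = 1
  nontriv : a.ends.1 ≠ a.ends.2

/-- A family of arcs with pairwise inequivalent ends. -/
structure Labelling.ArcSystem (L : Labelling C Γ E Y) (S X : Finset Y) (c : Y → Arc Γ E) :
    Prop where
  disj : Disjoint S X
  image_ty : Finset.univ.image L.ty = S ∪ X
  isArc : ∀ x ∈ X, L.IsArc S x (c x)
  indep : ∀ x ∈ X, ∀ x' ∈ X, x ≠ x' →
    ¬ SameOrbit Γ (c x).ends (c x').ends ∧ ¬ SameOrbit Γ (c x).ends (c x').ends.swap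

namespace Labelling

variable {L : Labelling C Γ E Y} {S X : Finset Y} {c : Y → Arc Γ E}

theorem IsArc.notMem {x : Y} {a : Arc Γ E} (h : L.IsArc S x a) (hd : Disjoint S X) :
    L.tyE a.u ∉ X ∧ L.tyE a.v ∉ X :=
  ⟨Finset.disjoint_left.1 hd h.ty_u, Finset.disjoint_left.1 hd h.ty_v⟩

open Classical in
/-- The map retracting all labels of arc regions to the starting points of the arcs. -/
noncomputable def retract (L : Labelling C Γ E Y) (X : Finset Y) (c : Y → Arc Γ E) (e : E) : E :=
  if h : L.tyE e ∈ X ∧ ∃ γ : Γ, γ • (c (L.tyE e)).xt = e then h.2.choose • (c (L.tyE e)).u else e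

theorem ArcSystem.retract_smul (h : L.ArcSystem S X c) {x : Y} (hx : x ∈ X) (γ : Γ) :
    L.retract X c (γ • (c x).xt) = γ • (c x).u := by
  have hty : L.tyE (γ • (c x).xt) = x := by rw [L.tyE_smul, (h.isArc x hx).ty_xt]
  have hex : L.tyE (γ • (c x).xt) ∈ X ∧ ∃ γ' : Γ,
      γ' • (c (L.tyE (γ • (c x).xt))).xt = γ • (c x).xt := by
    rw [hty]; exact ⟨hx, γ, rfl⟩
  rw [retract, dif_pos hex]
  have h1 := hex.2.choose_spec
  generalize hex.2.choose = δ at h1 ⊢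
  rw [hty] at h1 ⊢
  have : (γ⁻¹ * δ) • (c x).xt = (c x).xt := by rw [mul_smul, h1, inv_smul_smul]
  have h2 := (h.isArc x hx).free _ this
  rw [inv_mul_eq_one] at h2
  rw [h2]

theorem retract_of_notMem {e : E} (he : L.tyE e ∉ X) : L.retract X c e = e := by
  rw [retract, dif_neg fun h => he h.1]

theorem ArcSystem.retract_equivariant (h : L.ArcSystem S X c) (γ : Γ) (e : E) :
    L.retract X c (γ • e) = γ • L.retract X c e := by
  by_cases he : L.tyE e ∈ X
  · obtain ⟨δ, hδ⟩ := (h.isArc _ he).transitive e rfl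
    have h1 := h.retract_smul he δ
    have h2 := h.retract_smul he (γ * δ)
    rw [hδ] at h1
    rw [mul_smul, hδ] at h2
    rw [h1, h2, mul_smul]
  · rw [retract_of_notMem he, retract_of_notMem (by rwa [L.tyE_smul])]

/-- The labelling obtained by contracting every arc region to the starting point of its arc. -/
noncomputable def ArcSystem.contract (h : L.ArcSystem S X c) : Labelling C Γ E Y :=
  L.map (L.retract X c) h.retract_equivariant L.tyE L.tyE_smul
    (fun y => if y ∈ X then L.tyE (c y).u else y)
    (by
      intro e
      by_cases he : L.tyE e ∈ X
      · obtain ⟨δ, hδ⟩ := (h.isArc _ he).transitive e rfl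
        have h1 := h.retract_smul he δ
        rw [hδ] at h1
        rw [if_pos he, h1, L.tyE_smul]
      · rw [if_neg he, retract_of_notMem he])
    (by
      have key : ∀ a, ∃ a', ReflTransGen
          (C.TrivStep fun d => (L.lab d).map (L.retract X c) (L.retract X c)) a a' ∧
          ReflTransGen
          (C.TrivStep fun d => (L.lab d).map (L.retract X c) (L.retract X c)) a' a ∧
          L.ty a' = if L.ty a ∈ X then L.tyE (c (L.ty a)).u else L.ty a := by
        intro a
        by_cases ha : L.ty a ∈ X
        · have hA := h.isArc _ ha
          obtain ⟨d, hd⟩ := hA.link_u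
          obtain ⟨γ, hγ⟩ := hd.symm
          have hd1 : γ • (c (L.ty a)).u = (L.lab d).1 := congrArg Prod.fst hγ
          have hd2 : γ • (c (L.ty a)).xt = (L.lab d).2 := congrArg Prod.snd hγ
          have hu : L.tyE (γ • (c (L.ty a)).u) ∉ X := by
            rw [L.tyE_smul]
            exact (hA.notMem h.disj).1
          have htr : ((L.lab d).map (L.retract X c) (L.retract X c)).1 =
              ((L.lab d).map (L.retract X c) (L.retract X c)).2 := by
            simp only [Prod.map_fst, Prod.map_snd]
            rw [← hd1, ← hd2, h.retract_smul ha, retract_of_notMem hu]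
          have htr' : ((L.lab (C.α d)).map (L.retract X c) (L.retract X c)).1 =
              ((L.lab (C.α d)).map (L.retract X c) (L.retract X c)).2 := by
            obtain ⟨δ, hδ⟩ := (L.symm d).symm
            rw [← hδ]
            simp only [Prod.map_fst, Prod.map_snd, Prod.smul_fst, Prod.smul_snd,
              h.retract_equivariant, Prod.fst_swap, Prod.snd_swap] at htr ⊢
            rw [htr]
          have hty : L.ty a = L.ty (C.s (C.α d)) := by
            rw [← L.tyE_snd, ← hd2, L.tyE_smul, hA.ty_xt]
          refine ⟨C.s d, (trivStep_map _ (L.triv _ _ hty)).tail ?_,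
            .head ?_ (trivStep_map _ (L.triv _ _ hty.symm)), ?_⟩
          · exact ⟨C.α d, rfl, by rw [C.invol], htr'⟩
          · exact ⟨d, rfl, rfl, htr⟩
          · rw [if_pos ha, ← L.tyE_fst, ← hd1, L.tyE_smul]
        · exact ⟨a, .refl, .refl, by rw [if_neg ha]⟩
      intro a b hab
      obtain ⟨a', h1, -, h2⟩ := key a
      obtain ⟨b', -, h3, h4⟩ := key b
      exact h1.trans ((trivStep_map _ (L.triv a' b' (by rw [h2, h4, hab]))).trans h3))

theorem ArcSystem.image_contract (h : L.ArcSystem S X c) :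
    Finset.univ.image h.contract.ty = S := by
  have hi := h.image_ty
  ext y
  simp only [contract, map, Finset.mem_image, Finset.mem_univ, true_and]
  constructor
  · rintro ⟨w, rfl⟩
    split_ifs with hw
    · exact (h.isArc _ hw).ty_u
    · have : L.ty w ∈ S ∪ X := by rw [← hi]; simp
      exact (Finset.mem_union.1 this).resolve_right hw
  · intro hy
    have : y ∈ Finset.univ.image L.ty := by rw [hi]; exact Finset.mem_union_left _ hy
    obtain ⟨w, -, rfl⟩ := Finset.mem_image.1 this
    exact ⟨w, if_neg (Finset.disjoint_left.1 h.disj hy)⟩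

theorem ArcSystem.link_contract (h : L.ArcSystem S X c) {e e' : E} (hl : L.Link e e') :
    h.contract.Link (L.retract X c e) (L.retract X c e') :=
  Link.map h.retract_equivariant hl

theorem ArcSystem.ne_of_card_eq_two (h : L.ArcSystem S X c) (hS : S.card = 2) {x : Y} (hx : x ∈ X) :
    L.tyE (c x).u ≠ L.tyE (c x).v := by
  intro huv
  have hA := h.isArc x hx
  have h2 : (Finset.univ.image h.contract.ty).card = 2 := by rw [h.image_contract, hS]
  have hxt : L.retract X c (c x).xt = (c x).u := by simpa using h.retract_smul hx 1
  have h3 := h.link_contract hA.link_v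
  rw [hxt, retract_of_notMem (hA.notMem h.disj).2] at h3
  have h4 : (c x).u = (c x).v := h.contract.link_eq_of_two h2 h3 huv
  have h5 : Subgroup.closure {γ : Γ | L.Link (c x).xt (γ • (c x).xt)} ≤
      MulAction.stabilizer Γ (c x).u := by
    rw [Subgroup.closure_le]
    intro γ hγ
    have h6 := h.link_contract hγ
    rw [h.retract_smul hx, hxt] at h6
    exact (h.contract.link_eq_of_two h2 h6 (L.tyE_smul _ _).symm).symm
  have h7 : (c x).γ • (c x).u = (c x).u := h5 hA.mem_closure
  exact hA.nontriv (by simp only [Arc.ends]; rw [← h4, h7])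

theorem ArcSystem.card_le_of_simple (h : L.ArcSystem S X c) (hS : 3 ≤ S.card)
    (h1 : ∀ x ∈ X, (c x).γ = 1) : X.card + 6 ≤ 3 * S.card := by
  classical
  have hlink : ∀ x : X, ∃ d, SameOrbit Γ (h.contract.lab d) (c x).ends := by
    rintro ⟨x, hx⟩
    have hA := h.isArc x hx
    have hxt : L.retract X c (c x).xt = (c x).u := by simpa using h.retract_smul hx 1
    have h3 := h.link_contract hA.link_v
    rw [hxt, retract_of_notMem (hA.notMem h.disj).2] at h3
    rw [Arc.ends, h1 x hx, one_smul]
    exact h3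
  choose q hq using hlink
  have hinj : Function.Injective q := by
    intro x x' hxx
    by_contra hne
    refine (h.indep x x.2 x' x'.2 fun h => hne (Subtype.ext h)).1 ((hq x).symm.trans ?_)
    rw [hxx]
    exact hq x'
  have hI : Independent Γ h.contract.lab (Finset.univ.image q) := by
    refine ⟨?_, ?_⟩
    · intro d hd
      obtain ⟨x, -, rfl⟩ := Finset.mem_image.1 hd
      exact fun h' => (h.isArc x x.2).nontriv ((hq x).eq_iff.1 h')
    · intro d hd d' hd' hne
      obtain ⟨x, -, rfl⟩ := Finset.mem_image.1 hd
      obtain ⟨x', -, rfl⟩ := Finset.mem_image.1 hd'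
      have := h.indep x x.2 x' x'.2 fun h => hne (congrArg q (Subtype.ext h))
      exact ⟨fun h' => this.1 ((hq x).symm.trans (h'.trans (hq x'))),
        fun h' => this.2 ((hq x).symm.trans (h'.trans (hq x').swap))⟩
  have := h.contract.card_bound hI
  rw [h.image_contract, Finset.card_image_of_injective _ hinj] at this
  simp only [Finset.card_univ, Fintype.card_coe] at this
  omega

/-- The image of an arc in `Option E`. -/
def _root_.Arc.some (a : Arc Γ E) : Arc Γ (Option E) := ⟨a.u, a.xt, a.v, a.γ⟩

theorem pinch_of_notMem {B : Finset Y} {e : E} (he : L.tyE e ∉ B) : L.pinch B e = some e :=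
  if_neg he

theorem IsArc.collapse {x : Y} {a : Arc Γ E} (h : L.IsArc S x a) {B : Finset Y} {b : Y}
    {hb : b ∈ B} {hB : L.ConnOn B} (hx : x ∉ B) (hu : L.tyE a.u ∉ B) (hv : L.tyE a.v ∉ B)
    {S' : Finset Y} (hS : S \ B ⊆ S') :
    (L.collapse B b hb hB).IsArc S' x a.some := by
  have hxt : L.tyE a.xt ∉ B := by rwa [h.ty_xt]
  have hl : ∀ {e e'}, L.tyE e ∉ B → L.tyE e' ∉ B → L.Link e e' →
      (L.collapse B b hb hB).Link (some e) (some e') := by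
    intro e e' he he' h
    have := h.collapse (hb := hb) (hB := hB)
    rwa [pinch_of_notMem he, pinch_of_notMem he'] at this
  exact
  { ty_xt := h.ty_xt
    ty_u := hS (Finset.mem_sdiff.2 ⟨h.ty_u, hu⟩)
    ty_v := hS (Finset.mem_sdiff.2 ⟨h.ty_v, hv⟩)
    link_u := hl hu hxt h.link_u
    link_v := hl hxt hv h.link_v
    mem_closure := by
      refine Subgroup.closure_mono ?_ h.mem_closure
      intro γ hγ
      exact hl hxt (by rwa [L.tyE_smul]) hγ
    transitive := by
      rintro (_ | e) he
      · exact absurd (he ▸ hb) hx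
      · obtain ⟨γ, rfl⟩ := h.transitive e he
        exact ⟨γ, rfl⟩
    free := fun γ hγ => h.free γ (Option.some_injective _ hγ)
    nontriv := fun hh => h.nontriv (Option.some_injective _ hh) }

theorem sameOrbit_some {a b : E × E} :
    SameOrbit Γ (some a.1, some a.2) (some b.1, some b.2) ↔ SameOrbit Γ a b := by
  constructor
  · rintro ⟨γ, h⟩
    exact ⟨γ, Prod.ext (Option.some_injective _ (congrArg Prod.fst h))
      (Option.some_injective _ (congrArg Prod.snd h))⟩
  · rintro ⟨γ, rfl⟩
    exact ⟨γ, rfl⟩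

theorem ArcSystem.collapse_disjoint (h : L.ArcSystem S X c) {B : Finset Y} {b : Y} (hb : b ∈ B) :
    Disjoint (insert b (S \ B)) (X \ B) := by
  have := Finset.disjoint_left.1 h.disj
  rw [Finset.disjoint_left]
  intro y hy hy'
  rw [Finset.mem_insert, Finset.mem_sdiff] at hy
  rw [Finset.mem_sdiff] at hy'
  rcases hy with rfl | hy
  · exact hy'.2 hb
  · exact this hy.1 hy'.1

theorem ArcSystem.collapse_image (h : L.ArcSystem S X c) {B : Finset Y} {b : Y} (hBT : B ⊆ S ∪ X)
    {hb : b ∈ B} {hB : L.ConnOn B} :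
    Finset.univ.image (L.collapse B b hb hB).ty = insert b (S \ B) ∪ (X \ B) := by
  rw [image_collapse h.image_ty hBT, Finset.union_sdiff_distrib, Finset.insert_union]

theorem ArcSystem.collapse (h : L.ArcSystem S X c) {B : Finset Y} {b : Y} (hBT : B ⊆ S ∪ X)
    {hb : b ∈ B} {hB : L.ConnOn B}
    (hu : ∀ x ∈ X, x ∉ B → L.tyE (c x).u ∉ B ∧ L.tyE (c x).v ∉ B) :
    (L.collapse B b hb hB).ArcSystem (insert b (S \ B)) (X \ B) (fun x => (c x).some) where
  disj := h.collapse_disjoint hb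
  image_ty := h.collapse_image hBT
  isArc x hx := by
    rw [Finset.mem_sdiff] at hx
    have := hu x hx.1 hx.2
    exact (h.isArc x hx.1).collapse hx.2 this.1 this.2 (Finset.subset_insert _ _)
  indep x hx x' hx' hne := by
    have := h.indep x (Finset.mem_sdiff.1 hx).1 x' (Finset.mem_sdiff.1 hx').1 hne
    exact ⟨fun h' => this.1 (sameOrbit_some.1 h'), fun h' => this.2 (sameOrbit_some.1 h')⟩

end Labelling

end Arcs

section ArcBound

open Relation

variable {W D : Type*} [Fintype W] {C : SphereComplex W D}
variable {Γ E Y : Type*} [Group Γ] [MulAction Γ E] [DecidableEq Y]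

namespace Labelling

variable {L : Labelling C Γ E Y} {S X : Finset Y} {c : Y → Arc Γ E}

/-- No dart leads from a type in `B` to a type outside `B`, other than `x`. -/
def ClosedOff (L : Labelling C Γ E Y) (x : Y) (B : Finset Y) : Prop :=
  ∀ d, L.ty (C.s d) ∈ B → L.ty (C.s (C.α d)) ∈ B ∨ L.ty (C.s (C.α d)) = x

theorem ClosedOff.link {x : Y} {B : Finset Y} (h : L.ClosedOff x B) {e e' : E} (hl : L.Link e e')
    (he : L.tyE e ∈ B) : L.tyE e' ∈ B ∨ L.tyE e' = x := by
  obtain ⟨d, h1, h2⟩ := hl.exists_dart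
  rw [← h1] at he
  rw [← h2]
  exact h d he

theorem ClosedOff.exists_path {x : Y} {B : Finset Y} (h : L.ClosedOff x B) {w z : W}
    (hw : L.ty w ∈ B) (hz : L.ty z = x) :
    ∃ z', L.ty z' = x ∧ ReflTransGen (fun a b => ∃ d, C.s d = a ∧ C.s (C.α d) = b ∧
      L.ty a ∈ insert x B ∧ L.ty b ∈ insert x B) w z' := by
  have hp := C.graph w z
  replace hw : L.ty w ∈ insert x B := Finset.mem_insert_of_mem hw
  induction hp using ReflTransGen.head_induction_on with
  | refl => exact ⟨z, hz, .refl⟩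
  | @head a b hab hbz ih =>
    by_cases ha : L.ty a = x
    · exact ⟨a, ha, .refl⟩
    · obtain ⟨d, rfl, rfl⟩ := hab
      have hb : L.ty (C.s (C.α d)) ∈ insert x B := by
        have := h d ((Finset.mem_insert.1 hw).resolve_left ha)
        rw [Finset.mem_insert]
        tauto
      obtain ⟨z', hz', hp'⟩ := ih hb
      exact ⟨z', hz', .head ⟨d, rfl, rfl, hw, hb⟩ hp'⟩

theorem ClosedOff.exists_dart {x : Y} {B : Finset Y} (h : L.ClosedOff x B) (hx : x ∉ B) {w z : W}
    (hw : L.ty w ∈ B) (hz : L.ty z = x) : ∃ d, L.ty (C.s d) ∈ B ∧ L.ty (C.s (C.α d)) = x := by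
  by_contra! hcon
  have hp := C.graph w z
  suffices L.ty z ∈ B from hx (hz ▸ this)
  clear hz
  induction hp with
  | refl => exact hw
  | tail _ hs ih =>
    obtain ⟨d, rfl, rfl⟩ := hs
    exact (h d ih).resolve_right (hcon d ih)

theorem triv_path {B : Finset Y} {a b : W} (ha : L.ty a ∈ B) (hab : L.ty a = L.ty b) :
    ReflTransGen (fun a b => ∃ d, C.s d = a ∧ C.s (C.α d) = b ∧ L.ty a ∈ B ∧ L.ty b ∈ B) a b := by
  have hp := L.triv a b hab
  clear hab
  suffices ReflTransGen (fun a b => ∃ d, C.s d = a ∧ C.s (C.α d) = b ∧ L.ty a ∈ B ∧ L.ty b ∈ B) a b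
      ∧ L.ty b ∈ B from this.1
  induction hp with
  | refl => exact ⟨.refl, ha⟩
  | tail _ hs ih =>
    obtain ⟨d, rfl, rfl, hd⟩ := hs
    have : L.ty (C.s (C.α d)) = L.ty (C.s d) := by rw [← L.tyE_snd, ← L.tyE_fst d, hd]
    have hB : L.ty (C.s (C.α d)) ∈ B := this ▸ ih.2
    exact ⟨ih.1.tail ⟨d, rfl, rfl, ih.2, hB⟩, hB⟩

theorem path_symm {P : W → Prop} {a b : W}
    (h : ReflTransGen (fun a b => ∃ d, C.s d = a ∧ C.s (C.α d) = b ∧ P a ∧ P b) a b) :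
    ReflTransGen (fun a b => ∃ d, C.s d = a ∧ C.s (C.α d) = b ∧ P a ∧ P b) b a := by
  have hs : Std.Symm (fun a b => ∃ d, C.s d = a ∧ C.s (C.α d) = b ∧ P a ∧ P b) := ⟨by
    rintro a b ⟨d, rfl, rfl, h1, h2⟩
    exact ⟨C.α d, rfl, by rw [C.invol], h2, h1⟩⟩
  exact ReflTransGen.stdSymm.symm _ _ h

theorem ClosedOff.connOn_insert {x : Y} {B : Finset Y} (h : L.ClosedOff x B) {z : W}
    (hz : L.ty z = x) : L.ConnOn (insert x B) := by
  have key : ∀ a, L.ty a ∈ insert x B → ∃ z', L.ty z' = x ∧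
      ReflTransGen (fun a b => ∃ d, C.s d = a ∧ C.s (C.α d) = b ∧
      L.ty a ∈ insert x B ∧ L.ty b ∈ insert x B) a z' := by
    intro a ha
    rcases Finset.mem_insert.1 ha with ha | ha
    · exact ⟨a, ha, .refl⟩
    · exact h.exists_path ha hz
  intro a b ha hb
  obtain ⟨z₁, h1, h2⟩ := key a ha
  obtain ⟨z₂, h3, h4⟩ := key b hb
  exact h2.trans ((triv_path (by simp [h1]) (h1.trans h3.symm)).trans
    (path_symm (P := fun a => L.ty a ∈ insert x B) h4))

open Classical in
/-- The types reachable from `z` without meeting the type `x`. -/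
noncomputable def comp (L : Labelling C Γ E Y) (x : Y) (z : W) : Finset Y :=
  (Finset.univ.filter fun w => ReflTransGen (fun a b => ∃ d, C.s d = a ∧ C.s (C.α d) = b ∧
    L.ty a ≠ x ∧ L.ty b ≠ x) z w).image L.ty

theorem mem_comp {x : Y} {z w : W} (hz : L.ty z ≠ x) : L.ty w ∈ L.comp x z ↔
    ReflTransGen (fun a b => ∃ d, C.s d = a ∧ C.s (C.α d) = b ∧ L.ty a ≠ x ∧ L.ty b ≠ x) z w := by
  simp only [comp, Finset.mem_image, Finset.mem_filter, Finset.mem_univ, true_and]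
  constructor
  · rintro ⟨w', h, hw⟩
    have hw' : L.ty w' ≠ x := by
      cases h with
      | refl => exact hz
      | tail _ h => obtain ⟨d, -, -, -, h⟩ := h; exact h
    refine h.trans (reflTransGen_mono ?_ (triv_path (B := {L.ty w'}) (by simp) hw))
    rintro a b ⟨d, h1, h2, h3, h4⟩
    rw [Finset.mem_singleton] at h3 h4
    exact ⟨d, h1, h2, h3 ▸ hw', h4 ▸ hw'⟩
  · exact fun h => ⟨w, h, rfl⟩

theorem notMem_comp {x : Y} {z : W} (hz : L.ty z ≠ x) : x ∉ L.comp x z := by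
  simp only [comp, Finset.mem_image, Finset.mem_filter, Finset.mem_univ, true_and, not_exists,
    not_and]
  intro w h
  cases h with
  | refl => exact hz
  | tail _ h => obtain ⟨d, -, -, -, h⟩ := h; exact h

theorem comp_connOn {x : Y} {z : W} (hz : L.ty z ≠ x) : L.ConnOn (L.comp x z) := by
  have key : ∀ w, L.ty w ∈ L.comp x z → ReflTransGen (fun a b => ∃ d, C.s d = a ∧
      C.s (C.α d) = b ∧ L.ty a ∈ L.comp x z ∧ L.ty b ∈ L.comp x z) z w := by
    intro w hw
    rw [mem_comp hz] at hw
    induction hw with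
    | refl => exact .refl
    | tail h1 h2 ih =>
      have h3 := (mem_comp hz).2 h1
      have h4 := (mem_comp hz).2 (h1.tail h2)
      obtain ⟨d, hd1, hd2, -, -⟩ := h2
      exact ih.tail ⟨d, hd1, hd2, h3, h4⟩
  intro a b ha hb
  exact (path_symm (P := fun a => L.ty a ∈ L.comp x z) (key a ha)).trans (key b hb)

theorem comp_closedOff {x : Y} {z : W} (hz : L.ty z ≠ x) : L.ClosedOff x (L.comp x z) := by
  intro d hd
  by_cases h : L.ty (C.s (C.α d)) = x
  · exact .inr h
  · left
    rw [mem_comp hz] at hd ⊢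
    refine hd.tail ⟨d, rfl, rfl, ?_, h⟩
    intro h'
    have h2 := (mem_comp hz).2 hd
    rw [h'] at h2
    exact notMem_comp hz h2

theorem ClosedOff.compl {x : Y} {A B : Finset Y} (h : L.ClosedOff x A) (hxB : x ∉ B)
    (hAB : Disjoint A B) (hT : ∀ w, L.ty w ≠ x → L.ty w ∈ A ∨ L.ty w ∈ B) : L.ClosedOff x B := by
  intro d hd
  by_cases hx : L.ty (C.s (C.α d)) = x
  · exact .inr hx
  · left
    refine (hT _ hx).resolve_left fun hA => ?_
    have := h _ hA
    rw [C.invol] at this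
    rcases this with h1 | h1
    · exact Finset.disjoint_left.1 hAB h1 hd
    · exact hxB (h1 ▸ hd)

/-- The bound for arc systems on a label type. -/
def ArcSystem.Bounded (C : SphereComplex W D) (Γ E Y : Type*) [Group Γ] [MulAction Γ E]
    [DecidableEq Y] (N : ℕ) : Prop :=
  ∀ (L : Labelling C Γ E Y) (S X : Finset Y) (c : Y → Arc Γ E), L.ArcSystem S X c →
    {x ∈ (X : Set Y) | (c x).γ ≠ 1}.ncard < N → 3 ≤ S.card → X.card + 6 ≤ 3 * S.card

theorem ArcSystem.ends_mem (h : L.ArcSystem S X c) {x x' : Y} (hx : x ∈ X) (hx' : x' ∈ X)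
    {B : Finset Y} (hB : L.ClosedOff x B) (hxB : x' ∈ B) :
    L.tyE (c x').u ∈ B ∧ L.tyE (c x').v ∈ B := by
  have hA := h.isArc x' hx'
  have hS : ∀ {y}, y ∈ S → y ≠ x := fun hy hyx =>
    Finset.disjoint_left.1 h.disj hy (hyx ▸ hx)
  exact ⟨(hB.link hA.link_u.symm (by rwa [hA.ty_xt])).resolve_right (hS hA.ty_u),
    (hB.link hA.link_v (by rwa [hA.ty_xt])).resolve_right (hS hA.ty_v)⟩

theorem ArcSystem.cut (h : L.ArcSystem S X c) {N : ℕ} {x : Y} (hx : x ∈ X)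
    (hN : {x ∈ (X : Set Y) | (c x).γ ≠ 1}.ncard ≤ N) (hγ : (c x).γ ≠ 1)
    (IH : ArcSystem.Bounded C Γ (Option E) Y N)
    {A B : Finset Y} (hAB : Disjoint A B) (hT : S ∪ X = insert x (A ∪ B)) (hxA : x ∉ A)
    (hxB : x ∉ B) (hAc : L.ConnOn A) (hA : L.ClosedOff x A) (hB : L.ClosedOff x B)
    {q : E} (hqS : L.tyE q ∈ S) (hqB : L.tyE q ∈ B) (hq : L.Link q (c x).xt)
    (hAne : A.Nonempty) (hNB : 2 ≤ (S ∩ B).card) : X.card + 6 ≤ 3 * S.card := by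
  classical
  obtain ⟨a, ha⟩ := hAne
  have hxS : x ∉ S := fun hxS => Finset.disjoint_left.1 h.disj hxS hx
  have hmem : ∀ y, (y ∈ S ∨ y ∈ X) ↔ (y = x ∨ y ∈ A ∨ y ∈ B) := by
    intro y
    have : y ∈ S ∪ X ↔ y ∈ insert x (A ∪ B) := by rw [hT]
    simpa using this
  have hAB' : ∀ y, y ∈ A → y ∉ B := fun y hy => Finset.disjoint_left.1 hAB hy
  have hexists : ∀ y, y ∈ S ∪ X → ∃ w, L.ty w = y := by
    intro y hy
    rw [← h.image_ty] at hy
    simpa using hy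
  obtain ⟨z, hz⟩ := hexists x (by simp [hx])
  obtain ⟨wa, hwa⟩ := hexists a (by rw [hT]; simp [ha])
  have hxarc := h.isArc x hx
  -- cardinalities
  have hScard : S.card = (S ∩ A).card + (S ∩ B).card := by
    rw [← Finset.card_union_of_disjoint, ← Finset.inter_union_distrib_left]
    · congr 1
      ext y
      have := hmem y
      have := hxS
      simp only [Finset.mem_inter, Finset.mem_union]
      constructor
      · intro hy
        refine ⟨hy, ?_⟩
        have hyx : y ≠ x := by rintro rfl; exact hxS hy
        tauto
      · exact fun h => h.1
    · exact hAB.mono Finset.inter_subset_right Finset.inter_subset_right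
  have hXcard : X.card = (X ∩ A).card + (X ∩ B).card + 1 := by
    have : X = insert x ((X ∩ A) ∪ (X ∩ B)) := by
      ext y
      have := hmem y
      simp only [Finset.mem_inter, Finset.mem_union, Finset.mem_insert]
      constructor
      · intro hy
        tauto
      · rintro (rfl | h | h)
        · exact hx
        · exact h.1
        · exact h.1
    rw [this, Finset.card_insert_of_notMem, Finset.card_union_of_disjoint, ← this]
    · exact hAB.mono Finset.inter_subset_right Finset.inter_subset_right
    · simp [hxA, hxB]
  have hfin : {x ∈ (X : Set Y) | (c x).γ ≠ 1}.Finite := X.finite_toSet.subset fun y hy => hy.1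
  have hNA : 1 ≤ (S ∩ A).card := by
    rw [Nat.one_le_iff_ne_zero, Finset.card_ne_zero]
    rcases (hmem a).2 (.inr (.inl ha)) with haS | haX
    · exact ⟨a, by simp [haS, ha]⟩
    · exact ⟨_, Finset.mem_inter.2 ⟨(h.isArc a haX).ty_u, (h.ends_mem hx haX hA ha).1⟩⟩
  -- the part on the side of `B`, keeping a simple arc for `x`
  have hBbound : (X ∩ B).card + 1 + 6 ≤ 3 * ((S ∩ B).card + 1) := by
    have hAT : A ⊆ S ∪ X := by rw [hT]; intro y hy; simp [hy]
    set c' : Y → Arc Γ (Option E) :=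
      Function.update (fun y => (c y).some) x ⟨some q, some (c x).xt, none, 1⟩ with hc'
    have hc'x : c' x = ⟨some q, some (c x).xt, none, 1⟩ := Function.update_self ..
    have hc'y : ∀ y, y ≠ x → c' y = (c y).some := fun y hy => Function.update_of_ne hy ..
    have hsys : (L.collapse A a ha hAc).ArcSystem (insert a (S \ A)) (X \ A) c' := by
      refine ⟨h.collapse_disjoint ha, h.collapse_image hAT, ?_, ?_⟩
      · intro y hy
        rw [Finset.mem_sdiff] at hy
        by_cases hyx : y = x
        · subst hyx
          rw [hc'x]
          have hxt : L.tyE (c y).xt ∉ A := by rwa [hxarc.ty_xt]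
          have hqA : L.tyE q ∉ A := fun hh => hAB' _ hh hqB
          refine ⟨hxarc.ty_xt, ?_, Finset.mem_insert_self _ _, ?_, ?_, one_mem _, ?_, ?_, ?_⟩
          · exact Finset.mem_insert_of_mem (Finset.mem_sdiff.2 ⟨hqS, hqA⟩)
          · have := hq.collapse (hb := ha) (hB := hAc)
            rwa [pinch_of_notMem hqA, pinch_of_notMem hxt] at this
          · obtain ⟨d, hd1, hd2⟩ := hA.exists_dart hxA (hwa ▸ ha) hz
            obtain ⟨γ, hγ'⟩ := hxarc.transitive (L.lab d).2 (by rw [L.tyE_snd, hd2])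
            have hl : L.Link (c y).xt (γ⁻¹ • (L.lab d).1) := by
              have : L.Link (L.lab d).2 (L.lab d).1 := Link.symm ⟨d, SameOrbit.refl _⟩
              rw [← hγ'] at this
              simpa using this.smul γ⁻¹
            have := hl.collapse (hb := ha) (hB := hAc)
            rwa [pinch_of_notMem hxt, show L.pinch A (γ⁻¹ • (L.lab d).1) = none from
              if_pos (by rwa [L.tyE_smul, L.tyE_fst])] at this
          · rintro (_ | e) he
            · exact absurd ((show a = y from he) ▸ ha) hxA
            · obtain ⟨γ, rfl⟩ := hxarc.transitive e he
              exact ⟨γ, rfl⟩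
          · exact fun γ hγ => hxarc.free γ (Option.some_injective _ hγ)
          · simp [Arc.ends]
        · rw [hc'y y hyx]
          have hyB : y ∈ B := by
            have := hmem y
            tauto
          have := h.ends_mem hx hy.1 hB hyB
          exact (h.isArc y hy.1).collapse hy.2 (fun hh => hAB' _ hh this.1)
            (fun hh => hAB' _ hh this.2) (Finset.subset_insert _ _)
      · have hno : ∀ y, y ≠ x → ¬ SameOrbit Γ (c' x).ends (c' y).ends ∧
            ¬ SameOrbit Γ (c' x).ends (c' y).ends.swap := by
          intro y hyx
          rw [hc'x, hc'y y hyx]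
          constructor
          · rintro ⟨γ, hγ'⟩
            simpa [Arc.ends, Arc.some] using congrArg Prod.snd hγ'
          · rintro ⟨γ, hγ'⟩
            simpa [Arc.ends, Arc.some] using congrArg Prod.snd hγ'
        intro y hy y' hy' hne
        by_cases hyx : y = x
        · subst hyx
          exact hno y' hne.symm
        by_cases hyx' : y' = x
        · subst hyx'
          have := hno y hne
          exact ⟨fun h => this.1 h.symm, fun h => this.2 h.symm.swap⟩
        rw [hc'y y hyx, hc'y y' hyx']
        have := h.indep y (Finset.mem_sdiff.1 hy).1 y' (Finset.mem_sdiff.1 hy').1 hne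
        exact ⟨fun h' => this.1 (sameOrbit_some.1 h'), fun h' => this.2 (sameOrbit_some.1 h')⟩
    have h1 : (insert a (S \ A)).card = (S ∩ B).card + 1 := by
      rw [Finset.card_insert_of_notMem (by simp [ha])]
      have := Finset.card_sdiff_add_card_inter S A
      omega
    have h2 : (X \ A).card = (X ∩ B).card + 1 := by
      have := Finset.card_sdiff_add_card_inter X A
      omega
    rw [← h1, ← h2]
    refine IH _ _ _ _ hsys (lt_of_lt_of_le (Set.ncard_lt_ncard ?_ hfin) hN) (by omega)
    refine ⟨?_, ?_⟩
    · rintro y ⟨hy, hyγ⟩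
      have hyx : y ≠ x := by
        rintro rfl
        rw [hc'x] at hyγ
        exact hyγ rfl
      rw [hc'y y hyx] at hyγ
      exact ⟨(Finset.mem_sdiff.1 hy).1, hyγ⟩
    · intro hsub
      have := (hsub ⟨hx, hγ⟩).2
      rw [hc'x] at this
      exact this rfl
  -- the part on the side of `A`
  have hBx : insert x B ⊆ S ∪ X := by rw [hT]; intro y hy; simp at hy ⊢; tauto
  have hsys := h.collapse (b := x) (hb := Finset.mem_insert_self x B)
    (hB := hB.connOn_insert hz) hBx (by
      intro y hy hyB
      rw [Finset.mem_insert, not_or] at hyB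
      have hyA : y ∈ A := by
        have := hmem y
        tauto
      have := h.ends_mem hx hy hA hyA
      simp only [Finset.mem_insert, not_or]
      exact ⟨⟨fun hh => hxA (hh ▸ this.1), hAB' _ this.1⟩,
        ⟨fun hh => hxA (hh ▸ this.2), hAB' _ this.2⟩⟩)
  have h1 : (insert x (S \ insert x B)).card = (S ∩ A).card + 1 := by
    rw [Finset.card_insert_of_notMem (by simp)]
    have : S \ insert x B = S ∩ A := by
      ext y
      have h1 := hmem y
      have h2 := hAB' y
      have h3 : y ∈ S → y ≠ x := by rintro hy rfl; exact hxS hy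
      simp only [Finset.mem_sdiff, Finset.mem_insert, Finset.mem_inter]
      constructor
      · rintro ⟨h4, h5⟩
        exact ⟨h4, by tauto⟩
      · rintro ⟨h4, h5⟩
        exact ⟨h4, by tauto⟩
    rw [this]
  have h2 : X \ insert x B = X ∩ A := by
    ext y
    have h1 := hmem y
    have h2 := hAB' y
    simp only [Finset.mem_sdiff, Finset.mem_insert, Finset.mem_inter]
    constructor
    · rintro ⟨h4, h5⟩
      exact ⟨h4, by tauto⟩
    · rintro ⟨h4, h5⟩
      refine ⟨h4, ?_⟩
      rintro (rfl | h6)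
      · exact hxA h5
      · exact h2 h5 h6
  have hAbound : (X ∩ A).card = 0 ∧ (S ∩ A).card = 1 ∨
      (X ∩ A).card + 6 ≤ 3 * ((S ∩ A).card + 1) := by
    by_cases hNA2 : (S ∩ A).card = 1
    · left
      refine ⟨?_, hNA2⟩
      rw [Finset.card_eq_zero, Finset.eq_empty_iff_forall_notMem]
      intro y hy
      have hyX := (Finset.mem_inter.1 hy).1
      have := hsys.ne_of_card_eq_two (by omega) (x := y) (by rw [h2]; exact hy)
      refine this ?_
      obtain ⟨t, ht⟩ := Finset.card_eq_one.1 hNA2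
      have hyA := h.ends_mem hx hyX hA (Finset.mem_inter.1 hy).2
      have e1 : L.tyE (c y).u ∈ ({t} : Finset Y) := by
        rw [← ht]; exact Finset.mem_inter.2 ⟨(h.isArc y hyX).ty_u, hyA.1⟩
      have e2 : L.tyE (c y).v ∈ ({t} : Finset Y) := by
        rw [← ht]; exact Finset.mem_inter.2 ⟨(h.isArc y hyX).ty_v, hyA.2⟩
      exact (Finset.mem_singleton.1 e1).trans (Finset.mem_singleton.1 e2).symm
    · right
      rw [← h1, ← h2]
      refine IH _ _ _ _ hsys (lt_of_lt_of_le (Set.ncard_lt_ncard ?_ hfin) hN) (by omega)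
      refine ⟨?_, ?_⟩
      · rintro y ⟨hy, hyγ⟩
        exact ⟨(Finset.mem_sdiff.1 hy).1, hyγ⟩
      · intro hsub
        have := (hsub ⟨hx, hγ⟩).1
        simp at this
  omega

theorem ArcSystem.comp_eq_of_eq_one (h : L.ArcSystem S X c) {x : Y} (hx : x ∈ X)
    (hγ : (c x).γ ≠ 1) {z : W} (hz : L.ty z ≠ x) : ∃ w, L.ty w ≠ x ∧ L.ty w ∉ L.comp x z := by
  by_contra! hcon
  have hcomp : L.comp x z = (S ∪ X).erase x := by
    ext y
    rw [Finset.mem_erase, ← h.image_ty]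
    constructor
    · intro hy
      refine ⟨fun hh => notMem_comp hz (hh ▸ hy), ?_⟩
      simp only [comp, Finset.mem_image] at hy
      obtain ⟨w, -, hw⟩ := hy
      simp [← hw]
    · rintro ⟨h1, h2⟩
      obtain ⟨w, -, rfl⟩ := Finset.mem_image.1 h2
      exact hcon w h1
  have hzz : L.ty z ∈ L.comp x z := (mem_comp hz).2 .refl
  have hsub : L.comp x z ⊆ S ∪ X := by rw [hcomp]; exact Finset.erase_subset _ _
  set L' := L.collapse (L.comp x z) (L.ty z) hzz (comp_connOn hz) with hL'
  have h2 : (Finset.univ.image L'.ty).card = 2 := by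
    rw [hL', image_collapse h.image_ty hsub]
    have : (S ∪ X) \ L.comp x z = {x} := by
      rw [hcomp, Finset.sdiff_erase_self (by simp [hx])]
    rw [this, Finset.card_pair hz]
  have hA := h.isArc x hx
  have hxt : L.tyE (c x).xt ∉ L.comp x z := by rw [hA.ty_xt]; exact notMem_comp hz
  refine hγ ?_
  rw [← Subgroup.mem_bot]
  refine (Subgroup.closure_le _).2 ?_ hA.mem_closure
  intro γ hγ'
  have h3 := hγ'.collapse (hb := hzz) (hB := comp_connOn hz)
  rw [pinch_of_notMem hxt, pinch_of_notMem (by rwa [L.tyE_smul])] at h3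
  have h4 := L'.link_eq_of_two h2 h3 (L.tyE_smul _ _).symm
  exact hA.free γ (Option.some_injective _ h4).symm

theorem ArcSystem.bounded (N : ℕ) {Γ : Type*} {E : Type*} {Y : Type*} [Group Γ] [MulAction Γ E]
    [DecidableEq Y] : ArcSystem.Bounded C Γ E Y N := by
  classical
  induction N generalizing E with
  | zero => exact fun _ _ _ _ _ h => absurd h (Nat.not_lt_zero _)
  | succ N IH =>
    intro L S X c h hN hS
    by_cases hsimple : ∀ x ∈ X, (c x).γ = 1
    · exact h.card_le_of_simple hS hsimple
    push Not at hsimple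
    obtain ⟨x, hx, hγ⟩ := hsimple
    have hxS : x ∉ S := fun hxS => Finset.disjoint_left.1 h.disj hxS hx
    have hxarc := h.isArc x hx
    have hexists : ∀ y, y ∈ S ∪ X → ∃ w, L.ty w = y := by
      intro y hy
      rw [← h.image_ty] at hy
      simpa using hy
    have hall : ∀ w, L.ty w ∈ S ∪ X := by
      intro w
      rw [← h.image_ty]
      simp
    have hne : ∀ {y}, y ∈ S → y ≠ x := by
      rintro y hy rfl
      exact hxS hy
    obtain ⟨zu, hzu⟩ := hexists (L.tyE (c x).u) (Finset.mem_union_left _ hxarc.ty_u)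
    obtain ⟨zv, hzv⟩ := hexists (L.tyE (c x).v) (Finset.mem_union_left _ hxarc.ty_v)
    have hzux : L.ty zu ≠ x := by rw [hzu]; exact hne hxarc.ty_u
    have hzvx : L.ty zv ≠ x := by rw [hzv]; exact hne hxarc.ty_v
    obtain ⟨w, hwx, hwu⟩ := h.comp_eq_of_eq_one hx hγ hzux
    have hself : ∀ {z}, L.ty z ≠ x → L.ty z ∈ L.comp x z := fun hz => (mem_comp hz).2 .refl
    have hcompT : ∀ z, L.comp x z ⊆ S ∪ X := by
      intro z y hy
      simp only [comp, Finset.mem_image] at hy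
      obtain ⟨w, -, rfl⟩ := hy
      exact hall w
    -- splitting off the component of `z`
    have split : ∀ z, L.ty z ≠ x → ∀ q, L.tyE q ∈ S → L.tyE q ∉ L.comp x z →
        L.Link q (c x).xt → 2 ≤ (S \ L.comp x z).card → X.card + 6 ≤ 3 * S.card := by
      intro z hz q hqS hq hlink hcard
      have hAx := notMem_comp hz
      have hdisj : Disjoint (L.comp x z) (((S ∪ X) \ L.comp x z).erase x) :=
        Finset.disjoint_sdiff.mono_right (Finset.erase_subset _ _)
      refine h.cut (N := N) (A := L.comp x z) (B := ((S ∪ X) \ L.comp x z).erase x) hx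
        (Nat.lt_succ_iff.1 hN) hγ IH hdisj ?_ hAx (by simp)
        (comp_connOn hz) (comp_closedOff hz) ?_ hqS ?_ hlink ⟨_, hself hz⟩ ?_
      · ext y
        have := @hcompT z y
        simp only [Finset.mem_union, Finset.mem_insert, Finset.mem_erase, Finset.mem_sdiff] at *
        constructor
        · tauto
        · rintro (rfl | h1 | h1)
          · exact .inr hx
          · exact this h1
          · exact h1.2.1
      · refine (comp_closedOff hz).compl (by simp) hdisj ?_
        intro w hw
        have := hall w
        simp only [Finset.mem_erase, Finset.mem_sdiff]
        tauto
      · simp only [Finset.mem_erase, Finset.mem_sdiff, Finset.mem_union]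
        exact ⟨hne hqS, .inl hqS, hq⟩
      · refine hcard.trans (Finset.card_le_card ?_)
        intro y hy
        simp only [Finset.mem_erase, Finset.mem_sdiff, Finset.mem_union, Finset.mem_inter] at hy ⊢
        exact ⟨hy.1, hne hy.1, .inl hy.1, hy.2⟩
    have huC : L.tyE (c x).u ∉ L.comp x w := by
      rw [← hzu, mem_comp hwx]
      intro hp
      exact hwu ((mem_comp hzux).2 (path_symm hp))
    by_cases hcard : 2 ≤ (S \ L.comp x w).card
    · exact split w hwx _ hxarc.ty_u huC hxarc.link_u hcard
    have huS : L.tyE (c x).u ∈ S \ L.comp x w := Finset.mem_sdiff.2 ⟨hxarc.ty_u, huC⟩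
    have hcard1 : (S \ L.comp x w).card = 1 := by
      have : 0 < (S \ L.comp x w).card := Finset.card_pos.2 ⟨_, huS⟩
      omega
    by_cases hvC : L.tyE (c x).v ∈ L.comp x w
    · -- the component of `zu` contains at most one special type
      refine split zu hzux _ hxarc.ty_v ?_ hxarc.link_v.symm ?_
      · rw [← hzv] at hvC ⊢
        rw [mem_comp hwx] at hvC
        rw [mem_comp hzux]
        exact fun hp => hwu ((mem_comp hzux).2 (hp.trans (path_symm hvC)))
      · have hsub : S ∩ L.comp x zu ⊆ S \ L.comp x w := by
          intro y hy
          rw [Finset.mem_inter] at hy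
          refine Finset.mem_sdiff.2 ⟨hy.1, fun hy' => ?_⟩
          obtain ⟨w', rfl⟩ := hexists y (Finset.mem_union_left _ hy.1)
          rw [mem_comp hwx] at hy'
          exact hwu ((mem_comp hzux).2 (((mem_comp hzux).1 hy.2).trans (path_symm hy')))
        have h1 := Finset.card_le_card hsub
        have h2 := Finset.card_sdiff_add_card_inter S (L.comp x zu)
        omega
    · exfalso
      have hsys := h.collapse (hcompT w) (hb := hself hwx) (hB := comp_connOn hwx) (by
        intro y hy hyC
        by_cases hyx : y = x
        · subst hyx
          exact ⟨huC, hvC⟩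
        · have hcl : L.ClosedOff x (((S ∪ X) \ L.comp x w).erase x) := by
            refine (comp_closedOff hwx).compl (by simp)
              (Finset.disjoint_sdiff.mono_right (Finset.erase_subset _ _)) ?_
            intro w' hw'
            have := hall w'
            simp only [Finset.mem_erase, Finset.mem_sdiff]
            tauto
          have := h.ends_mem hx hy hcl (by simp [hyx, hy, hyC])
          simp only [Finset.mem_erase, Finset.mem_sdiff] at this
          exact ⟨this.1.2.2, this.2.2.2⟩)
      refine hsys.ne_of_card_eq_two ?_ (x := x)
        (Finset.mem_sdiff.2 ⟨hx, notMem_comp hwx⟩) ?_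
      · rw [Finset.card_insert_of_notMem (by simp [hself hwx]), hcard1]
      · obtain ⟨t, ht⟩ := Finset.card_eq_one.1 hcard1
        have hvS : L.tyE (c x).v ∈ S \ L.comp x w := Finset.mem_sdiff.2 ⟨hxarc.ty_v, hvC⟩
        rw [ht, Finset.mem_singleton] at huS hvS
        exact huS.trans hvS.symm

theorem ArcSystem.card_le (h : L.ArcSystem S X c) (hS : 3 ≤ S.card) :
    X.card + 6 ≤ 3 * S.card :=
  ArcSystem.bounded _ L S X c h (Nat.lt_succ_self _) hS

end Labelling

end ArcBound

section Voltages

open Relation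

variable {W D : Type*} [Fintype W] {C : SphereComplex W D} {Γ S X Y : Type*} [Group Γ]

/-- `C.WalkIn g P z w γ`: there is a walk of total voltage `γ` from `z` to `w` inside `P`. -/
inductive SphereComplex.WalkIn (C : SphereComplex W D) (g : D → Γ) (P : Set W) :
    W → W → Γ → Prop
  | refl {z : W} : z ∈ P → C.WalkIn g P z z 1
  | head {d : D} {w : W} {γ : Γ} : C.s d ∈ P → C.WalkIn g P (C.s (C.α d)) w γ →
      C.WalkIn g P (C.s d) w (g d * γ)

/-- A gauge on a set `A` of vertices: the dart `d` is trivial for it. -/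
def SphereComplex.GaugeStep (C : SphereComplex W D) (g : D → Γ) (H : Y → Subgroup Γ)
    (A : Set W) (ty : W → Y) (h : W → Γ) (a b : W) : Prop :=
  a ∈ A ∧ b ∈ A ∧ ∃ d, C.s d = a ∧ C.s (C.α d) = b ∧ ty a = ty b ∧
    (h a)⁻¹ * g d * h b ∈ H (ty a)

/-- Vertices of the same type in `A` are joined by trivial darts. -/
def SphereComplex.Gauged (C : SphereComplex W D) (g : D → Γ) (H : Y → Subgroup Γ)
    (A : Set W) (ty : W → Y) (h : W → Γ) : Prop :=
  ∀ a ∈ A, ∀ b ∈ A, ty a = ty b → ReflTransGen (C.GaugeStep g H A ty h) a b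

namespace SphereComplex

variable {g : D → Γ} {H : Y → Subgroup Γ}

theorem WalkIn.start_mem {P : Set W} {z w : W} {γ : Γ} (h : C.WalkIn g P z w γ) : z ∈ P := by
  rcases h with h | ⟨h, -⟩
  · exact h
  · exact h

theorem Gauged.adjoin (hg : ∀ d, g (C.α d) = (g d)⁻¹) {A : Set W} {ty : W → Y} {h : W → Γ}
    (hA : C.Gauged g H A ty h) {d : D} (ha : C.s d ∈ A) (hb : C.s (C.α d) ∉ A) :
    ∃ ty' h', C.Gauged g H (insert (C.s (C.α d)) A) ty' h' ∧ (∀ z ∈ A, ty' z = ty z) ∧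
      (∀ z ∈ A, h' z = h z) ∧ ty' (C.s (C.α d)) = ty (C.s d) := by
  classical
  set b := C.s (C.α d)
  have hne : ∀ z ∈ A, z ≠ b := fun z hz h => hb (h ▸ hz)
  refine ⟨Function.update ty b (ty (C.s d)), Function.update h b ((g d)⁻¹ * h (C.s d)), ?_,
    fun z hz => Function.update_of_ne (hne z hz) _ _,
    fun z hz => Function.update_of_ne (hne z hz) _ _, Function.update_self _ _ _⟩
  set ty' := Function.update ty b (ty (C.s d)) with hty'
  set h' := Function.update h b ((g d)⁻¹ * h (C.s d)) with hh'
  have e1 : ∀ z ∈ A, ty' z = ty z := fun z hz => Function.update_of_ne (hne z hz) _ _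
  have e2 : ∀ z ∈ A, h' z = h z := fun z hz => Function.update_of_ne (hne z hz) _ _
  have e3 : ty' b = ty (C.s d) := Function.update_self _ _ _
  have e4 : h' b = (g d)⁻¹ * h (C.s d) := Function.update_self _ _ _
  have old : ∀ x ∈ A, ∀ y ∈ A, ty x = ty y →
      ReflTransGen (C.GaugeStep g H (insert b A) ty' h') x y := by
    intro x hx y hy hxy
    refine reflTransGen_mono ?_ (hA x hx y hy hxy)
    rintro p q ⟨hp, hq, d', h1, h2, h3, h4⟩
    exact ⟨Set.mem_insert_of_mem _ hp, Set.mem_insert_of_mem _ hq, d', h1, h2,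
      by rw [e1 p hp, e1 q hq, h3], by rwa [e1 p hp, e2 p hp, e2 q hq]⟩
  have s1 : C.GaugeStep g H (insert b A) ty' h' (C.s d) b :=
    ⟨Set.mem_insert_of_mem _ ha, Set.mem_insert _ _, d, rfl, rfl, by rw [e1 _ ha, e3],
      by rw [e2 _ ha, e4]; convert (H _).one_mem using 1; group⟩
  have s2 : C.GaugeStep g H (insert b A) ty' h' b (C.s d) :=
    ⟨Set.mem_insert _ _, Set.mem_insert_of_mem _ ha, C.α d, rfl, by rw [C.invol],
      by rw [e1 _ ha, e3], by rw [e2 _ ha, e4, hg]; convert (H _).one_mem using 1; group⟩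
  rintro x (rfl | hx) y (rfl | hy) hxy
  · exact .refl
  · rw [e3, e1 y hy] at hxy
    exact .head s2 (old _ ha _ hy hxy)
  · rw [e3, e1 x hx] at hxy
    exact (old _ hx _ ha hxy).tail s1
  · rw [e1 x hx, e1 y hy] at hxy
    exact old _ hx _ hy hxy

theorem Gauged.grow (hg : ∀ d, g (C.α d) = (g d)⁻¹) {R : W → W → Prop}
    (hR : ∀ a b, R a b → ∃ d, C.s d = a ∧ C.s (C.α d) = b) {Inv : W → Y → Prop}
    (hI : ∀ a b y, R a b → Inv a y → Inv b y) (A : Set W) (ty : W → Y) (h : W → Γ)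
    (hA : C.Gauged g H A ty h) (hInv : ∀ z ∈ A, Inv z (ty z)) :
    ∃ A' ty' h', A ⊆ A' ∧ C.Gauged g H A' ty' h' ∧ (∀ z ∈ A', Inv z (ty' z)) ∧
      (∀ z ∈ A, ty' z = ty z) ∧ (∀ z ∈ A, h' z = h z) ∧ ∀ a ∈ A', ∀ b, R a b → b ∈ A' := by
  induction hn : (Aᶜ).ncard using Nat.strong_induction_on generalizing A ty h with
  | _ n ih =>
    by_cases hcl : ∀ a ∈ A, ∀ b, R a b → b ∈ A
    · exact ⟨A, ty, h, subset_rfl, hA, hInv, fun _ _ => rfl, fun _ _ => rfl, hcl⟩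
    push Not at hcl
    obtain ⟨a, ha, b, hab, hb⟩ := hcl
    obtain ⟨d, rfl, rfl⟩ := hR a b hab
    obtain ⟨ty', h', h1, h2, h3, h4⟩ := hA.adjoin hg ha hb
    have hlt : ((insert (C.s (C.α d)) A)ᶜ : Set W).ncard < n := by
      rw [← hn]
      refine Set.ncard_lt_ncard ?_ (Set.toFinite _)
      exact compl_lt_compl_iff_lt.2 (Set.ssubset_insert hb)
    obtain ⟨A', ty'', h'', k1, k2, k3, k4, k5, k6⟩ := ih _ hlt _ ty' h' h1 (by
      rintro z (rfl | hz)
      · rw [h4]; exact hI _ _ _ hab (hInv _ ha)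
      · rw [h2 z hz]; exact hInv z hz) rfl
    exact ⟨A', ty'', h'', (Set.subset_insert _ _).trans k1, k2, k3,
      fun z hz => (k4 z (Set.mem_insert_of_mem _ hz)).trans (h2 z hz),
      fun z hz => (k5 z (Set.mem_insert_of_mem _ hz)).trans (h3 z hz), k6⟩

end SphereComplex
end Voltages

section ArcCovers

open Relation

variable {W D : Type*} [Fintype W]

/-- The closed walk `l` from `z` to `w`. -/
def SphereComplex.IsWalk (C : SphereComplex W D) : List D → W → W → Prop
  | [], z, w => z = w
  | d :: l, z, w => C.s d = z ∧ C.IsWalk l (C.s (C.α d)) w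

/-- A voltage assignment on a sphere complex with special regions `B s`, around which the
voltages lie in the subgroup `H s`, together with arcs running from special region to special
region through pairwise disjoint sets `P x`. -/
structure ArcCover (C : SphereComplex W D) (Γ S X : Type*) [Group Γ] where
  g : D → Γ
  g_inv : ∀ d, g (C.α d) = (g d)⁻¹
  H : S → Subgroup Γ
  B : S → Set W
  B_disj : ∀ z s s', z ∈ B s → z ∈ B s' → s = s'
  B_nonempty : ∀ s, (B s).Nonempty
  B_conn : ∀ s, ∀ a ∈ B s, ∀ b ∈ B s,
    ReflTransGen (fun a b => a ∈ B s ∧ b ∈ B s ∧ ∃ d, C.s d = a ∧ C.s (C.α d) = b) a b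
  h : W → Γ
  h_mem : ∀ s d, C.s d ∈ B s → C.s (C.α d) ∈ B s →
    (h (C.s d))⁻¹ * g d * h (C.s (C.α d)) ∈ H s
  face : ∀ l ∈ C.F, (∃ s, (∀ d ∈ l, C.s d ∈ B s ∧ C.s (C.α d) ∈ B s)) ∨
    ∃ z, C.IsWalk l z z ∧ (l.map g).prod = 1
  P : X → Set W
  P_disj : ∀ z x x', z ∈ P x → z ∈ P x' → x = x'
  P_B : ∀ z x s, z ∈ P x → z ∉ B s
  src : X → S
  tgt : X → S
  d₁ : X → D
  d₂ : X → D
  G : X → Γ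
  d₁_src : ∀ x, C.s (d₁ x) ∈ B (src x)
  d₂_tgt : ∀ x, C.s (C.α (d₂ x)) ∈ B (tgt x)
  walk : ∀ x, C.WalkIn g (P x) (C.s (C.α (d₁ x))) (C.s (d₂ x)) (G x)

namespace ArcCover

variable {C : SphereComplex W D} {Γ S X : Type*} [Group Γ] (A : ArcCover C Γ S X)

/-- The total voltage of the arc `x`, read in the gauge of its end regions. -/
def total (x : X) : Γ :=
  (A.h (C.s (A.d₁ x)))⁻¹ * (A.g (A.d₁ x) * A.G x * A.g (A.d₂ x)) * A.h (C.s (C.α (A.d₂ x)))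

/-- The subgroups of all regions: arcs get the trivial one. -/
def sub (y : S ⊕ X) : Subgroup Γ := Sum.elim A.H (fun _ => ⊥) y

/-- The label of a type and a group element. -/
def lbl (y : S ⊕ X) (a : Γ) : Σ y, Γ ⧸ A.sub y := ⟨y, (a : Γ ⧸ A.sub y)⟩

theorem lbl_eq {y y' : S ⊕ X} {a b : Γ} :
    A.lbl y a = A.lbl y' b ↔ y = y' ∧ a⁻¹ * b ∈ A.sub y := by
  constructor
  · intro h
    have h1 : y = y' := congrArg Sigma.fst h
    subst h1
    exact ⟨rfl, QuotientGroup.eq.1 (eq_of_heq (Sigma.mk.inj h).2)⟩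
  · rintro ⟨rfl, h⟩
    rw [lbl, lbl, QuotientGroup.eq.2 h]

theorem sameOrbit_lbl (γ : Γ) {y z y' z' : S ⊕ X} {a b a' b' : Γ}
    (h1 : A.lbl y (γ * a) = A.lbl y' a') (h2 : A.lbl z (γ * b) = A.lbl z' b') :
    SameOrbit Γ (A.lbl y a, A.lbl z b) (A.lbl y' a', A.lbl z' b') :=
  ⟨γ, Prod.ext h1 h2⟩

theorem exists_lbl (e : Σ y, Γ ⧸ A.sub y) : ∃ a, e = A.lbl e.1 a := by
  obtain ⟨y, q⟩ := e
  obtain ⟨a, rfl⟩ := QuotientGroup.mk_surjective q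
  exact ⟨a, rfl⟩

theorem B_seed (x : X) (s : S) : C.s (C.α (A.d₁ x)) ∉ A.B s ∧ C.s (C.α (A.d₁ x)) ∈ A.P x := by
  have h := (A.walk x).start_mem
  exact ⟨A.P_B _ _ _ h, h⟩

theorem exists_gauge [Nonempty S] : ∃ (ty : W → S ⊕ X) (h : W → Γ),
    C.Gauged A.g A.sub Set.univ ty h ∧ (∀ s, ∀ z ∈ A.B s, ty z = .inl s) ∧
    (∀ s, ∀ z ∈ A.B s, h z = A.h z) ∧
    ∃ Q : Set W, (∀ x, C.s (C.α (A.d₁ x)) ∈ Q) ∧ (∀ x, ∀ z ∈ Q, z ∈ A.P x → ty z = .inr x) ∧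
      ∀ x, ∀ a ∈ Q, a ∈ A.P x → ∀ b ∈ A.P x, (∃ d, C.s d = a ∧ C.s (C.α d) = b) → b ∈ Q := by
  classical
  obtain ⟨s₀⟩ := ‹Nonempty S›
  set ty₀ : W → S ⊕ X := fun z => if hs : ∃ s, z ∈ A.B s then .inl hs.choose else
    if hx : ∃ x, z ∈ A.P x then .inr hx.choose else .inl s₀ with hty₀
  have t1 : ∀ s, ∀ z ∈ A.B s, ty₀ z = .inl s := by
    intro s z hz
    have h1 : ∃ s, z ∈ A.B s := ⟨s, hz⟩
    simp only [hty₀]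
    rw [dif_pos h1, A.B_disj _ _ _ h1.choose_spec hz]
  have t2 : ∀ x, ∀ z ∈ A.P x, ty₀ z = .inr x := by
    intro x z hz
    have h1 : ∃ x, z ∈ A.P x := ⟨x, hz⟩
    simp only [hty₀]
    rw [dif_neg (by rintro ⟨s, hs⟩; exact A.P_B _ _ _ hz hs), dif_pos h1,
      A.P_disj _ _ _ h1.choose_spec hz]
  set A₀ : Set W := {z | (∃ s, z ∈ A.B s) ∨ ∃ x, z = C.s (C.α (A.d₁ x))} with hA₀
  have g₀ : C.Gauged A.g A.sub A₀ ty₀ A.h := by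
    rintro a (⟨s, ha⟩ | ⟨x, rfl⟩) b (⟨s', hb⟩ | ⟨x', rfl⟩) hab
    · rw [t1 s a ha, t1 s' b hb] at hab
      obtain rfl := Sum.inl_injective hab
      refine reflTransGen_mono ?_ (A.B_conn s a ha b hb)
      rintro p q ⟨hp, hq, d, rfl, rfl⟩
      refine ⟨.inl ⟨s, hp⟩, .inl ⟨s, hq⟩, d, rfl, rfl, by rw [t1 s _ hp, t1 s _ hq], ?_⟩
      rw [t1 s _ hp]
      exact A.h_mem s d hp hq
    · rw [t1 s a ha, t2 x' _ (A.B_seed x' s).2] at hab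
      cases hab
    · rw [t1 s' b hb, t2 x _ (A.B_seed x s').2] at hab
      cases hab
    · rw [t2 x _ (A.B_seed x s₀).2, t2 x' _ (A.B_seed x' s₀).2] at hab
      obtain rfl := Sum.inr_injective hab
      exact .refl
  obtain ⟨A₁, ty₁, h₁, a1, a2, a3, a4, a5, a6⟩ := g₀.grow A.g_inv
    (R := fun a b => ∃ x, a ∈ A.P x ∧ b ∈ A.P x ∧ ∃ d, C.s d = a ∧ C.s (C.α d) = b)
    (by rintro a b ⟨x, -, -, h⟩; exact h) (Inv := fun z y => ∀ x, z ∈ A.P x → y = .inr x)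
    (by
      rintro a b y ⟨x, ha, hb, -⟩ h x' hx'
      rw [h x ha, A.P_disj _ _ _ hb hx'])
    _ _ _ (fun z _ x hz => t2 x z hz)
  obtain ⟨A₂, ty₂, h₂, b1, b2, -, b4, b5, b6⟩ := a2.grow A.g_inv
    (R := fun a b => ∃ d, C.s d = a ∧ C.s (C.α d) = b)
    (by rintro a b h; exact h) (Inv := fun _ _ => True) (fun _ _ _ _ _ => trivial)
    _ _ _ (fun _ _ => trivial)
  have hA₂ : A₂ = Set.univ := by
    obtain ⟨z₀, hz₀⟩ := A.B_nonempty s₀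
    rw [Set.eq_univ_iff_forall]
    intro z
    induction C.graph z₀ z with
    | refl => exact b1 (a1 (.inl ⟨s₀, hz₀⟩))
    | tail _ h ih => exact b6 _ ih _ h
  subst hA₂
  have hB : ∀ s, ∀ z ∈ A.B s, z ∈ A₀ := fun s z hz => .inl ⟨s, hz⟩
  refine ⟨ty₂, h₂, b2, fun s z hz => ?_, fun s z hz => ?_, A₁, fun x => ?_, fun x z hz hx => ?_,
    fun x a ha hax b hbx h => ?_⟩
  · rw [b4 z (a1 (hB s z hz)), a4 z (hB s z hz), t1 s z hz]
  · rw [b5 z (a1 (hB s z hz)), a5 z (hB s z hz)]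
  · exact a1 (.inr ⟨x, rfl⟩)
  · rw [b4 z hz, a3 z hz x hx]
  · exact a6 a ha b ⟨x, hax, hbx, h⟩

end ArcCover
end ArcCovers

section ArcCoverBound

open Relation

namespace ArcCover

variable {W D : Type*} [Fintype W] {C : SphereComplex W D} {Γ S X : Type*} [Group Γ]
  (A : ArcCover C Γ S X)

/-- The labelling of a gauged arc cover. -/
def labelling {ty : W → S ⊕ X} {h : W → Γ} (hg : C.Gauged A.g A.sub Set.univ ty h)
    (hty : ∀ s, ∀ z ∈ A.B s, ty z = .inl s) (hh : ∀ s, ∀ z ∈ A.B s, h z = A.h z) :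
    Labelling C Γ (Σ y, Γ ⧸ A.sub y) (S ⊕ X) where
  lab d := (A.lbl (ty (C.s d)) (h (C.s d)), A.lbl (ty (C.s (C.α d))) (A.g d * h (C.s (C.α d))))
  tyE := Sigma.fst
  ty := ty
  tyE_smul _ _ := rfl
  tyE_fst _ := rfl
  tyE_snd _ := rfl
  symm d := by
    refine A.sameOrbit_lbl (A.g d) rfl ?_
    rw [C.invol, A.g_inv, mul_inv_cancel_left]
  flat l hl := by
    set lab : D → (Σ y, Γ ⧸ A.sub y) × (Σ y, Γ ⧸ A.sub y) := fun d =>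
      (A.lbl (ty (C.s d)) (h (C.s d)), A.lbl (ty (C.s (C.α d))) (A.g d * h (C.s (C.α d))))
      with hlab
    rcases A.face l hl with ⟨s, hs⟩ | ⟨z, hz, hp⟩
    · refine ⟨A.lbl (.inl s) 1, ?_⟩
      clear hl
      induction l with
      | nil => rfl
      | cons d l ih =>
        refine ⟨A.lbl (.inl s) 1, ?_, ih fun d hd => hs d (List.mem_cons_of_mem _ hd)⟩
        obtain ⟨h1, h2⟩ := hs d List.mem_cons_self
        refine A.sameOrbit_lbl (h (C.s d))⁻¹ (A.lbl_eq.2 ⟨hty s _ h1, ?_⟩)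
          (A.lbl_eq.2 ⟨hty s _ h2, ?_⟩)
        · simp
        · rw [mul_one, hty s _ h2, ← mul_assoc, hh s _ h1, hh s _ h2]
          exact inv_mem (A.h_mem s d h1 h2)
    · refine ⟨A.lbl (ty z) (h z), ?_⟩
      have key : ∀ (l : List D) (z w : W) (γ : Γ), C.IsWalk l z w →
          Develops Γ lab l (A.lbl (ty z) (γ * h z))
            (A.lbl (ty w) (γ * (l.map A.g).prod * h w)) := by
        intro l
        induction l with
        | nil =>
          rintro z w γ rfl
          simp [Develops]
        | cons d l ih =>
          rintro z w γ ⟨rfl, h2⟩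
          refine ⟨A.lbl (ty (C.s (C.α d))) (γ * A.g d * h (C.s (C.α d))),
            A.sameOrbit_lbl γ rfl (by rw [mul_assoc]), ?_⟩
          have := ih _ _ (γ * A.g d) h2
          rwa [mul_assoc γ (A.g d) (l.map A.g).prod, ← List.prod_cons, ← List.map_cons] at this
      simpa [hp] using key l z z 1 hz
  triv a b hab := by
    refine reflTransGen_mono ?_ (hg a (Set.mem_univ _) b (Set.mem_univ _) hab)
    rintro a b ⟨-, -, d, rfl, rfl, h1, h2⟩
    refine ⟨d, rfl, rfl, A.lbl_eq.2 ⟨h1, ?_⟩⟩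
    rwa [← mul_assoc]

/-- The arc of an arc cover in a gauge. -/
def arc (h : W → Γ) : S ⊕ X → Arc Γ (Σ y, Γ ⧸ A.sub y)
  | .inl s => ⟨A.lbl (.inl s) 1, A.lbl (.inl s) 1, A.lbl (.inl s) 1, 1⟩
  | .inr x => ⟨A.lbl (.inl (A.src x)) ((A.g (A.d₁ x))⁻¹ * h (C.s (A.d₁ x))),
      A.lbl (.inr x) (h (C.s (C.α (A.d₁ x)))),
      A.lbl (.inl (A.tgt x)) (h (C.s (C.α (A.d₁ x))) * (h (C.s (A.d₂ x)))⁻¹ *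
        A.g (A.d₂ x) * h (C.s (C.α (A.d₂ x)))),
      A.G x * h (C.s (A.d₂ x)) * (h (C.s (C.α (A.d₁ x))))⁻¹⟩

theorem ends_arc {h : W → Γ} (hh : ∀ s, ∀ z ∈ A.B s, h z = A.h z) (x : X) :
    SameOrbit Γ (A.arc h (.inr x)).ends (A.lbl (.inl (A.src x)) 1, A.lbl (.inl (A.tgt x)) (A.total x)) := by
  refine A.sameOrbit_lbl ((A.h (C.s (A.d₁ x)))⁻¹ * A.g (A.d₁ x)) (congrArg _ ?_)
    (a' := 1) (b := A.G x * h (C.s (A.d₂ x)) * (h (C.s (C.α (A.d₁ x))))⁻¹ *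
      (h (C.s (C.α (A.d₁ x))) * (h (C.s (A.d₂ x)))⁻¹ *
        A.g (A.d₂ x) * h (C.s (C.α (A.d₂ x))))) (congrArg _ ?_)
  · rw [hh _ _ (A.d₁_src x)]; group
  · rw [hh _ _ (A.d₂_tgt x), total]; group

theorem walk_mem {ty : W → S ⊕ X} {h : W → Γ} (hg : C.Gauged A.g A.sub Set.univ ty h)
    (hty : ∀ s, ∀ z ∈ A.B s, ty z = .inl s) (hh : ∀ s, ∀ z ∈ A.B s, h z = A.h z)
    {Q : Set W} {x : X} (hQ : ∀ z ∈ Q, z ∈ A.P x → ty z = .inr x)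
    (hcl : ∀ a ∈ Q, a ∈ A.P x → ∀ b ∈ A.P x, (∃ d, C.s d = a ∧ C.s (C.α d) = b) → b ∈ Q)
    (γ₀ : Γ) {z w : W} {γ : Γ} (hw : C.WalkIn A.g (A.P x) z w γ) (hz : z ∈ Q) :
    ty w = .inr x ∧ γ₀ * (h z)⁻¹ * γ * h w * γ₀⁻¹ ∈ Subgroup.closure
      {δ : Γ | (A.labelling hg hty hh).Link (A.lbl (.inr x) γ₀) (δ • A.lbl (.inr x) γ₀)} := by
  induction hw with
  | refl h => exact ⟨hQ _ hz h, by simp⟩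
  | @head d w γ hd hw ih =>
    have hP : C.s (C.α d) ∈ A.P x := hw.start_mem
    have hz' := hcl _ hz hd _ hP ⟨d, rfl, rfl⟩
    obtain ⟨h1, h2⟩ := ih hz'
    refine ⟨h1, ?_⟩
    have h3 : γ₀ * (h (C.s d))⁻¹ * A.g d * h (C.s (C.α d)) * γ₀⁻¹ ∈ Subgroup.closure
      {δ : Γ | (A.labelling hg hty hh).Link (A.lbl (.inr x) γ₀) (δ • A.lbl (.inr x) γ₀)} := by
      apply Subgroup.subset_closure
      refine ⟨d, A.sameOrbit_lbl (γ₀ * (h (C.s d))⁻¹) ?_ ?_⟩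
      · rw [hQ _ hz hd]; congr 1; group
      · rw [hQ _ hz' hP]; exact congrArg (A.lbl _) (by simp only [smul_eq_mul]; group)
    convert mul_mem h3 h2 using 1
    group

theorem exists_system [Fintype S] [Fintype X] [DecidableEq (S ⊕ X)] [Nonempty S]
    (hnt : ∀ x, A.src x = A.tgt x → A.total x ∉ A.H (A.src x))
    (hind : ∀ x x', x ≠ x' → A.src x = A.src x' → A.tgt x = A.tgt x' →
      ∀ a ∈ A.H (A.src x), ∀ b ∈ A.H (A.tgt x), A.total x' ≠ a * A.total x * b)
    (hind' : ∀ x x', x ≠ x' → A.src x = A.tgt x' → A.tgt x = A.src x' →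
      ∀ a ∈ A.H (A.src x), ∀ b ∈ A.H (A.tgt x), (A.total x')⁻¹ ≠ a * A.total x * b) :
    ∃ (L : Labelling C Γ (Σ y, Γ ⧸ A.sub y) (S ⊕ X)) (c : S ⊕ X → Arc Γ (Σ y, Γ ⧸ A.sub y)),
      L.ArcSystem (Finset.univ.map .inl) (Finset.univ.map .inr) c ∧
      ∀ x, L.tyE (c (.inr x)).u = .inl (A.src x) ∧ L.tyE (c (.inr x)).v = .inl (A.tgt x) := by
  obtain ⟨ty, h, hg, hty, hh, Q, q1, q2, q3⟩ := A.exists_gauge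
  refine ⟨A.labelling hg hty hh, A.arc h, ?_, fun x => ⟨rfl, rfl⟩⟩
  have hL : ∀ d, (A.labelling hg hty hh).lab d = (A.lbl (ty (C.s d)) (h (C.s d)),
    A.lbl (ty (C.s (C.α d))) (A.g d * h (C.s (C.α d)))) := fun _ => rfl
  have ht1 : ∀ x, ty (C.s (C.α (A.d₁ x))) = .inr x := fun x => by
    obtain ⟨s₀⟩ := ‹Nonempty S›
    exact q2 x _ (q1 x) (A.B_seed x s₀).2
  have hw := fun x => A.walk_mem hg hty hh (q2 x) (q3 x) (h (C.s (C.α (A.d₁ x)))) (A.walk x) (q1 x)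
  refine ⟨?_, ?_, ?_, ?_⟩
  · rw [Finset.disjoint_left]
    intro y hy hy'
    simp only [Finset.mem_map, Finset.mem_univ, true_and] at hy hy'
    obtain ⟨s, rfl⟩ := hy
    obtain ⟨x, hx⟩ := hy'
    cases hx
  · ext y
    simp only [Finset.mem_image, Finset.mem_univ, true_and, Finset.mem_union, Finset.mem_map]
    constructor
    · intro _
      rcases y with s | x
      · exact .inl ⟨s, rfl⟩
      · exact .inr ⟨x, rfl⟩
    · intro _
      rcases y with s | x
      · obtain ⟨z, hz⟩ := A.B_nonempty s
        exact ⟨z, hty s z hz⟩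
      · exact ⟨_, ht1 x⟩
  · intro y hy
    simp only [Finset.mem_map, Finset.mem_univ, true_and] at hy
    obtain ⟨x, rfl⟩ := hy
    exact
    { ty_xt := rfl
      ty_u := by simp [labelling, arc, lbl]
      ty_v := by simp [labelling, arc, lbl]
      link_u := by
        refine ⟨A.d₁ x, ?_⟩
        rw [hL]
        refine A.sameOrbit_lbl (A.g (A.d₁ x))⁻¹ ?_ ?_
        · rw [hty _ _ (A.d₁_src x)]
        · rw [ht1 x]; exact congrArg _ (by group)
      link_v := by
        refine ⟨A.d₂ x, ?_⟩
        rw [hL]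
        refine A.sameOrbit_lbl (h (C.s (C.α (A.d₁ x))) * (h (C.s (A.d₂ x)))⁻¹) ?_ ?_
        · rw [(hw x).1]; exact congrArg _ (by group)
        · rw [hty _ _ (A.d₂_tgt x)]; exact congrArg (A.lbl _) (by group)
      mem_closure := by
        have := (hw x).2
        rw [mul_inv_cancel, one_mul] at this
        exact this
      transitive := by
        intro e he
        obtain ⟨a, ha⟩ := A.exists_lbl e
        replace he : e.1 = .inr x := he
        rw [he] at ha
        refine ⟨a * (h (C.s (C.α (A.d₁ x))))⁻¹, ?_⟩
        rw [ha]
        exact congrArg (A.lbl _) (by simp only [smul_eq_mul]; group)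
      free := by
        intro γ hγ
        have := (A.lbl_eq.1 hγ).2
        have : (γ * h (C.s (C.α (A.d₁ x))))⁻¹ * h (C.s (C.α (A.d₁ x))) = 1 := this
        rw [inv_mul_eq_one] at this
        simpa using this
      nontriv := by
        intro he
        have := A.lbl_eq.1 ((A.ends_arc hh x).eq_iff.1 he)
        refine hnt x (Sum.inl_injective this.1) ?_
        have h2 : 1⁻¹ * A.total x ∈ A.H (A.src x) := this.2
        simpa using h2 }
  · intro y hy y' hy' hne
    simp only [Finset.mem_map, Finset.mem_univ, true_and] at hy hy'
    obtain ⟨x, rfl⟩ := hy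
    obtain ⟨x', rfl⟩ := hy'
    have hne : x ≠ x' := fun h => hne (by rw [h])
    constructor
    · intro ho
      obtain ⟨γ, hγ⟩ := (A.ends_arc hh x).symm.trans (ho.trans (A.ends_arc hh x'))
      obtain ⟨h1, h2⟩ := A.lbl_eq.1 (congrArg Prod.fst hγ)
      obtain ⟨h3, h4⟩ := A.lbl_eq.1 (congrArg Prod.snd hγ)
      replace h2 : (γ * 1)⁻¹ * 1 ∈ A.H (A.src x) := h2
      replace h4 : (γ * A.total x)⁻¹ * A.total x' ∈ A.H (A.tgt x) := h4
      refine hind x x' hne (Sum.inl_injective h1) (Sum.inl_injective h3) γ ?_ _ h4 ?_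
      · simpa using inv_mem h2
      · group
    · intro ho
      obtain ⟨γ, hγ⟩ := (A.ends_arc hh x).symm.trans (ho.trans (A.ends_arc hh x').swap)
      obtain ⟨h1, h2⟩ := A.lbl_eq.1 (congrArg Prod.fst hγ)
      obtain ⟨h3, h4⟩ := A.lbl_eq.1 (congrArg Prod.snd hγ)
      replace h2 : (γ * 1)⁻¹ * A.total x' ∈ A.H (A.src x) := h2
      replace h4 : (γ * A.total x)⁻¹ * 1 ∈ A.H (A.tgt x) := h4
      refine hind' x x' hne (Sum.inl_injective h1) (Sum.inl_injective h3)
        ((A.total x')⁻¹ * γ) ?_ _ h4 ?_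
      · simpa using inv_mem h2
      · group

theorem card_bound [Fintype S] [Fintype X] [Nonempty S]
    (hnt : ∀ x, A.src x = A.tgt x → A.total x ∉ A.H (A.src x))
    (hind : ∀ x x', x ≠ x' → A.src x = A.src x' → A.tgt x = A.tgt x' →
      ∀ a ∈ A.H (A.src x), ∀ b ∈ A.H (A.tgt x), A.total x' ≠ a * A.total x * b)
    (hind' : ∀ x x', x ≠ x' → A.src x = A.tgt x' → A.tgt x = A.src x' →
      ∀ a ∈ A.H (A.src x), ∀ b ∈ A.H (A.tgt x), (A.total x')⁻¹ ≠ a * A.total x * b) :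
    (3 ≤ Fintype.card S → Fintype.card X + 6 ≤ 3 * Fintype.card S) ∧
    (Fintype.card S = 2 → ∀ x, A.src x ≠ A.tgt x) := by
  classical
  obtain ⟨L, c, hs, hc⟩ := A.exists_system hnt hind hind'
  constructor
  · intro h3
    simpa using hs.card_le (by simpa using h3)
  · intro h2 x hx
    refine hs.ne_of_card_eq_two (by simpa using h2) (x := .inr x) (by simp) ?_
    rw [(hc x).1, (hc x).2, hx]

end ArcCover
end ArcCoverBound

namespace Grid

open Relation

variable {a : ℕ}

/-- Darts of the square grid: `(vertical, reversed, position along, position across)`. -/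
abbrev Dart (a : ℕ) := Bool × Bool × Fin a × Fin (a + 1)

/-- Vertices of the square grid. -/
abbrev Vert (a : ℕ) := Fin (a + 1) × Fin (a + 1)

/-- Reversal of darts. -/
def rev (d : Dart a) : Dart a := (d.1, !d.2.1, d.2.2)

/-- The source of a dart. -/
def src (d : Dart a) : Vert a :=
  let p : Fin (a + 1) := if d.2.1 then d.2.2.1.succ else d.2.2.1.castSucc
  if d.1 then (d.2.2.2, p) else (p, d.2.2.2)

/-- The cell on the left of a dart, if it is not the outer one. -/
def owner (d : Dart a) : Option (Fin a × Fin a) :=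
  (if d.1 = d.2.1 then
    (if h : d.2.2.2 = Fin.last a then none else some (d.2.2.2.castPred h))
  else (if h : d.2.2.2 = 0 then none else some (d.2.2.2.pred h))).map
    fun k => if d.1 then (k, d.2.2.1) else (d.2.2.1, k)

/-- The boundary word of a cell. -/
def square (c : Fin a × Fin a) : List (Dart a) :=
  [(false, false, c.1, c.2.castSucc), (true, false, c.2, c.1.succ),
    (false, true, c.1, c.2.succ), (true, true, c.2, c.1.castSucc)]

/-- The boundary words of all cells, including the outer one. -/
noncomputable def word : Option (Fin a × Fin a) → List (Dart a)
  | none => (Finset.univ.filter fun d : Dart a => owner d = none).toList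
  | some c => square c

theorem up_eq_some {j : Fin (a + 1)} {k : Fin a} :
    (if h : j = Fin.last a then none else some (j.castPred h)) = some k ↔ j = k.castSucc := by
  split_ifs with h
  · subst h
    simp only [false_iff]
    exact (Fin.castSucc_ne_last k).symm
  · rw [Option.some_inj]
    constructor
    · rintro rfl; simp
    · rintro rfl; simp

theorem down_eq_some {j : Fin (a + 1)} {k : Fin a} :
    (if h : j = 0 then none else some (j.pred h)) = some k ↔ j = k.succ := by
  split_ifs with h
  · subst h
    simp only [false_iff]
    exact (Fin.succ_ne_zero k).symm
  · rw [Option.some_inj]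
    constructor
    · rintro rfl; simp
    · rintro rfl; simp

theorem mem_word (d : Dart a) (c : Option (Fin a × Fin a)) : d ∈ word c ↔ owner d = c := by
  rcases c with _ | ⟨i, j⟩
  · simp [word]
  · obtain ⟨v, r, p, q⟩ := d
    cases v <;> cases r <;>
    simp only [word, square, owner, Option.map_eq_some_iff, up_eq_some, down_eq_some, if_true,
      if_false, Bool.false_eq_true, reduceCtorEq] <;> simp [and_comm]

theorem nodup_word (c : Option (Fin a × Fin a)) : (word c).Nodup := by
  rcases c with _ | ⟨i, j⟩
  · exact Finset.nodup_toList _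
  · simp [word, square]

/-- The faces of the grid. -/
noncomputable def faces (a : ℕ) : Multiset (List (Dart a)) :=
  (Finset.univ : Finset (Option (Fin a × Fin a))).val.map word

theorem mem_faces {l : List (Dart a)} : l ∈ faces a ↔ ∃ c, word c = l := by
  simp [faces]

theorem letters_faces : letters (faces a) = Finset.univ.val := by
  have h1 : (letters (faces a)).Nodup := by
    rw [letters, faces, Multiset.bind_map, Multiset.nodup_bind]
    refine ⟨fun c _ => by simpa using nodup_word c, ?_⟩
    refine (Finset.univ : Finset (Option (Fin a × Fin a))).nodup.pairwise fun c _ c' _ hne => ?_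
    simp only [Function.onFun, Multiset.disjoint_left, Multiset.mem_coe, mem_word]
    rintro d rfl h
    exact hne h
  refine (Multiset.Nodup.ext h1 Finset.univ.nodup).2 fun d => ?_
  simp only [Finset.mem_val, Finset.mem_univ, iff_true]
  exact mem_letters.2 ⟨word (owner d), mem_faces.2 ⟨_, rfl⟩, (mem_word _ _).2 rfl⟩

theorem rev_rev (d : Dart a) : rev (rev d) = d := by
  obtain ⟨v, r, p⟩ := d
  simp [rev]

theorem sum_word (φ : Dart a → ℤ) (c : Option (Fin a × Fin a)) :
    ((word c).map φ).sum = ∑ d with owner d = c, φ d := by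
  rw [← List.sum_toFinset _ (nodup_word c)]
  congr 1
  ext d
  simp [mem_word]

theorem balanced : WordsBalanced rev src (faces a) := by
  intro l hl f
  obtain ⟨c, rfl⟩ := mem_faces.1 hl
  have hs : ∀ c : Fin a × Fin a,
      ((word (some c)).map fun e => f (src e) - f (src (rev e))).sum = 0 := by
    intro c
    simp [word, square, src, rev]
  rcases c with _ | c
  · have h1 : ∑ d : Dart a, (f (src d) - f (src (rev d))) = 0 := by
      rw [Finset.sum_sub_distrib, sub_eq_zero]
      exact (Equiv.sum_comp (Function.Involutive.toPerm rev rev_rev) fun d => f (src d)).symm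
    rw [← Finset.sum_fiberwise Finset.univ owner] at h1
    simp only [← sum_word] at h1
    rw [Fintype.sum_option] at h1
    simpa only [hs, Finset.sum_const_zero, add_zero] using h1
  · exact hs c

theorem facesConnected : FacesConnected rev (faces a) := by
  intro P hP
  have h1 : ∀ d : Dart a, P (word (owner d)) ↔ P (word (owner (rev d))) := by
    have : ∀ d : Dart a, P (word (owner d)) → P (word (owner (rev d))) := fun d h =>
      hP _ (mem_faces.2 ⟨_, rfl⟩) h d ((mem_word _ _).2 rfl) _ (mem_faces.2 ⟨_, rfl⟩)
        ((mem_word _ _).2 rfl)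
    intro d
    refine ⟨this d, fun h => ?_⟩
    have := this _ h
    rwa [rev_rev] at this
  have h2 : ∀ (n : ℕ) (i j : Fin a), (j : ℕ) = n → (P (word (some (i, j))) ↔ P (word none)) := by
    intro n
    induction n with
    | zero =>
      intro i j hj
      have h := h1 (false, false, i, j.castSucc)
      have e1 : owner (false, false, i, j.castSucc) = some (i, j) := by
        simp [owner]
      have e2 : owner (rev (false, false, i, j.castSucc)) = none := by
        have : j.castSucc = 0 := Fin.ext hj
        simp [owner, rev, this]
      rwa [e1, e2] at h
    | succ n ih =>
      intro i j hj
      have h := h1 (false, false, i, j.castSucc)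
      have e1 : owner (false, false, i, j.castSucc) = some (i, j) := by
        simp [owner]
      have hn : n < a := by omega
      have e2 : owner (rev (false, false, i, j.castSucc)) = some (i, ⟨n, hn⟩) := by
        rw [← mem_word]
        have : j.castSucc = (⟨n, hn⟩ : Fin a).succ := Fin.ext hj
        simp [word, square, rev, this]
      rw [e1, e2] at h
      exact h.trans (ih i ⟨n, hn⟩ rfl)
  have h3 : ∀ c, P (word c) ↔ P (word (none : Option (Fin a × Fin a))) := by
    rintro (_ | ⟨i, j⟩)
    · exact Iff.rfl
    · exact h2 _ i j rfl
  by_cases h : P (word (none : Option (Fin a × Fin a)))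
  · left
    intro l hl
    obtain ⟨c, rfl⟩ := mem_faces.1 hl
    exact (h3 c).2 h
  · right
    intro l hl
    obtain ⟨c, rfl⟩ := mem_faces.1 hl
    exact fun h' => h ((h3 c).1 h')

/-- Steps along darts inside `S`. -/
def Step (S : Set (Vert a)) (z w : Vert a) : Prop :=
  z ∈ S ∧ w ∈ S ∧ ∃ d, src d = z ∧ src (rev d) = w

theorem Step.symm {S : Set (Vert a)} {z w : Vert a} (h : Step S z w) : Step S w z := by
  obtain ⟨h1, h2, d, h3, h4⟩ := h
  exact ⟨h2, h1, rev d, h4, by rw [rev_rev, h3]⟩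

theorem reach_symm {S : Set (Vert a)} {z w : Vert a} (h : ReflTransGen (Step S) z w) :
    ReflTransGen (Step S) w z := by
  induction h with
  | refl => exact .refl
  | tail _ h ih => exact .head h.symm ih

theorem reach_line {S : Set (Vert a)} (v : Bool) (q p p' : Fin (a + 1)) (hp : p ≤ p')
    (hS : ∀ x, p ≤ x → x ≤ p' → (if v then (q, x) else (x, q)) ∈ S) :
    ReflTransGen (Step S) (if v then (q, p) else (p, q)) (if v then (q, p') else (p', q)) := by
  obtain ⟨n, hn⟩ := Nat.exists_eq_add_of_le (Fin.le_def.1 hp)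
  induction n generalizing p' with
  | zero =>
    have : p' = p := Fin.ext (by simpa using hn)
    rw [this]
  | succ n ih =>
    have hlt : (p : ℕ) + n < a := by have := p'.2; omega
    set r : Fin a := ⟨p + n, hlt⟩
    have e : p' = r.succ := Fin.ext (by rw [hn]; rfl)
    have h1 : r.castSucc ≤ p' := by
      rw [Fin.le_def, hn]; change (p : ℕ) + n ≤ _; omega
    have h2 : p ≤ r.castSucc := by
      rw [Fin.le_def]; change (p : ℕ) ≤ p + n; omega
    refine (ih r.castSucc h2 (fun x hx hx' => hS x hx (hx'.trans h1)) rfl).tail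
      ⟨hS _ h2 h1, hS _ hp le_rfl, (v, false, r, q), ?_, ?_⟩
    · cases v <;> simp [src]
    · cases v <;> simp [src, rev, e]

theorem reach_line' {S : Set (Vert a)} (v : Bool) (q p p' : Fin (a + 1))
    (hS : ∀ x, min p p' ≤ x → x ≤ max p p' → (if v then (q, x) else (x, q)) ∈ S) :
    ReflTransGen (Step S) (if v then (q, p) else (p, q)) (if v then (q, p') else (p', q)) := by
  rcases le_total p p' with h | h
  · exact reach_line v q p p' h fun x hx hx' => hS x (by simpa [h] using hx) (by simpa [h] using hx')
  · exact reach_symm (reach_line v q p' p h fun x hx hx' =>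
      hS x (by simpa [h] using hx) (by simpa [h] using hx'))

/-- A product of two intervals is connected. -/
theorem reach_box {S : Set (Vert a)} {z w : Vert a}
    (hS : ∀ x : Vert a, min z.1 w.1 ≤ x.1 → x.1 ≤ max z.1 w.1 → min z.2 w.2 ≤ x.2 →
      x.2 ≤ max z.2 w.2 → x ∈ S) : ReflTransGen (Step S) z w := by
  have h1 := reach_line' (S := S) false z.2 z.1 w.1 fun x hx hx' => by
    simpa using hS (x, z.2) hx hx' (by simp) (by simp)
  have h2 := reach_line' (S := S) true w.1 z.2 w.2 fun x hx hx' => by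
    simpa using hS (w.1, x) (by simp) (by simp) hx hx'
  simp only [Bool.false_eq_true, if_false, if_true] at h1 h2
  exact h1.trans h2

/-- The square grid with `a * a` cells and an outer face as a sphere. -/
noncomputable def sphere (a : ℕ) : SphereComplex (Vert a) (Dart a) where
  α := rev
  s := src
  F := faces a
  invol := rev_rev
  nofix d h := by
    have := congrArg (fun d => d.2.1) h
    simp [rev] at this
  nodup := by rw [letters_faces]; exact Finset.univ.nodup
  mem_all d := by rw [letters_faces]; simp
  balanced := balanced
  faces := facesConnected
  euler := by
    rw [letters_faces]
    simp [faces]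
    ring
  graph z w := reflTransGen_mono (fun _ _ h => h.2.2) (reach_box (S := Set.univ) fun _ _ _ _ _ => trivial)

/-- The boundary of the grid. -/
def frame (a : ℕ) : Set (Vert a) :=
  {z | z.1 = 0 ∨ z.1 = Fin.last a ∨ z.2 = 0 ∨ z.2 = Fin.last a}

theorem src_mem_frame {d : Dart a} (h : owner d = none) : src d ∈ frame a ∧ src (rev d) ∈ frame a := by
  obtain ⟨v, r, p, q⟩ := d
  have hq : q = 0 ∨ q = Fin.last a := by
    by_contra hq
    push Not at hq
    cases v <;> cases r <;> simp [owner, hq.1, hq.2] at h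
  rcases hq with rfl | rfl <;> cases v <;> cases r <;> simp [src, rev, frame]

theorem frame_conn {z w : Vert a} (hz : z ∈ frame a) (hw : w ∈ frame a) :
    ReflTransGen (Step (frame a)) z w := by
  have key : ∀ z ∈ frame a, ReflTransGen (Step (frame a)) z (0, 0) := by
    have k1 : ∀ p q, p = 0 → ReflTransGen (Step (frame a)) (p, q) (0, 0) := by
      rintro p q rfl
      refine reach_box fun x h1 h2 h3 h4 => .inl ?_
      simpa using h2
    have k2 : ∀ p q, q = 0 → ReflTransGen (Step (frame a)) (p, q) (0, 0) := by
      rintro p q rfl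
      refine reach_box fun x h1 h2 h3 h4 => .inr (.inr (.inl ?_))
      simpa using h4
    rintro ⟨p, q⟩ (h | h | h | h)
    · exact k1 _ _ h
    · simp only at h
      subst h
      refine ReflTransGen.trans (b := (Fin.last a, 0)) (reach_box fun x h1 h2 h3 h4 => ?_) (k2 _ _ rfl)
      exact .inr (.inl (le_antisymm (Fin.le_last _) (by simpa using h1)))
    · exact k2 _ _ h
    · simp only at h
      subst h
      refine ReflTransGen.trans (b := (0, Fin.last a)) (reach_box fun x h1 h2 h3 h4 => ?_) (k1 _ _ rfl)
      exact .inr (.inr (.inr (le_antisymm (Fin.le_last _) (by simpa using h3))))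
  exact (key z hz).trans (reach_symm (key w hw))

end Grid

/-- A faithful voltage: paths of `X` are labelled by elements of a group, multiplicatively, and
two paths with the same ends have the same label if and only if they are homotopic. -/
structure Voltage (X : Type) [TopologicalSpace X] (Γ : Type) [Group Γ] where
  G : ∀ {x y : X}, Path x y → Γ
  map_trans : ∀ {x y z : X} (p : Path x y) (q : Path y z), G (p.trans q) = G p * G q
  eq_iff : ∀ {x y : X} (p q : Path x y), G p = G q ↔ p.Homotopic q

namespace Voltage

variable {X : Type} [TopologicalSpace X] {Γ : Type} [Group Γ] (A : Voltage X Γ)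

theorem map_refl (x : X) : A.G (Path.refl x) = 1 := by
  have h := A.map_trans (Path.refl x) (Path.refl x)
  rw [Path.refl_trans_refl] at h
  exact left_eq_mul.1 h

theorem map_symm {x y : X} (p : Path x y) : A.G p.symm = (A.G p)⁻¹ := by
  rw [← mul_eq_one_iff_eq_inv, ← A.map_trans, ← A.map_refl y]
  exact (A.eq_iff _ _).2 ⟨(Path.Homotopy.reflSymmTrans p).symm⟩

theorem map_cast {x y x' y' : X} (p : Path x y) (hx : x' = x) (hy : y' = y) :
    A.G (p.cast hx hy) = A.G p := by
  subst hx hy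
  rfl

theorem map_subpath_trans {x y : X} (p : Path x y) (r s t : unitInterval) :
    A.G (p.subpath r t) = A.G (p.subpath r s) * A.G (p.subpath s t) := by
  rw [← A.map_trans]
  exact (A.eq_iff _ _).2 ⟨(Path.Homotopy.subpathTransSubpath p r s t).symm⟩

theorem map_subpath_zero_one {x y : X} (p : Path x y) : A.G (p.subpath 0 1) = A.G p := by
  rw [Path.subpath_zero_one, map_cast]

open Path.Homotopic.Quotient in
/-- Path connected spaces carry a faithful voltage. -/
theorem exists_voltage (X : Type) [TopologicalSpace X] [PathConnectedSpace X] :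
    ∃ (Γ : Type) (_ : Group Γ), Nonempty (Voltage X Γ) := by
  obtain ⟨b⟩ : Nonempty X := inferInstance
  let c : ∀ x : X, Path b x := fun x => PathConnectedSpace.somePath b x
  let inst : Group (Path.Homotopic.Quotient b b) :=
    { mul := fun p q => p.trans q
      one := Path.Homotopic.Quotient.refl b
      inv := fun p => p.symm
      mul_assoc := fun p q r => trans_assoc p q r
      one_mul := fun p => refl_trans p
      mul_one := fun p => trans_refl p
      inv_mul_cancel := fun p => symm_trans p }
  refine ⟨Path.Homotopic.Quotient b b, inst,
    ⟨⟨fun {x y} p => ((Path.Homotopic.Quotient.mk (c x)).trans (Path.Homotopic.Quotient.mk p)).trans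
      (Path.Homotopic.Quotient.mk (c y)).symm, ?_, ?_⟩⟩⟩
  · intro x y z p q
    change _ = Path.Homotopic.Quotient.trans _ _
    rw [mk_trans]
    simp only [trans_assoc]
    rw [← trans_assoc (Path.Homotopic.Quotient.mk (c y)).symm, symm_trans, refl_trans]
  · intro x y p q
    rw [← Path.Homotopic.Quotient.eq]
    constructor
    · intro h
      have h1 := congrArg (fun r => ((Path.Homotopic.Quotient.mk (c x)).symm.trans r).trans (Path.Homotopic.Quotient.mk (c y))) h
      simp only [trans_assoc, symm_trans, trans_refl] at h1
      simpa only [← trans_assoc, symm_trans, refl_trans] using h1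
    · intro h
      rw [h]

end Voltage

/-- The open square with centre `c` and half-side `r`. -/
def box (c : ℂ) (r : ℝ) : Set ℂ := {z | |z.re - c.re| < r ∧ |z.im - c.im| < r}

theorem mem_box {c z : ℂ} {r : ℝ} : z ∈ box c r ↔ |z.re - c.re| < r ∧ |z.im - c.im| < r := Iff.rfl

theorem box_subset {c d : ℂ} {r s : ℝ} (h : d ∈ box c s) : box d r ⊆ box c (s + r) := by
  intro z hz
  rw [mem_box] at *
  simp only [abs_lt] at *
  refine ⟨⟨?_, ?_⟩, ?_, ?_⟩ <;> linarith [h.1.1, h.1.2, h.2.1, h.2.2, hz.1.1, hz.1.2, hz.2.1, hz.2.2]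

theorem box_mono {c : ℂ} {r s : ℝ} (h : r ≤ s) : box c r ⊆ box c s :=
  fun _ hz => ⟨hz.1.trans_le h, hz.2.trans_le h⟩

theorem mem_box_comm {c z : ℂ} {r : ℝ} : z ∈ box c r ↔ c ∈ box z r := by
  rw [mem_box, mem_box, abs_sub_comm, abs_sub_comm z.im]

theorem mem_box_self {c : ℂ} {r : ℝ} (h : 0 < r) : c ∈ box c r := by
  simpa [mem_box] using h

theorem ball_subset_box (c : ℂ) (r : ℝ) : Metric.ball c r ⊆ box c r := by
  intro z hz
  rw [Metric.mem_ball, Complex.dist_eq] at hz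
  refine ⟨?_, ?_⟩
  · simpa using (Complex.abs_re_le_norm (z - c)).trans_lt hz
  · simpa using (Complex.abs_im_le_norm (z - c)).trans_lt hz

theorem convex_box (c : ℂ) (r : ℝ) : Convex ℝ (box c r) := by
  have h : box c r = Complex.reLm ⁻¹' (Set.Ioo (c.re - r) (c.re + r)) ∩
      Complex.imLm ⁻¹' (Set.Ioo (c.im - r) (c.im + r)) := by
    ext z
    simp only [mem_box, abs_lt, Set.mem_inter_iff, Set.mem_preimage, Set.mem_Ioo,
      Complex.reLm_coe, Complex.imLm_coe]
    constructor
    · rintro ⟨⟨_, _⟩, _, _⟩; refine ⟨⟨?_, ?_⟩, ?_, ?_⟩ <;> linarith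
    · rintro ⟨⟨_, _⟩, _, _⟩; refine ⟨⟨?_, ?_⟩, ?_, ?_⟩ <;> linarith
  rw [h]
  exact ((convex_Ioo _ _).linear_preimage _).inter ((convex_Ioo _ _).linear_preimage _)

/-- Points between two points of a square, coordinatewise, lie in it. -/
theorem mem_box_of_between {c z w u : ℂ} {r : ℝ} (hz : z ∈ box c r) (hw : w ∈ box c r)
    (h1 : min z.re w.re ≤ u.re) (h2 : u.re ≤ max z.re w.re)
    (h3 : min z.im w.im ≤ u.im) (h4 : u.im ≤ max z.im w.im) : u ∈ box c r := by
  rw [mem_box] at *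
  simp only [abs_lt] at *
  rw [min_le_iff] at h1 h3
  rw [le_max_iff] at h2 h4
  obtain ⟨⟨_, _⟩, _, _⟩ := hz
  obtain ⟨⟨_, _⟩, _, _⟩ := hw
  refine ⟨⟨?_, ?_⟩, ?_, ?_⟩
  · rcases h1 with h | h <;> linarith
  · rcases h2 with h | h <;> linarith
  · rcases h3 with h | h <;> linarith
  · rcases h4 with h | h <;> linarith

/-- The punctured open square. -/
def pbox (c : ℂ) (r : ℝ) : Set ℂ := box c r \ {c}

theorem joinedIn_pbox {c x y : ℂ} {r : ℝ} (hx : x ∈ pbox c r) (hy : y ∈ pbox c r) :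
    JoinedIn (pbox c r) x y := by
  let M : ℂ → ℝ := fun z => max |z.re - c.re| |z.im - c.im|
  have hM : Continuous M := by fun_prop
  have hMr : ∀ z, z ∈ box c r ↔ M z < r := fun z => (max_lt_iff).symm
  have hM0 : ∀ z, z ≠ c → 0 < M z := by
    intro z hz
    by_contra h
    apply hz
    have h1 := max_le_iff.1 (not_lt.1 h)
    apply Complex.ext
    · exact sub_eq_zero.1 (abs_nonpos_iff.1 h1.1)
    · exact sub_eq_zero.1 (abs_nonpos_iff.1 h1.2)
  set q := max (M x) (M y) with hq
  have hq0 : 0 < q := lt_max_of_lt_left (hM0 x hx.2)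
  have hqr : q < r := max_lt ((hMr x).1 hx.1) ((hMr y).1 hy.1)
  have hpos : ∀ z, 0 < max q (M z) := fun z => lt_max_of_lt_left hq0
  let ψ : ℂ → ℂ := fun z => c + ((q / max q (M z) : ℝ) : ℂ) * (z - c)
  have hψ : Continuous ψ := by
    refine continuous_const.add (Continuous.mul (Complex.continuous_ofReal.comp
      (continuous_const.div (continuous_const.max hM) fun z => (hpos z).ne')) (by fun_prop))
  have hfix : ∀ z, M z ≤ q → ψ z = z := by
    intro z hz
    have h1 : (q : ℂ) / q = 1 := div_self (Complex.ofReal_ne_zero.2 hq0.ne')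
    simp [ψ, max_eq_left hz, h1]
  have hmap : ∀ z, z ≠ c → ψ z ∈ pbox c r := by
    intro z hz
    refine ⟨?_, ?_⟩
    · have hk : |q / max q (M z)| = q / max q (M z) := abs_of_pos (div_pos hq0 (hpos z))
      have hle : ∀ a : ℝ, |a| ≤ M z → |q / max q (M z) * a| < r := by
        intro a ha
        rw [abs_mul, hk]
        calc q / max q (M z) * |a| ≤ q / max q (M z) * max q (M z) := by
              refine mul_le_mul_of_nonneg_left (ha.trans (le_max_right _ _)) (div_pos hq0 (hpos z)).le
          _ = q := div_mul_cancel₀ _ (hpos z).ne'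
          _ < r := hqr
      refine ⟨?_, ?_⟩
      · simpa [ψ] using hle (z.re - c.re) (le_max_left _ _)
      · simpa [ψ] using hle (z.im - c.im) (le_max_right _ _)
    · intro h
      have h1 : ((q / max q (M z) : ℝ) : ℂ) * (z - c) = 0 := by
        have : ψ z = c := h
        simpa [ψ, -Complex.ofReal_div] using this
      rcases mul_eq_zero.1 h1 with h2 | h2
      · exact (div_pos hq0 (hpos z)).ne' (Complex.ofReal_eq_zero.1 h2)
      · exact hz (sub_eq_zero.1 h2)
  have hj : JoinedIn ({c}ᶜ : Set ℂ) x y :=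
    (isPathConnected_compl_singleton_of_one_lt_rank (by simp [Complex.rank_real_complex]) c).joinedIn
      x hx.2 y hy.2
  have := hj.map_continuousOn (f := ψ) hψ.continuousOn
  rw [hfix x (le_max_left _ _), hfix y (le_max_right _ _)] at this
  exact this.mono (by rintro _ ⟨z, hz, rfl⟩; exact hmap z hz)

/-- The complement of a set of punctures. -/
abbrev Punct (V : Set ℂ) : Type := {z : ℂ // z ∉ V}

theorem pathConnectedSpace_punct {V : Set ℂ} (hV : V.Finite) : PathConnectedSpace (Punct V) :=
  isPathConnected_iff_pathConnectedSpace.1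
    (hV.countable.isPathConnected_compl_of_one_lt_rank (by simp [Complex.rank_real_complex]))

section Segments

variable {V : Set ℂ}

/-- The straight path. -/
noncomputable def segPath {x y : ℂ} (h : segment ℝ x y ⊆ Vᶜ) :
    Path (⟨x, h (left_mem_segment ℝ x y)⟩ : Punct V) ⟨y, h (right_mem_segment ℝ x y)⟩ where
  toFun t := ⟨AffineMap.lineMap x y (t : ℝ), h (by
    rw [segment_eq_image_lineMap]
    exact ⟨t, t.2, rfl⟩)⟩
  continuous_toFun := by
    refine Continuous.subtype_mk ?_ _
    exact AffineMap.lineMap_continuous.comp continuous_subtype_val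
  source' := by simp
  target' := by simp

theorem segPath_mem {x y : ℂ} (h : segment ℝ x y ⊆ Vᶜ) (t : I) :
    (segPath h t : ℂ) ∈ segment ℝ x y := by
  rw [segment_eq_image_lineMap]
  exact ⟨t, t.2, rfl⟩

theorem homotopic_of_convex {K : Set ℂ} (hK : Convex ℝ K) (hKV : K ⊆ Vᶜ) {x y : Punct V}
    (p q : Path x y) (hp : ∀ t, (p t : ℂ) ∈ K) (hq : ∀ t, (q t : ℂ) ∈ K) : p.Homotopic q := by
  refine ⟨⟨⟨⟨fun s => ⟨AffineMap.lineMap (p s.2 : ℂ) (q s.2 : ℂ) (s.1 : ℝ), ?_⟩, ?_⟩, ?_, ?_⟩, ?_⟩⟩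
  · exact hKV (hK.lineMap_mem (hp _) (hq _) s.1.2)
  · refine Continuous.subtype_mk ?_ _
    simp only [AffineMap.lineMap_apply_module]
    fun_prop
  · intro t; simp
  · intro t; simp
  · rintro s t (rfl | rfl)
    · simp
    · simp

variable {Γ : Type} [Group Γ] (A : Voltage (Punct V) Γ)

open Classical in
/-- The voltage of a straight segment. -/
noncomputable def Voltage.sg (x y : ℂ) : Γ :=
  if h : segment ℝ x y ⊆ Vᶜ then A.G (segPath h) else 1

theorem Voltage.G_eq_sg {K : Set ℂ} (hK : Convex ℝ K) (hKV : K ⊆ Vᶜ) {x y : Punct V}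
    (p : Path x y) (hp : ∀ t, (p t : ℂ) ∈ K) : A.G p = A.sg x y := by
  have hx : (x : ℂ) ∈ K := by simpa using hp 0
  have hy : (y : ℂ) ∈ K := by simpa using hp 1
  have hs : segment ℝ (x : ℂ) y ⊆ Vᶜ := (hK.segment_subset hx hy).trans hKV
  rw [Voltage.sg, dif_pos hs]
  exact (A.eq_iff _ _).2 (homotopic_of_convex hK hKV _ _ hp
    fun t => hK.segment_subset hx hy (segPath_mem hs t))

theorem Voltage.sg_trans {K : Set ℂ} (hK : Convex ℝ K) (hKV : K ⊆ Vᶜ) {x y z : ℂ}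
    (hx : x ∈ K) (hy : y ∈ K) (hz : z ∈ K) : A.sg x y * A.sg y z = A.sg x z := by
  have h1 := hK.segment_subset hx hy
  have h2 := hK.segment_subset hy hz
  rw [Voltage.sg, Voltage.sg, dif_pos (h1.trans hKV), dif_pos (h2.trans hKV), ← A.map_trans]
  exact A.G_eq_sg hK hKV (x := ⟨x, hKV hx⟩) (y := ⟨z, hKV hz⟩) _ fun t => by
    rw [Path.trans_apply]
    split_ifs
    · exact h1 (segPath_mem _ _)
    · exact h2 (segPath_mem _ _)

theorem Voltage.sg_self (x : ℂ) : A.sg x x = 1 := by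
  rw [Voltage.sg]
  split_ifs with h
  · rw [← A.map_refl ⟨x, h (left_mem_segment ℝ x x)⟩]
    exact (A.eq_iff _ _).2 (homotopic_of_convex (convex_singleton x)
      (by simpa [segment_same] using h) _ _ (fun t => by simpa using segPath_mem h t)
      fun t => by simp)
  · rfl

theorem Voltage.sg_symm (x y : ℂ) : A.sg y x = (A.sg x y)⁻¹ := by
  by_cases h : segment ℝ x y ⊆ Vᶜ
  · rw [← mul_eq_one_iff_eq_inv, ← A.sg_self y]
    exact A.sg_trans (convex_segment x y) h (right_mem_segment ℝ x y) (left_mem_segment ℝ x y)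
      (right_mem_segment ℝ x y)
  · have h' : ¬ segment ℝ y x ⊆ Vᶜ := by rwa [segment_symm]
    rw [Voltage.sg, Voltage.sg, dif_neg h, dif_neg h', inv_one]

end Segments

section Cones

variable (V : Set ℂ) (u v : ℂ)

/-- Curves from `u` to `v` with interior in the complement of `V`. -/
def edgeCurves : Set C(I, ℂ) :=
  {c | c 0 = u ∧ c 1 = v ∧ ∀ t, t ≠ 0 → t ≠ 1 → c t ∉ V}

/-- Curves in the complement of `V` that start near `u` and end near `v`. -/
def coreCurves (r : ℝ) : Set C(I, ℂ) :=
  {c | c 0 ∈ pbox u r ∧ c 1 ∈ pbox v r ∧ ∀ t, c t ∉ V}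

/-- The affine rescaling `[a, 1 - a] → [0, 1]`, clamped. -/
noncomputable def rescale (a : ℝ) (t : I) : I :=
  Set.projIcc 0 1 zero_le_one (((t : ℝ) - a) / (1 - 2 * a))

/-- The inverse of `rescale`. -/
noncomputable def unscale (a : ℝ) (t : I) : I :=
  Set.projIcc 0 1 zero_le_one (a + t * (1 - 2 * a))

theorem continuous_rescale (a : ℝ) : Continuous (rescale a) :=
  continuous_projIcc.comp (by fun_prop)

theorem continuous_unscale (a : ℝ) : Continuous (unscale a) :=
  continuous_projIcc.comp (by fun_prop)

/-- Extend a core curve by straight segments from `u` and to `v`. -/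
noncomputable def cone (a : ℝ) (c : C(I, ℂ)) : C(I, ℂ) where
  toFun t := c (rescale a t) + (1 - min 1 ((t : ℝ) / a) : ℝ) * (u - c 0) +
    (1 - min 1 ((1 - (t : ℝ)) / a) : ℝ) * (v - c 1)
  continuous_toFun := by
    have := continuous_rescale a
    fun_prop

theorem continuous_cone (a : ℝ) : Continuous (cone u v a) := by
  refine ContinuousMap.continuous_of_continuous_uncurry _ ?_
  have := continuous_rescale a
  change Continuous fun p : C(I, ℂ) × I => p.1 (rescale a p.2) +
    (1 - min 1 ((p.2 : ℝ) / a) : ℝ) * (u - p.1 0) +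
    (1 - min 1 ((1 - (p.2 : ℝ)) / a) : ℝ) * (v - p.1 1)
  fun_prop

variable {V u v}

theorem rescale_of_le {a : ℝ} (ha' : a < 1 / 2) {t : I} (ht : (t : ℝ) ≤ a) :
    rescale a t = 0 :=
  Set.projIcc_of_le_left _ (div_nonpos_of_nonpos_of_nonneg (by linarith) (by linarith))

theorem rescale_of_ge {a : ℝ} (ha' : a < 1 / 2) {t : I} (ht : 1 - a ≤ (t : ℝ)) :
    rescale a t = 1 :=
  Set.projIcc_of_right_le _ ((one_le_div (by linarith)).2 (by linarith))

theorem shrink_mem {r k : ℝ} {x : ℂ} (hx : x ∈ pbox u r) (hk0 : 0 ≤ k) (hk : k < 1) :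
    x + (k : ℂ) * (u - x) ∈ pbox u r := by
  have hr : 0 < r := (abs_nonneg _).trans_lt hx.1.1
  refine ⟨?_, ?_⟩
  · have := (convex_box u r).lineMap_mem hx.1 (mem_box_self hr) (t := k) ⟨hk0, hk.le⟩
    rw [AffineMap.lineMap_apply_module'] at this
    rw [add_comm]
    simpa using this
  · intro h
    have h1 : ((1 - k : ℝ) : ℂ) * (x - u) = 0 := by
      rw [Set.mem_singleton_iff] at h
      push_cast
      linear_combination h
    rcases mul_eq_zero.1 h1 with h2 | h2
    · rw [Complex.ofReal_eq_zero] at h2; linarith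
    · exact hx.2 (sub_eq_zero.1 h2)

theorem cone_mem {a r : ℝ} (ha : 0 < a) (ha' : a < 1 / 2) (hu : pbox u r ⊆ Vᶜ)
    (hv : pbox v r ⊆ Vᶜ) {c : C(I, ℂ)} (hc : c ∈ coreCurves V u v r) :
    cone u v a c ∈ edgeCurves V u v := by
  obtain ⟨h0, h1, hV⟩ := hc
  refine ⟨?_, ?_, ?_⟩
  · have e1 : (1 : ℝ) ≤ 1 / a := (one_le_div ha).2 (by linarith)
    have e2 : rescale a 0 = 0 := rescale_of_le ha' (by simpa using ha.le)
    simp only [cone, ContinuousMap.coe_mk, e2, Set.Icc.coe_zero, zero_div, sub_zero, min_eq_left e1]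
    rw [min_eq_right zero_le_one]
    simp
  · have e1 : (1 : ℝ) ≤ 1 / a := (one_le_div ha).2 (by linarith)
    have e2 : rescale a 1 = 1 := rescale_of_ge ha' (by simpa using ha.le)
    simp only [cone, ContinuousMap.coe_mk, e2, Set.Icc.coe_one, sub_self, zero_div, min_eq_left e1]
    rw [min_eq_right zero_le_one]
    simp
  · intro t ht0 ht1
    have p0 : 0 < (t : ℝ) := unitInterval.pos_iff_ne_zero.2 ht0
    have p1 : (t : ℝ) < 1 := unitInterval.lt_one_iff_ne_one.2 ht1
    simp only [cone, ContinuousMap.coe_mk]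
    by_cases hl : (t : ℝ) ≤ a
    · rw [rescale_of_le ha' hl, min_eq_left ((one_le_div ha).2 (by linarith : a ≤ 1 - (t : ℝ))),
        min_eq_right ((div_le_one ha).2 hl)]
      rw [sub_self, Complex.ofReal_zero, zero_mul, add_zero]
      exact hu (shrink_mem h0 (sub_nonneg.2 ((div_le_one ha).2 hl))
        (by linarith [div_pos p0 ha]))
    · by_cases hr : 1 - a ≤ (t : ℝ)
      · have h2 : (1 - (t : ℝ)) / a ≤ 1 := (div_le_one ha).2 (by linarith)
        rw [rescale_of_ge ha' hr, min_eq_left ((one_le_div ha).2 (not_le.1 hl).le),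
          min_eq_right h2]
        rw [sub_self, Complex.ofReal_zero, zero_mul, add_zero]
        exact hv (shrink_mem h1 (sub_nonneg.2 h2)
          (by linarith [div_pos (sub_pos.2 p1) ha]))
      · rw [min_eq_left ((one_le_div ha).2 (not_le.1 hl).le),
          min_eq_left ((one_le_div ha).2 (by linarith))]
        simpa using hV _

theorem joinedIn_cone {a r : ℝ} (ha : 0 < a) (ha' : a < 1 / 2) (hu : pbox u r ⊆ Vᶜ)
    (hv : pbox v r ⊆ Vᶜ) {c c' : C(I, ℂ)} (h : JoinedIn (coreCurves V u v r) c c') :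
    JoinedIn (edgeCurves V u v) (cone u v a c) (cone u v a c') :=
  (h.map_continuousOn (continuous_cone u v a).continuousOn).mono (by
    rintro _ ⟨c, hc, rfl⟩
    exact cone_mem ha ha' hu hv hc)

/-- The core of a curve. -/
noncomputable def core (a : ℝ) (c : C(I, ℂ)) : C(I, ℂ) := c.comp ⟨unscale a, continuous_unscale a⟩

theorem joinedIn_of_curry {S : Set C(I, ℂ)} {c c' : C(I, ℂ)} (H : C(I × I, ℂ))
    (h0 : ∀ t, H (0, t) = c t) (h1 : ∀ t, H (1, t) = c' t) (hS : ∀ s, H.curry s ∈ S) :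
    JoinedIn S c c' :=
  ⟨{ toFun := H.curry
     source' := ContinuousMap.ext h0
     target' := ContinuousMap.ext h1 }, hS⟩

theorem joinedIn_cone_core {a r : ℝ} (ha : 0 < a) (ha' : a < 1 / 2) (hu : pbox u r ⊆ Vᶜ)
    (hv : pbox v r ⊆ Vᶜ) {c : C(I, ℂ)} (hc : c ∈ edgeCurves V u v)
    (hl : ∀ t : I, (t : ℝ) ≤ a → c t ∈ box u r) (hr : ∀ t : I, 1 - a ≤ (t : ℝ) → c t ∈ box v r)
    (hul : u ∈ V) (hvl : v ∈ V) :
    JoinedIn (edgeCurves V u v) c (cone u v a (core a c)) := by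
  let s1 : I → ℝ := fun s => min 1 (2 * (s : ℝ))
  let s2 : I → ℝ := fun s => max 0 (2 * (s : ℝ) - 1)
  have b1 : ∀ s, 0 ≤ s1 s ∧ s1 s ≤ 1 := fun s =>
    ⟨le_min zero_le_one (by linarith [s.2.1]), min_le_left _ _⟩
  have b2 : ∀ s, 0 ≤ s2 s ∧ s2 s ≤ 1 := fun s =>
    ⟨le_max_left _ _, max_le zero_le_one (by linarith [s.2.2])⟩
  have b12 : ∀ s, s1 s = 1 ∨ s2 s = 0 := by
    intro s
    rcases le_total (2 * (s : ℝ)) 1 with h | h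
    · exact Or.inr (max_eq_left (by linarith))
    · exact Or.inl (min_eq_left h)
  let φ : I × I → ℝ := fun p => max (s2 p.1 * a) (min (p.2 : ℝ) (1 - s2 p.1 * a))
  let ψ : I × I → I := fun p => Set.projIcc 0 1 zero_le_one (φ p)
  have cs1 : Continuous s1 := by fun_prop
  have cs2 : Continuous s2 := by fun_prop
  have cψ : Continuous ψ := continuous_projIcc.comp (by fun_prop)
  have b2a : ∀ s, 0 ≤ s2 s * a ∧ s2 s * a ≤ a := fun s =>
    ⟨mul_nonneg (b2 s).1 ha.le, mul_le_of_le_one_left ha.le (b2 s).2⟩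
  have hψ : ∀ p, (ψ p : ℝ) = φ p := by
    intro p
    have : φ p ∈ Set.Icc (0 : ℝ) 1 := by
      refine ⟨(b2a p.1).1.trans (le_max_left _ _), max_le ?_ ((min_le_left _ _).trans p.2.2.2)⟩
      linarith [(b2a p.1).2]
    simp only [ψ, Set.projIcc_of_mem zero_le_one this]
  have φl : ∀ s t : I, (t : ℝ) ≤ a → φ (s, t) = max (s2 s * a) t := by
    intro s t ht
    simp only [φ]
    rw [min_eq_left (by linarith [(b2a s).2])]
  have φr : ∀ s t : I, 1 - a ≤ (t : ℝ) → φ (s, t) = min (t : ℝ) (1 - s2 s * a) := by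
    intro s t ht
    exact max_eq_right (le_min (by linarith [(b2a s).2]) (by linarith [(b2a s).2]))
  have φm : ∀ s t : I, a ≤ (t : ℝ) → (t : ℝ) ≤ 1 - a → φ (s, t) = t := by
    intro s t h1 h2
    simp only [φ]
    rw [min_eq_left (by linarith [(b2a s).2]), max_eq_right (by linarith [(b2a s).2])]
  have hpl : ∀ t : I, 0 < (t : ℝ) → (t : ℝ) ≤ a → c t ∈ pbox u r := by
    refine fun t h0 h1 => ⟨hl t h1, fun h => hc.2.2 t (unitInterval.pos_iff_ne_zero.1 h0) ?_ ?_⟩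
    · rintro rfl; norm_num at h1; linarith
    · rw [Set.mem_singleton_iff.1 h]; exact hul
  have hpr : ∀ t : I, (t : ℝ) < 1 → 1 - a ≤ (t : ℝ) → c t ∈ pbox v r := by
    refine fun t h0 h1 => ⟨hr t h1, fun h => hc.2.2 t ?_ (unitInterval.lt_one_iff_ne_one.1 h0) ?_⟩
    · rintro rfl; norm_num at h1; linarith
    · rw [Set.mem_singleton_iff.1 h]; exact hvl
  let H : C(I × I, ℂ) := ⟨fun p => c (ψ p) +
    (s1 p.1 * (1 - min 1 ((p.2 : ℝ) / a)) : ℝ) * (u - c (ψ p)) +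
    (s1 p.1 * (1 - min 1 ((1 - (p.2 : ℝ)) / a)) : ℝ) * (v - c (ψ p)), by fun_prop⟩
  have e1 : (1 : ℝ) ≤ 1 / a := (one_le_div ha).2 (by linarith)
  refine joinedIn_of_curry H ?_ ?_ fun s => ⟨?_, ?_, ?_⟩
  · intro t
    have h1 : s1 0 = 0 := by simp [s1]
    have h2 : s2 0 = 0 := by simp [s2]
    have h3 : ψ (0, t) = t := by
      apply Subtype.ext
      rw [hψ]
      simp [φ, h2, t.2.1, t.2.2]
    simp [H, h1, h3]
  · intro t
    have h1 : s1 1 = 1 := by norm_num [s1]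
    have h2 : s2 1 = 1 := by norm_num [s2]
    have h3 : ψ (1, t) = unscale a (rescale a t) := by
      apply Subtype.ext
      rw [hψ]
      have hd : 0 < 1 - 2 * a := by linarith
      by_cases hl : (t : ℝ) ≤ a
      · rw [φl _ _ hl, rescale_of_le ha' hl, h2, unscale, Set.projIcc_of_mem zero_le_one
          (x := a + ((0 : I) : ℝ) * (1 - 2 * a)) ⟨by simpa using ha.le, by simp; linarith⟩]
        simp [hl]
      · by_cases hr : 1 - a ≤ (t : ℝ)
        · rw [φr _ _ hr, rescale_of_ge ha' hr, h2, unscale, Set.projIcc_of_mem zero_le_one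
            (x := a + ((1 : I) : ℝ) * (1 - 2 * a)) ⟨by simp; linarith, by simp; linarith⟩]
          rw [min_eq_right (by linarith)]
          simp; ring
        · push Not at hl hr
          rw [φm _ _ hl.le hr.le, unscale, rescale, Set.projIcc_of_mem zero_le_one
            (x := ((t : ℝ) - a) / (1 - 2 * a)) ⟨div_nonneg (by linarith) hd.le,
              (div_le_one hd).2 (by linarith)⟩]
          have : a + ((t : ℝ) - a) / (1 - 2 * a) * (1 - 2 * a) = t := by
            rw [div_mul_cancel₀ _ hd.ne']; ring
          simp only [this, Set.projIcc_of_mem zero_le_one t.2]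
    have h4 : ((1 - min 1 ((t : ℝ) / a) : ℝ) : ℂ) * (u - c (ψ (1, t))) =
        ((1 - min 1 ((t : ℝ) / a) : ℝ) : ℂ) * (u - c (unscale a 0)) := by
      by_cases hl : (t : ℝ) ≤ a
      · rw [h3, rescale_of_le ha' hl]
      · rw [min_eq_left ((one_le_div ha).2 (not_le.1 hl).le)]; simp
    have h5 : ((1 - min 1 ((1 - (t : ℝ)) / a) : ℝ) : ℂ) * (v - c (ψ (1, t))) =
        ((1 - min 1 ((1 - (t : ℝ)) / a) : ℝ) : ℂ) * (v - c (unscale a 1)) := by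
      by_cases hr : 1 - a ≤ (t : ℝ)
      · rw [h3, rescale_of_ge ha' hr]
      · rw [min_eq_left ((one_le_div ha).2 (by linarith))]; simp
    simp only [H, ContinuousMap.coe_mk, h1, one_mul, h4, h5]
    rw [h3]
    rfl
  · have h0 : ψ (s, 0) = 0 ∨ s1 s = 1 := by
      rcases b12 s with h | h
      · exact Or.inr h
      · left
        apply Subtype.ext
        rw [hψ, φl _ _ (by simpa using ha.le), h]
        simp
    simp only [H, ContinuousMap.curry_apply, ContinuousMap.coe_mk, Set.Icc.coe_zero, zero_div, sub_zero, min_eq_left e1]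
    rw [min_eq_right zero_le_one]
    rcases h0 with h | h
    · simp [h, hc.1]
    · simp [h]
  · have h0 : ψ (s, 1) = 1 ∨ s1 s = 1 := by
      rcases b12 s with h | h
      · exact Or.inr h
      · left
        apply Subtype.ext
        rw [hψ, φr _ _ (by simpa using ha.le), h]
        simp
    simp only [H, ContinuousMap.curry_apply, ContinuousMap.coe_mk, Set.Icc.coe_one, sub_self, zero_div, min_eq_left e1]
    rw [min_eq_right zero_le_one]
    rcases h0 with h | h
    · simp [h, hc.2.1]
    · simp [h]
  · intro t ht0 ht1
    have p0 : 0 < (t : ℝ) := unitInterval.pos_iff_ne_zero.2 ht0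
    have p1 : (t : ℝ) < 1 := unitInterval.lt_one_iff_ne_one.2 ht1
    simp only [H, ContinuousMap.curry_apply, ContinuousMap.coe_mk]
    by_cases hl : (t : ℝ) ≤ a
    · rw [min_eq_left ((one_le_div ha).2 (by linarith : a ≤ 1 - (t : ℝ))),
        min_eq_right ((div_le_one ha).2 hl)]
      rw [sub_self, mul_zero, Complex.ofReal_zero, zero_mul, add_zero]
      have hk : 0 ≤ 1 - (t : ℝ) / a := sub_nonneg.2 ((div_le_one ha).2 hl)
      refine hu (shrink_mem (hpl _ ?_ ?_) (mul_nonneg (b1 s).1 hk) ?_)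
      · rw [hψ, φl _ _ hl]; exact lt_max_of_lt_right p0
      · rw [hψ, φl _ _ hl]; exact max_le (b2a s).2 hl
      · refine (mul_le_of_le_one_left hk (b1 s).2).trans_lt ?_
        linarith [div_pos p0 ha]
    · by_cases hr : 1 - a ≤ (t : ℝ)
      · have h2 : (1 - (t : ℝ)) / a ≤ 1 := (div_le_one ha).2 (by linarith)
        rw [min_eq_left ((one_le_div ha).2 (not_le.1 hl).le), min_eq_right h2]
        rw [sub_self, mul_zero, Complex.ofReal_zero, zero_mul, add_zero]
        refine hv (shrink_mem (hpr _ ?_ ?_) (mul_nonneg (b1 s).1 (sub_nonneg.2 h2)) ?_)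
        · rw [hψ, φr _ _ hr]; exact min_lt_of_left_lt p1
        · rw [hψ, φr _ _ hr]; exact le_min hr (by linarith [(b2a s).2])
        · refine (mul_le_of_le_one_left (sub_nonneg.2 h2) (b1 s).2).trans_lt ?_
          linarith [div_pos (sub_pos.2 p1) ha]
      · push Not at hl hr
        rw [min_eq_left ((one_le_div ha).2 hl.le), min_eq_left ((one_le_div ha).2 (by linarith))]
        have : ψ (s, t) = t := Subtype.ext (by rw [hψ, φm _ _ hl.le hr.le])
        simpa [this] using hc.2.2 t ht0 ht1

end Cones

section CoreHomotopy

variable {V : Set ℂ} {u v : ℂ} {r : ℝ}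

/-- A path in the punctured plane as a curve. -/
noncomputable def Path.curve {x y : Punct V} (p : Path x y) : C(I, ℂ) := ⟨fun t => (p t : ℂ), by fun_prop⟩

theorem Path.curve_mem {x y : Punct V} (p : Path x y) (hx : (x : ℂ) ∈ pbox u r)
    (hy : (y : ℂ) ∈ pbox v r) : p.curve ∈ coreCurves V u v r :=
  ⟨by simpa [Path.curve] using hx, by simpa [Path.curve] using hy, fun t => (p t).2⟩

theorem joinedIn_of_homotopic {x y : Punct V} {p q : Path x y} (h : p.Homotopic q)
    (hx : (x : ℂ) ∈ pbox u r) (hy : (y : ℂ) ∈ pbox v r) :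
    JoinedIn (coreCurves V u v r) p.curve q.curve := by
  obtain ⟨F⟩ := h
  refine joinedIn_of_curry ⟨fun s => (F s : ℂ), by fun_prop⟩ (fun t => ?_) (fun t => ?_)
    fun s => ?_
  · simp [Path.curve]
  · simp [Path.curve]
  · exact (F.eval s).curve_mem hx hy

theorem joinedIn_trans_left {x y z : Punct V} (p : Path x y) (q : Path y z)
    (hp : ∀ t, (p t : ℂ) ∈ pbox u r) (hz : (z : ℂ) ∈ pbox v r) :
    JoinedIn (coreCurves V u v r) (p.trans q).curve q.curve := by
  let φ : I × I → I := fun s => Set.projIcc 0 1 zero_le_one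
    ((s.1 : ℝ) / 2 + (1 - (s.1 : ℝ) / 2) * s.2)
  have hφ : ∀ s, (φ s : ℝ) = (s.1 : ℝ) / 2 + (1 - (s.1 : ℝ) / 2) * s.2 := by
    intro s
    have h1 := s.1.2
    have h2 := s.2.2
    have : (s.1 : ℝ) / 2 + (1 - (s.1 : ℝ) / 2) * s.2 ∈ Set.Icc (0 : ℝ) 1 := by
      constructor <;> nlinarith [h1.1, h1.2, h2.1, h2.2]
    simp only [φ, Set.projIcc_of_mem zero_le_one this]
  have cφ : Continuous φ := continuous_projIcc.comp (by fun_prop)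
  refine joinedIn_of_curry ⟨fun s => ((p.trans q) (φ s) : ℂ), by fun_prop⟩ (fun t => ?_)
    (fun t => ?_) fun s => ⟨?_, ?_, fun t => ((p.trans q) _).2⟩
  · have : φ (0, t) = t := Subtype.ext (by rw [hφ]; simp)
    simp [Path.curve, this]
  · have h1 : (φ (1, t) : ℝ) = 1 / 2 + t / 2 := by rw [hφ]; simp; ring
    simp only [ContinuousMap.coe_mk, Path.curve, Path.trans_apply]
    split_ifs with h
    · have ht : t = 0 := Subtype.ext (le_antisymm (by simp; linarith) t.2.1)
      subst ht
      have h2 : (⟨2 * (φ (1, 0) : ℝ), (unitInterval.mul_pos_mem_iff zero_lt_two).2 ⟨(φ (1, 0)).2.1, h⟩⟩ : I) = 1 :=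
        Subtype.ext (by simp [h1])
      rw [h2]
      simp
    · congr 3
      rw [h1]
      ring
  · have h1 : (φ (s, 0) : ℝ) = s / 2 := by rw [hφ]; simp
    simp only [ContinuousMap.coe_mk, ContinuousMap.curry_apply, Path.trans_apply]
    rw [dif_pos (by rw [h1]; linarith [s.2.2])]
    exact hp _
  · have h1 : φ (s, 1) = 1 := Subtype.ext (by rw [hφ]; simp)
    simpa [h1] using hz

theorem joinedIn_trans_right {x y z : Punct V} (p : Path x y) (q : Path y z)
    (hq : ∀ t, (q t : ℂ) ∈ pbox v r) (hx : (x : ℂ) ∈ pbox u r) :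
    JoinedIn (coreCurves V u v r) (p.trans q).curve p.curve := by
  have h1 := joinedIn_trans_left (u := v) (v := u) (r := r) q.symm p.symm (fun t => hq _) hx
  have h2 : Continuous fun c : C(I, ℂ) => c.comp ⟨σ, unitInterval.continuous_symm⟩ := by fun_prop
  have h3 := (h1.map_continuousOn h2.continuousOn).mono (show _ ⊆ coreCurves V u v r by
    rintro _ ⟨c, ⟨hc0, hc1, hc⟩, rfl⟩
    exact ⟨by simpa using hc1, by simpa using hc0, fun t => hc _⟩)
  convert h3 using 1
  · ext t
    change _ = (((q.symm.trans p.symm) (σ t) : Punct V) : ℂ)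
    rw [← Path.trans_symm, Path.symm_apply, Function.comp_apply, unitInterval.symm_symm]
    rfl
  · ext t; simp [Path.curve]

theorem joinedIn_of_voltage {Γ : Type} [Group Γ] (A : Voltage (Punct V) Γ)
    {x y x' y' : Punct V} (F : Path x y) (F' : Path x' y') (p : Path x' x) (q : Path y y')
    (hp : ∀ t, (p t : ℂ) ∈ pbox u r) (hq : ∀ t, (q t : ℂ) ∈ pbox v r)
    (h : A.G F' = A.G p * A.G F * A.G q) :
    JoinedIn (coreCurves V u v r) F'.curve F.curve := by
  have hx : (x : ℂ) ∈ pbox u r := by simpa using hp 1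
  have hx' : (x' : ℂ) ∈ pbox u r := by simpa using hp 0
  have hy' : (y' : ℂ) ∈ pbox v r := by simpa using hq 1
  have h1 : F'.Homotopic (p.trans (F.trans q)) := by
    rw [← A.eq_iff, A.map_trans, A.map_trans, h, mul_assoc]
  exact (joinedIn_of_homotopic h1 hx' hy').trans
    ((joinedIn_trans_left p _ hp hy').trans (joinedIn_trans_right F q hq hx))

theorem homotopicIn_of_path {c c' : C(I, ℂ)} (γ : Path c c') (hu : ∀ s, γ s 0 = u)
    (hv : ∀ s, γ s 1 = v) (hV : ∀ s t, s ≠ 1 → t ≠ 0 → t ≠ 1 → γ s t ∉ V) :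
    HomotopicIn V c c' := by
  refine ⟨fun s => γ s.1 s.2, ?_, fun t => by simp, fun t => by simp, fun s => ?_, fun s => ?_,
    fun s t _ hs => hV s t hs⟩
  · exact ContinuousEval.continuous_eval.comp
      ((γ.continuous.comp continuous_fst).prodMk continuous_snd)
  · exact (hu s).trans ((hu 0).symm.trans (by rw [γ.source]))
  · exact (hv s).trans ((hv 0).symm.trans (by rw [γ.source]))

theorem homotopicIn_of_joinedIn {c c' : C(I, ℂ)} (h : JoinedIn (edgeCurves V u v) c c') :
    HomotopicIn V c c' :=
  homotopicIn_of_path h.somePath (fun s => (h.somePath_mem s).1) (fun s => (h.somePath_mem s).2.1)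
    fun s t _ => (h.somePath_mem s).2.2 t

/-- Curves as required in the neighbourhoods of their ends. -/
structure GoodCurve (V : Set ℂ) (u v : ℂ) (a r : ℝ) (c : C(I, ℂ)) : Prop where
  mem : c ∈ edgeCurves V u v
  left : ∀ t : I, (t : ℝ) ≤ a → c t ∈ box u r
  right : ∀ t : I, 1 - a ≤ (t : ℝ) → c t ∈ box v r

theorem homotopicIn_of_voltage {Γ : Type} [Group Γ] (A : Voltage (Punct V) Γ) {a : ℝ} (ha : 0 < a)
    (ha' : a < 1 / 2) (hu : pbox u r ⊆ Vᶜ) (hv : pbox v r ⊆ Vᶜ) (hul : u ∈ V) (hvl : v ∈ V)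
    {c c' : C(I, ℂ)} (hc : GoodCurve V u v a r c) (hc' : GoodCurve V u v a r c')
    {x y x' y' : Punct V} {F : Path x y} {F' : Path x' y'} (hF : F.curve = core a c)
    (hF' : F'.curve = core a c') (p : Path x' x) (q : Path y y')
    (hp : ∀ t, (p t : ℂ) ∈ pbox u r) (hq : ∀ t, (q t : ℂ) ∈ pbox v r)
    (h : A.G F' = A.G p * A.G F * A.G q) : HomotopicIn V c' c := by
  refine homotopicIn_of_joinedIn (u := u) (v := v)
    ((joinedIn_cone_core ha ha' hu hv hc'.mem hc'.left hc'.right hul hvl).trans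
    (JoinedIn.trans ?_ (joinedIn_cone_core ha ha' hu hv hc.mem hc.left hc.right hul hvl).symm))
  rw [← hF, ← hF']
  exact joinedIn_cone ha ha' hu hv (joinedIn_of_voltage A F F' p q hp hq h)

theorem homotopicIn_const {Γ : Type} [Group Γ] (A : Voltage (Punct V) Γ) {a : ℝ} (ha : 0 < a)
    (ha' : a < 1 / 2) (hu : pbox u r ⊆ Vᶜ) (hul : u ∈ V)
    {c : C(I, ℂ)} (hc : GoodCurve V u u a r c)
    {x y : Punct V} {F : Path x y} (hF : F.curve = core a c) (p : Path x y)
    (hp : ∀ t, (p t : ℂ) ∈ pbox u r) (h : A.G F = A.G p) : HomotopicIn V c fun _ => u := by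
  have hx : (x : ℂ) ∈ pbox u r := by simpa using hp 0
  have hy : (y : ℂ) ∈ pbox u r := by simpa using hp 1
  have h1 : JoinedIn (edgeCurves V u u) c (cone u u a p.curve) := by
    refine (joinedIn_cone_core ha ha' hu hu hc.mem hc.left hc.right hul hul).trans ?_
    rw [← hF]
    exact joinedIn_cone ha ha' hu hu (joinedIn_of_homotopic ((A.eq_iff _ _).1 h) hx hy)
  have h2 : ∀ t : I, t ≠ 0 → t ≠ 1 → cone u u a p.curve t ∈ pbox u r := by
    intro t h0 h1
    have := (cone_mem (V := (pbox u r)ᶜ) (u := u) (v := u) (r := r) ha ha' (by simp) (by simp) (c := p.curve)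
      ⟨by simpa [Path.curve] using hx, by simpa [Path.curve] using hy,
        fun t => not_not.2 (hp t)⟩).2.2 t h0 h1
    simpa using this
  have h3 := cone_mem ha ha' hu hu (p.curve_mem hx hy)
  let γ : Path (cone u u a p.curve) (ContinuousMap.const I u) :=
    { toFun := fun s => cone u u a p.curve +
        (s : ℝ) • (ContinuousMap.const I u - cone u u a p.curve)
      continuous_toFun := by fun_prop
      source' := ContinuousMap.ext fun t => by simp
      target' := ContinuousMap.ext fun t => by simp }
  have hγ : ∀ s t, γ s t = cone u u a p.curve t + ((s : ℝ) : ℂ) * (u - cone u u a p.curve t) :=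
    fun s t => by
      rw [← smul_eq_mul, Complex.coe_smul]; rfl
  refine homotopicIn_of_path (u := u) (v := u) (h1.somePath.trans γ) (fun s => ?_) (fun s => ?_)
    fun s t hs h0' h1' => ?_
  · rw [Path.trans_apply]
    split_ifs
    · exact (h1.somePath_mem _).1
    · rw [hγ, h3.1]; simp
  · rw [Path.trans_apply]
    split_ifs
    · exact (h1.somePath_mem _).2.1
    · rw [hγ, h3.2.1]; simp
  · rw [Path.trans_apply]
    split_ifs with h
    · exact (h1.somePath_mem _).2.2 t h0' h1'
    · rw [hγ]
      refine hu (shrink_mem (h2 t h0' h1') ?_ ?_)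
      · simp only; linarith
      · have : (s : ℝ) < 1 := unitInterval.lt_one_iff_ne_one.2 hs
        simp only; linarith

end CoreHomotopy

namespace SphereComplex

variable {W D : Type*} [Fintype W] {C : SphereComplex W D} {Γ : Type*} [Group Γ] {g : D → Γ}

theorem WalkIn.mono {P Q : Set W} (hPQ : P ⊆ Q) {z w : W} {γ : Γ} (h : C.WalkIn g P z w γ) :
    C.WalkIn g Q z w γ := by
  induction h with
  | refl hz => exact .refl (hPQ hz)
  | head hd _ ih => exact .head (hPQ hd) ih

theorem WalkIn.trans {P : Set W} {z w x : W} {γ γ' : Γ} (h : C.WalkIn g P z w γ)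
    (h' : C.WalkIn g P w x γ') : C.WalkIn g P z x (γ * γ') := by
  induction h with
  | refl hz => rwa [one_mul]
  | head hd _ ih =>
    rw [mul_assoc]
    exact .head hd (ih h')

theorem WalkIn.symm (hg : ∀ d, g (C.α d) = (g d)⁻¹) {P : Set W} {z w : W} {γ : Γ}
    (h : C.WalkIn g P z w γ) : C.WalkIn g P w z γ⁻¹ := by
  induction h with
  | refl hz => rw [inv_one]; exact .refl hz
  | @head d w γ hd h ih =>
    rw [mul_inv_rev]
    refine ih.trans ?_
    have h1 : C.WalkIn g P (C.s (C.α (C.α d))) (C.s d) 1 := by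
      rw [C.invol]; exact .refl hd
    have h2 := WalkIn.head (d := C.α d) h.start_mem h1
    rwa [mul_one, hg] at h2

theorem WalkIn.last_exit {P B : Set W} {z w : W} {γ : Γ} (h : C.WalkIn g P z w γ) (hw : w ∉ B) :
    C.WalkIn g (P \ B) z w γ ∨ ∃ d q₀ q₁, C.s d ∈ B ∧ C.WalkIn g P z (C.s d) q₀ ∧
      C.WalkIn g (P \ B) (C.s (C.α d)) w q₁ ∧ γ = q₀ * g d * q₁ := by
  induction h with
  | refl hz => exact Or.inl (.refl ⟨hz, hw⟩)
  | @head d w γ hd h ih =>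
    rcases ih hw with h1 | ⟨e, q₀, q₁, he, h1, h2, rfl⟩
    · by_cases hB : C.s d ∈ B
      · exact Or.inr ⟨d, 1, γ, hB, .refl hd, h1, by rw [one_mul]⟩
      · exact Or.inl (.head ⟨hd, hB⟩ h1)
    · exact Or.inr ⟨e, g d * q₀, q₁, he, .head hd h1, h2, by simp only [mul_assoc]⟩

end SphereComplex

/-- A square mesh of step `δ` in general position with respect to `V`, covering the square of
half-side `R` around the origin. -/
structure Mesh (V : Set ℂ) (δ R : ℝ) where
  a : ℕ
  x : ℝ
  y : ℝ
  δ_pos : 0 < δ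
  re_ne : ∀ v ∈ V, ∀ i : ℕ, v.re ≠ x + i * δ
  im_ne : ∀ v ∈ V, ∀ i : ℕ, v.im ≠ y + i * δ
  x_lt : x < -R
  y_lt : y < -R
  lt_x : R < x + a * δ
  lt_y : R < y + a * δ

theorem exists_generic {T : Set ℝ} (hT : T.Finite) (δ : ℝ) (a : ℕ) {p q : ℝ} (hpq : p < q) :
    ∃ x, p < x ∧ x < q ∧ ∀ t ∈ T, ∀ i ≤ a, t ≠ x + i * δ := by
  have hfin : (Set.image2 (fun t (i : ℕ) => t - i * δ) T (Set.Iic a)).Finite :=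
    hT.image2 _ (Set.finite_Iic a)
  obtain ⟨x, hx, hx'⟩ := ((Set.Ioo_infinite hpq).sdiff hfin).nonempty
  refine ⟨x, hx.1, hx.2, fun t ht i hi h => hx' ⟨t, ht, i, hi, ?_⟩⟩
  simp only [h]
  ring

theorem exists_mesh {V : Set ℂ} (hV : V.Finite) {δ R : ℝ} (hδ : 0 < δ)
    (hVR : ∀ v ∈ V, |v.re| < R ∧ |v.im| < R) : Nonempty (Mesh V δ R) := by
  obtain ⟨a, ha⟩ := exists_nat_gt ((2 * R + 1) / δ)
  rw [div_lt_iff₀ hδ] at ha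
  obtain ⟨x, hx1, hx2, hx⟩ := exists_generic (hV.image Complex.re) δ a (p := -R - 1) (q := -R)
    (by linarith)
  obtain ⟨y, hy1, hy2, hy⟩ := exists_generic (hV.image Complex.im) δ a (p := -R - 1) (q := -R)
    (by linarith)
  have big : ∀ i : ℕ, a < i → (a : ℝ) * δ < i * δ := fun i hi =>
    mul_lt_mul_of_pos_right (by exact_mod_cast hi) hδ
  refine ⟨⟨a, x, y, hδ, fun v hv i => ?_, fun v hv i => ?_, hx2, hy2, by linarith, by linarith⟩⟩
  · by_cases hi : i ≤ a
    · exact hx _ ⟨v, hv, rfl⟩ i hi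
    · have := big i (not_le.1 hi)
      have := (abs_lt.1 (hVR v hv).1).2
      intro h; linarith
  · by_cases hi : i ≤ a
    · exact hy _ ⟨v, hv, rfl⟩ i hi
    · have := big i (not_le.1 hi)
      have := (abs_lt.1 (hVR v hv).2).2
      intro h; linarith

namespace Mesh

open Grid Relation

variable {V : Set ℂ} {δ R : ℝ} (M : Mesh V δ R)

/-- The position of a grid vertex. -/
def pos (z : Vert M.a) : ℂ := ⟨M.x + (z.1 : ℕ) * δ, M.y + (z.2 : ℕ) * δ⟩

theorem src_eq (d : Dart M.a) : (d.1 = false ∧ (src d).2 = (src (rev d)).2 ∧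
      |((src d).1 : ℝ) - ((src (rev d)).1 : ℕ)| = 1) ∨
    (d.1 = true ∧ (src d).1 = (src (rev d)).1 ∧
      |((src d).2 : ℝ) - ((src (rev d)).2 : ℕ)| = 1) := by
  obtain ⟨v, r, p, q⟩ := d
  cases v <;> cases r <;> simp [src, rev]

theorem segment_re_of_eq {x y z : ℂ} (h : x.re = y.re) (hz : z ∈ segment ℝ x y) : z.re = x.re := by
  obtain ⟨s, t, -, -, hst, rfl⟩ := hz
  simp [← h, ← add_mul, hst]

theorem segment_im_of_eq {x y z : ℂ} (h : x.im = y.im) (hz : z ∈ segment ℝ x y) : z.im = x.im := by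
  obtain ⟨s, t, -, -, hst, rfl⟩ := hz
  simp [← h, ← add_mul, hst]

theorem segment_dart (d : Dart M.a) : segment ℝ (M.pos (src d)) (M.pos (src (rev d))) ⊆ Vᶜ := by
  intro z hz hzV
  rcases M.src_eq d with ⟨-, h1, h2⟩ | ⟨-, h1, h2⟩
  · exact M.im_ne z hzV _ (segment_im_of_eq (by simp only [pos, h1]) hz)
  · exact M.re_ne z hzV _ (segment_re_of_eq (by simp only [pos, h1]) hz)

theorem pos_notMem (z : Vert M.a) : M.pos z ∉ V := fun h => M.re_ne _ h z.1 rfl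

theorem between {z w x : Vert M.a} {c : ℂ} {r : ℝ} (hz : M.pos z ∈ box c r)
    (hw : M.pos w ∈ box c r) (h1 : min z.1 w.1 ≤ x.1) (h2 : x.1 ≤ max z.1 w.1)
    (h3 : min z.2 w.2 ≤ x.2) (h4 : x.2 ≤ max z.2 w.2) : M.pos x ∈ box c r := by
  have hδ := M.δ_pos
  have mono : ∀ (b : ℝ) (i j : Fin (M.a + 1)), i ≤ j →
      b + ((i : ℕ) : ℝ) * δ ≤ b + ((j : ℕ) : ℝ) * δ := by
    intro b i j h
    have : ((i : ℕ) : ℝ) ≤ (j : ℕ) := by exact_mod_cast h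
    nlinarith
  rw [min_le_iff] at h1 h3
  rw [le_max_iff] at h2 h4
  exact mem_box_of_between hz hw (min_le_iff.2 (h1.imp (mono _ _ _) (mono _ _ _)))
    (le_max_iff.2 (h2.imp (mono _ _ _) (mono _ _ _)))
    (min_le_iff.2 (h3.imp (mono _ _ _) (mono _ _ _)))
    (le_max_iff.2 (h4.imp (mono _ _ _) (mono _ _ _)))

theorem reach_box {z w : Vert M.a} {c : ℂ} {r : ℝ} (hz : M.pos z ∈ box c r)
    (hw : M.pos w ∈ box c r) : ReflTransGen (Step (M.pos ⁻¹' box c r)) z w :=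
  Grid.reach_box fun _ h1 h2 h3 h4 => M.between hz hw h1 h2 h3 h4

/-- The lower left corner of a cell. -/
def corner (c : Fin M.a × Fin M.a) : Vert M.a := (c.1.castSucc, c.2.castSucc)

theorem exists_index {b p : ℝ} (h1 : b ≤ p) (h2 : p < b + M.a * δ) :
    ∃ i : Fin M.a, b + (i : ℕ) * δ ≤ p ∧ p < b + (i : ℕ) * δ + δ := by
  have hδ := M.δ_pos
  have h0 : 0 ≤ (p - b) / δ := div_nonneg (by linarith) hδ.le
  have hi : ⌊(p - b) / δ⌋₊ < M.a := by
    rw [Nat.floor_lt h0, div_lt_iff₀ hδ]; linarith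
  refine ⟨⟨_, hi⟩, ?_, ?_⟩
  · have := (le_div_iff₀ hδ).1 (Nat.floor_le h0)
    simp only; linarith
  · have := (div_lt_iff₀ hδ).1 (Nat.lt_floor_add_one ((p - b) / δ))
    simp only; linarith

theorem exists_near {p : ℂ} (hp : |p.re| < R ∧ |p.im| < R) : ∃ z, M.pos z ∈ box p (2 * δ) := by
  have hδ := M.δ_pos
  rw [abs_lt, abs_lt] at hp
  obtain ⟨i, hi1, hi2⟩ := M.exists_index (b := M.x) (p := p.re) (by linarith [M.x_lt])
    (by linarith [M.lt_x])
  obtain ⟨j, hj1, hj2⟩ := M.exists_index (b := M.y) (p := p.im) (by linarith [M.y_lt])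
    (by linarith [M.lt_y])
  refine ⟨M.corner (i, j), ?_, ?_⟩ <;> simp only [pos, corner, Fin.val_castSucc] <;>
    rw [abs_lt] <;> constructor <;> linarith

theorem frame_far {z : Vert M.a} (hz : z ∈ frame M.a) : R < |(M.pos z).re| ∨ R < |(M.pos z).im| := by
  have h1 := M.x_lt
  have h2 := M.lt_x
  have h3 := M.y_lt
  have h4 := M.lt_y
  rcases hz with h | h | h | h
  · left; simp only [pos, h, Fin.val_zero]; rw [lt_abs]; right; simp; linarith
  · left; simp only [pos, h, Fin.val_last]; rw [lt_abs]; left; linarith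
  · right; simp only [pos, h, Fin.val_zero]; rw [lt_abs]; right; simp; linarith
  · right; simp only [pos, h, Fin.val_last]; rw [lt_abs]; left; linarith

variable {Γ : Type} [Group Γ] (A : Voltage (Punct V) Γ)

/-- The voltage of a dart of the mesh. -/
noncomputable def volt (d : Dart M.a) : Γ := A.sg (M.pos (src d)) (M.pos (src (rev d)))

theorem volt_rev (d : Dart M.a) : M.volt A ((sphere M.a).α d) = (M.volt A d)⁻¹ := by
  change A.sg _ (M.pos (src (rev (rev d)))) = _
  rw [rev_rev, A.sg_symm]
  rfl

theorem walk_of_reach {K : Set ℂ} (hK : Convex ℝ K) (hKV : K ⊆ Vᶜ) {S P : Set (Vert M.a)}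
    (hS : S ⊆ M.pos ⁻¹' K) (hSP : S ⊆ P) {z w : Vert M.a} (hw : w ∈ S)
    (h : ReflTransGen (Step S) z w) :
    (sphere M.a).WalkIn (M.volt A) P z w (A.sg (M.pos z) (M.pos w)) := by
  induction h using ReflTransGen.head_induction_on with
  | refl =>
    rw [A.sg_self]
    exact .refl (hSP hw)
  | @head x y hxy _ ih =>
    obtain ⟨hx, hy, d, rfl, rfl⟩ := hxy
    rw [← A.sg_trans hK hKV (hS hx) (hS hy) (hS hw)]
    exact .head (C := sphere M.a) (hSP hx) ih

theorem face (c : Option (Fin M.a × Fin M.a)) :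
    (∀ d ∈ word c, src d ∈ frame M.a ∧ src (rev d) ∈ frame M.a) ∨
    (∃ v ∈ V, ∀ d ∈ word c, M.pos (src d) ∈ box v (2 * δ) ∧ M.pos (src (rev d)) ∈ box v (2 * δ)) ∨
    ∃ z, (sphere M.a).IsWalk (word c) z z ∧ ((word c).map (M.volt A)).prod = 1 := by
  have hδ := M.δ_pos
  rcases c with _ | ⟨i, j⟩
  · exact Or.inl fun d hd => src_mem_frame ((mem_word d none).1 hd)
  · right
    set K : Set ℂ := Set.Icc (M.x + (i : ℕ) * δ) (M.x + (i : ℕ) * δ + δ) ×ℂ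
      Set.Icc (M.y + (j : ℕ) * δ) (M.y + (j : ℕ) * δ + δ) with hKdef
    have hK : Convex ℝ K :=
      ((convex_Icc _ _).linear_preimage Complex.reLm).inter
        ((convex_Icc _ _).linear_preimage Complex.imLm)
    have hc : ∀ p q : ℕ, p ≤ 1 → q ≤ 1 → (⟨M.x + ((i + p : ℕ) : ℝ) * δ, M.y + ((j + q : ℕ) : ℝ) * δ⟩ : ℂ) ∈ K := by
      intro p q hp hq
      have hp' : (p : ℝ) ≤ 1 := by exact_mod_cast hp
      have hq' : (q : ℝ) ≤ 1 := by exact_mod_cast hq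
      have hp0 : (0 : ℝ) ≤ p := p.cast_nonneg
      have hq0 : (0 : ℝ) ≤ q := q.cast_nonneg
      rw [hKdef, Complex.mem_reProdIm]
      push_cast
      refine ⟨⟨?_, ?_⟩, ?_, ?_⟩ <;> nlinarith
    have c1 : M.pos (i.castSucc, j.castSucc) ∈ K := hc 0 0 zero_le_one zero_le_one
    have c2 : M.pos (i.succ, j.castSucc) ∈ K := hc 1 0 le_rfl zero_le_one
    have c3 : M.pos (i.succ, j.succ) ∈ K := hc 1 1 le_rfl le_rfl
    have c4 : M.pos (i.castSucc, j.succ) ∈ K := hc 0 1 zero_le_one le_rfl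
    have hword : word (some (i, j)) = square (i, j) := rfl
    by_cases hV : ∃ v ∈ V, v ∈ K
    · left
      obtain ⟨v, hv, hvK⟩ := hV
      have near : ∀ p ∈ K, p ∈ box v (2 * δ) := by
        intro p hp
        rw [hKdef, Complex.mem_reProdIm] at hp hvK
        obtain ⟨⟨_, _⟩, _, _⟩ := hp
        obtain ⟨⟨_, _⟩, _, _⟩ := hvK
        refine ⟨?_, ?_⟩ <;> rw [abs_lt] <;> constructor <;> linarith
      refine ⟨v, hv, ?_⟩
      rw [hword]
      simp only [square, List.forall_mem_cons, src, rev]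
      simp [near _ c1, near _ c2, near _ c3, near _ c4]
    · right
      push Not at hV
      have hKV : K ⊆ Vᶜ := fun p hp hpV => hV p hpV hp
      refine ⟨(i.castSucc, j.castSucc), ?_, ?_⟩
      · rw [hword]
        simp [square, SphereComplex.IsWalk, sphere, src, rev]
      · rw [hword]
        have e1 : M.volt A (false, false, i, j.castSucc) =
          A.sg (M.pos (i.castSucc, j.castSucc)) (M.pos (i.succ, j.castSucc)) := rfl
        have e2 : M.volt A (true, false, j, i.succ) =
          A.sg (M.pos (i.succ, j.castSucc)) (M.pos (i.succ, j.succ)) := rfl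
        have e3 : M.volt A (false, true, i, j.succ) =
          A.sg (M.pos (i.succ, j.succ)) (M.pos (i.castSucc, j.succ)) := rfl
        have e4 : M.volt A (true, true, j, i.castSucc) =
          A.sg (M.pos (i.castSucc, j.succ)) (M.pos (i.castSucc, j.castSucc)) := rfl
        simp only [square, List.map_cons, List.map_nil, List.prod_cons, List.prod_nil, mul_one,
          e1, e2, e3, e4]
        rw [A.sg_trans hK hKV c3 c4 c1, A.sg_trans hK hKV c2 c3 c1, A.sg_trans hK hKV c1 c2 c1,
          A.sg_self]

end Mesh

namespace Mesh

open Grid Relation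

variable {V : Set ℂ} {δ R : ℝ} (M : Mesh V δ R) {Γ : Type} [Group Γ] (A : Voltage (Punct V) Γ)

/-- The grid vertices near a path. -/
def near {x y : Punct V} (p : Path x y) : Set (Vert M.a) :=
  {z | ∃ t, M.pos z ∈ box (p t : ℂ) (3 * δ)}

theorem near_subpath {x y : Punct V} (p : Path x y) (s t : I) :
    M.near (p.subpath s t) ⊆ M.near p := by
  rintro z ⟨r, hr⟩
  exact ⟨_, hr⟩

/-- The grid vertices close to a puncture. -/
def blobs (ρ : ℝ) : Set (Vert M.a) := {z | ∃ w ∈ V, M.pos z ∈ box w ρ}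

theorem walk_of_box {c : ℂ} {r : ℝ} (h : box c r ⊆ Vᶜ) {z w : Vert M.a} (hz : M.pos z ∈ box c r)
    (hw : M.pos w ∈ box c r) :
    (sphere M.a).WalkIn (M.volt A) (M.pos ⁻¹' box c r) z w (A.sg (M.pos z) (M.pos w)) :=
  M.walk_of_reach A (convex_box c r) h subset_rfl subset_rfl hw (M.reach_box hz hw)

theorem exists_partition {x y : Punct V} (p : Path x y) {δ : ℝ} (hδ : 0 < δ) :
    ∃ (N : ℕ) (τ : ℕ → I), τ 0 = 0 ∧ τ N = 1 ∧
      ∀ k, ∀ s ∈ Set.uIcc (τ k) (τ (k + 1)), (p s : ℂ) ∈ box (p (τ k) : ℂ) δ := by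
  have huc : UniformContinuous fun t => (p t : ℂ) :=
    CompactSpace.uniformContinuous_of_continuous (by fun_prop)
  obtain ⟨ε, hε, H⟩ := Metric.uniformContinuous_iff.1 huc δ hδ
  obtain ⟨N, hN⟩ := exists_nat_gt (1 / ε)
  have hN0 : (0 : ℝ) < N := (one_div_pos.2 hε).trans hN
  refine ⟨N, fun k => Set.projIcc 0 1 zero_le_one ((k : ℝ) / N), ?_, ?_, fun k s hs => ?_⟩
  · exact Set.projIcc_of_le_left _ (by simp)
  · exact Set.projIcc_of_right_le _ (by rw [div_self hN0.ne'])
  · refine ball_subset_box _ _ (Metric.mem_ball.2 (H ?_))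
    have h1 : |(s : ℝ) - (Set.projIcc (0 : ℝ) 1 zero_le_one ((k : ℝ) / N) : ℝ)| ≤
        |((Set.projIcc (0 : ℝ) 1 zero_le_one (((k + 1 : ℕ) : ℝ) / N) : I) : ℝ) -
          (Set.projIcc (0 : ℝ) 1 zero_le_one ((k : ℝ) / N) : I)| := by
      have : (s : ℝ) ∈ Set.uIcc ((Set.projIcc (0 : ℝ) 1 zero_le_one ((k : ℝ) / N) : I) : ℝ)
        ((Set.projIcc (0 : ℝ) 1 zero_le_one (((k + 1 : ℕ) : ℝ) / N) : I) : ℝ) := by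
        rw [Set.mem_uIcc] at hs ⊢
        exact hs
      exact Set.abs_sub_left_of_mem_uIcc this
    have h2 := Set.abs_projIcc_sub_projIcc (a := (0 : ℝ)) (b := 1) (c := ((k + 1 : ℕ) : ℝ) / N)
      (d := (k : ℝ) / N) zero_le_one
    rw [Subtype.dist_eq, Real.dist_eq]
    refine h1.trans_lt (h2.trans_lt ?_)
    rw [← sub_div]
    push_cast
    rw [add_sub_cancel_left, abs_of_pos (by positivity), div_lt_iff₀ hN0]
    rw [div_lt_iff₀ hε] at hN
    linarith

theorem approx {x y : Punct V} (p : Path x y) {ρ : ℝ} (hρ : 3 * δ ≤ ρ)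
    (hp : ∀ t, box (p t : ℂ) ρ ⊆ Vᶜ) (hR : ∀ t, |(p t : ℂ).re| < R ∧ |(p t : ℂ).im| < R)
    {z w : Vert M.a} (hz : M.pos z ∈ box (x : ℂ) (2 * δ)) (hw : M.pos w ∈ box (y : ℂ) (2 * δ)) :
    (sphere M.a).WalkIn (M.volt A) (M.near p) z w
      (A.sg (M.pos z) x * A.G p * A.sg y (M.pos w)) := by
  have hδ := M.δ_pos
  obtain ⟨N, τ, h0, hN, hτ⟩ := exists_partition p hδ
  have h3 : ∀ t, box (p t : ℂ) (3 * δ) ⊆ Vᶜ := fun t => (box_mono hρ).trans (hp t)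
  have h23 : (2 * δ) ≤ 3 * δ := by linarith
  have claim : ∀ k, ∀ w, M.pos w ∈ box (p (τ k) : ℂ) (2 * δ) →
      (sphere M.a).WalkIn (M.volt A) (M.near p) z w
        (A.sg (M.pos z) (p 0) * A.G (p.subpath 0 (τ k)) * A.sg (p (τ k)) (M.pos w)) := by
    intro k
    induction k with
    | zero =>
      intro w hw
      rw [h0] at hw ⊢
      rw [Path.subpath_self, A.map_refl, mul_one]
      have hz' : M.pos z ∈ box (p 0 : ℂ) (3 * δ) := by
        rw [p.source]; exact box_mono h23 hz
      have hw' := box_mono h23 hw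
      rw [A.sg_trans (convex_box _ _) (h3 0) hz' (mem_box_self (by linarith)) hw']
      exact (M.walk_of_box A (h3 0) hz' hw').mono (Q := M.near p) fun v hv => ⟨0, hv⟩
    | succ k ih =>
      intro w hw
      obtain ⟨v, hv⟩ := M.exists_near (hR (τ k))
      have hk := hτ k (τ (k + 1)) Set.right_mem_uIcc
      have hw' : M.pos w ∈ box (p (τ k) : ℂ) (3 * δ) :=
        box_mono (by linarith) (box_subset hk hw)
      have hv' := box_mono h23 hv
      have step : A.G (p.subpath (τ k) (τ (k + 1))) = A.sg (p (τ k)) (p (τ (k + 1))) :=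
        A.G_eq_sg (convex_box _ _) (h3 (τ k)) _ fun t => by
          have hmem : (p.subpath (τ k) (τ (k + 1))) t ∈ Set.range (p.subpath (τ k) (τ (k + 1))) :=
            ⟨t, rfl⟩
          rw [Path.range_subpath] at hmem
          obtain ⟨s, hs, hs'⟩ := hmem
          rw [← hs']
          exact box_mono (by linarith) (hτ k s hs)
      have := (ih v hv).trans ((M.walk_of_box A (h3 (τ k)) hv' hw').mono (Q := M.near p)
        fun v hv => ⟨_, hv⟩)
      convert this using 1
      rw [A.map_subpath_trans p 0 (τ k) (τ (k + 1)), step]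
      have hc := mem_box_self (c := (p (τ k) : ℂ)) (r := 3 * δ) (by linarith)
      have hk' := box_mono (by linarith : δ ≤ 3 * δ) hk
      simp only [mul_assoc]
      rw [A.sg_trans (convex_box _ _) (h3 (τ k)) hc hk' hw',
        A.sg_trans (convex_box _ _) (h3 (τ k)) hc hv' hw']
  have := claim N w (by rw [hN, p.target]; exact hw)
  rw [hN, A.map_subpath_zero_one] at this
  simpa using this

theorem trans_mem {K : Set ℂ} {x y z : Punct V} (p : Path x y) (q : Path y z)
    (hp : ∀ t, (p t : ℂ) ∈ K) (hq : ∀ t, (q t : ℂ) ∈ K) (t : I) : (p.trans q t : ℂ) ∈ K := by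
  rw [Path.trans_apply]
  split_ifs
  · exact hp _
  · exact hq _

theorem exists_segPath {x y : Punct V} {K : Set ℂ} (h : segment ℝ (x : ℂ) y ⊆ Vᶜ)
    (hK : segment ℝ (x : ℂ) y ⊆ K) :
    ∃ q : Path x y, (∀ t, (q t : ℂ) ∈ K) ∧ A.G q = A.sg x y :=
  ⟨segPath h, fun t => hK (segPath_mem h t), by rw [Voltage.sg, dif_pos h]⟩

theorem exists_path_of_walk {K : Set ℂ} (hK : Convex ℝ K) {P : Set (Vert M.a)}
    (hP : P ⊆ M.pos ⁻¹' K) {z w : Vert M.a} {γ : Γ}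
    (h : (sphere M.a).WalkIn (M.volt A) P z w γ) :
    ∃ q : Path (⟨M.pos z, M.pos_notMem z⟩ : Punct V) ⟨M.pos w, M.pos_notMem w⟩,
      (∀ t, (q t : ℂ) ∈ K) ∧ A.G q = γ := by
  induction h with
  | @refl z hz => exact ⟨Path.refl _, fun t => hP hz, A.map_refl _⟩
  | @head d w γ hd h ih =>
    obtain ⟨q, hq, rfl⟩ := ih
    have hs : segment ℝ (M.pos (src d)) (M.pos (src (rev d))) ⊆ K :=
      hK.segment_subset (hP hd) (hP h.start_mem)
    refine ⟨(segPath (M.segment_dart d)).trans q,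
      trans_mem _ _ (fun t => hs (segPath_mem _ t)) hq, (A.map_trans _ _).trans ?_⟩
    rw [volt, Voltage.sg, dif_pos (M.segment_dart d)]
    rfl

theorem exists_exit {u : ℂ} {r ρ ρ' : ℝ}
    (hdisj : ∀ w ∈ V, w ≠ u → Disjoint (box u r) (box w r)) (hu : u ∈ V) (hρ : 2 * ρ ≤ r)
    (hδ : 4 * δ ≤ ρ) {x y : Punct V} (p : Path x y) (hδ' : 3 * δ ≤ ρ')
    (hp : ∀ t, box (p t : ℂ) ρ' ⊆ Vᶜ) (hR : ∀ t, |(p t : ℂ).re| < R ∧ |(p t : ℂ).im| < R)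
    (hpu : ∀ t, (p t : ℂ) ∈ box u (r / 2)) (hx : (x : ℂ) ∈ box u (ρ / 2))
    (hy : ∀ w ∈ V, (y : ℂ) ∉ box w (2 * ρ)) {z₁ : Vert M.a}
    (hz₁ : M.pos z₁ ∈ box (y : ℂ) (2 * δ)) :
    ∃ (d : Dart M.a) (γ : Γ) (q : Path (⟨M.pos (src d), M.pos_notMem _⟩ : Punct V) x),
      M.pos (src d) ∈ box u ρ ∧ (∀ t, (q t : ℂ) ∈ pbox u r) ∧
      (sphere M.a).WalkIn (M.volt A) (M.near p \ M.blobs ρ) (src (rev d)) z₁ γ ∧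
      M.volt A d * γ = A.G q * A.G p * A.sg y (M.pos z₁) := by
  have hδ0 := M.δ_pos
  have hpbox : ∀ q ∈ box u r, q ∉ V → q ∈ pbox u r := fun q hq hqV =>
    ⟨hq, fun h => hqV (by rw [Set.mem_singleton_iff.1 h]; exact hu)⟩
  have hnear : M.near p ⊆ M.pos ⁻¹' box u r := by
    rintro z ⟨t, ht⟩
    exact box_mono (by linarith) (box_subset (hpu t) ht)
  obtain ⟨z₀, hz₀⟩ : ∃ z, M.pos z ∈ box (x : ℂ) (2 * δ) := by
    have := M.exists_near (hR 0)
    rwa [p.source] at this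
  have hz₀u : M.pos z₀ ∈ box u ρ := box_mono (by linarith) (box_subset hx hz₀)
  have hz₁B : z₁ ∉ M.blobs ρ := by
    rintro ⟨w, hw, h⟩
    exact hy w hw (box_mono (by linarith) (box_subset h (mem_box_comm.1 hz₁)))
  rcases (M.approx A p hδ' hp hR hz₀ hz₁).last_exit hz₁B with h | ⟨d, q₀, q₁, hd, h0, h1, h2⟩
  · exact absurd ⟨u, hu, hz₀u⟩ h.start_mem.2
  · have hdP : M.pos (src d) ∈ box u r := by
      have := (h0.symm (g := M.volt A) (M.volt_rev A)).start_mem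
      exact hnear this
    have hdu : M.pos (src d) ∈ box u ρ := by
      obtain ⟨w, hw, hdw⟩ := hd
      by_cases hwu : w = u
      · rwa [hwu] at hdw
      · exact absurd (box_mono (by linarith) hdw) (Set.disjoint_left.1 (hdisj w hw hwu) hdP)
    obtain ⟨q, hq, hqG⟩ : ∃ q : Path (⟨M.pos z₀, M.pos_notMem z₀⟩ : Punct V)
        ⟨M.pos (src d), M.pos_notMem (src d)⟩, (∀ t, (q t : ℂ) ∈ box u r) ∧ A.G q = q₀ :=
      M.exists_path_of_walk A (convex_box u r) hnear h0
    have hbx : box (x : ℂ) ρ' ⊆ Vᶜ := by simpa using hp 0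
    have hseg : segment ℝ (M.pos z₀) x ⊆ box (x : ℂ) (2 * δ) :=
      (convex_box _ _).segment_subset hz₀ (mem_box_self (by linarith))
    have hsegV : segment ℝ (M.pos z₀) x ⊆ Vᶜ :=
      hseg.trans ((box_mono (by linarith)).trans hbx)
    have hsegu : segment ℝ (M.pos z₀) x ⊆ box u r :=
      hseg.trans (fun q hq => box_mono (by linarith) (box_subset hx hq))
    obtain ⟨e, he, heG⟩ := exists_segPath A (x := ⟨M.pos z₀, M.pos_notMem z₀⟩) (y := x) hsegV hsegu
    refine ⟨d, q₁, q.symm.trans e, hdu, fun t => ?_, h1, ?_⟩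
    · have hm := trans_mem (K := box u r) q.symm e (fun t => hq (σ t)) he t
      exact hpbox _ hm ((q.symm.trans e) t).2
    · rw [A.map_trans, A.map_symm, hqG, heG]
      have : M.volt A d * q₁ = q₀⁻¹ * (q₀ * M.volt A d * q₁) := by group
      rw [this, ← h2]
      group

end Mesh

namespace Mesh

open Grid Relation

variable {V : Set ℂ} {δ R : ℝ} (M : Mesh V δ R) {Γ : Type} [Group Γ] (A : Voltage (Punct V) Γ)

theorem exists_arc {u v : ℂ} {r ρ ρ' : ℝ} (hu : u ∈ V) (hv : v ∈ V)
    (hdisj : ∀ w ∈ V, ∀ w' ∈ V, w ≠ w' → Disjoint (box w r) (box w' r)) (hρ : 2 * ρ ≤ r)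
    (hδ : 4 * δ ≤ ρ) (hδ' : 3 * δ ≤ ρ') {x y : Punct V} (p : Path x y)
    (hp : ∀ t, box (p t : ℂ) ρ' ⊆ Vᶜ) (hR : ∀ t, |(p t : ℂ).re| < R ∧ |(p t : ℂ).im| < R)
    {s₁ s₂ : I} (hs : s₁ ≤ s₂) (hleft : ∀ t ≤ s₁, (p t : ℂ) ∈ box u (r / 2))
    (hright : ∀ t, s₂ ≤ t → (p t : ℂ) ∈ box v (r / 2))
    (hmid : ∀ t, s₁ ≤ t → t ≤ s₂ → ∀ w ∈ V, (p t : ℂ) ∉ box w (2 * ρ))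
    (hx : (x : ℂ) ∈ box u (ρ / 2)) (hy : (y : ℂ) ∈ box v (ρ / 2)) :
    ∃ (d e : Dart M.a) (γ : Γ) (q₁ : Path (⟨M.pos (src d), M.pos_notMem _⟩ : Punct V) x)
      (q₂ : Path y ⟨M.pos (src e), M.pos_notMem _⟩),
      M.pos (src d) ∈ box u ρ ∧ M.pos (src e) ∈ box v ρ ∧ (∀ t, (q₁ t : ℂ) ∈ pbox u r) ∧
      (∀ t, (q₂ t : ℂ) ∈ pbox v r) ∧
      (sphere M.a).WalkIn (M.volt A) (M.near p \ M.blobs ρ) (src (rev d)) (src (rev e)) γ ∧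
      M.volt A d * γ * (M.volt A e)⁻¹ = A.G q₁ * A.G p * A.G q₂ := by
  have hδ0 := M.δ_pos
  obtain ⟨z₁, hz₁⟩ := M.exists_near (hR s₁)
  obtain ⟨z₂, hz₂⟩ := M.exists_near (hR s₂)
  have hsub : ∀ s s' t, ∃ τ ∈ Set.uIcc s s', (p.subpath s s') t = p τ := by
    intro s s' t
    have hmem : (p.subpath s s') t ∈ Set.range (p.subpath s s') := ⟨t, rfl⟩
    rw [Path.range_subpath] at hmem
    obtain ⟨τ, hτ, h⟩ := hmem
    exact ⟨τ, hτ, h.symm⟩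
  have hdisj' : ∀ w ∈ V, ∀ w' ∈ V, w' ≠ w → Disjoint (box w r) (box w' r) := fun w hw w' hw' h =>
    hdisj w hw w' hw' h.symm
  have key₁ := M.exists_exit A (hdisj' u hu) hu hρ hδ
    ((p.subpath 0 s₁).cast p.source.symm rfl) hδ' (fun t => hp _) (fun t => hR _) (fun t => by
      obtain ⟨τ, hτ, h⟩ := hsub 0 s₁ t
      rw [Path.cast_coe, h]
      rw [Set.uIcc_of_le (show (0 : I) ≤ s₁ from s₁.2.1)] at hτ
      exact hleft τ hτ.2) hx (hmid s₁ le_rfl hs) hz₁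
  have key₂ := M.exists_exit A (hdisj' v hv) hv hρ hδ
    ((p.subpath 1 s₂).cast p.target.symm rfl) hδ' (fun t => hp _) (fun t => hR _) (fun t => by
      obtain ⟨τ, hτ, h⟩ := hsub 1 s₂ t
      rw [Path.cast_coe, h]
      rw [Set.uIcc_of_ge (show s₂ ≤ (1 : I) from s₂.2.2)] at hτ
      exact hright τ hτ.1) hy (hmid s₂ hs le_rfl) hz₂
  obtain ⟨d, γ₁, q₁, hd, hq₁, hw₁, hG₁⟩ := key₁
  obtain ⟨e, γ₂, q₂, he, hq₂, hw₂, hG₂⟩ := key₂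
  have hmidw := M.approx A (p.subpath s₁ s₂) hδ' (fun t => hp _) (fun t => hR _) hz₁ hz₂
  have hB : M.near (p.subpath s₁ s₂) ⊆ M.near p \ M.blobs ρ := by
    refine fun z hz => ⟨M.near_subpath p _ _ hz, ?_⟩
    rintro ⟨w, hw, hzw⟩
    obtain ⟨t, ht⟩ := hz
    obtain ⟨τ, hτ, h⟩ := hsub s₁ s₂ t
    rw [h] at ht
    rw [Set.uIcc_of_le hs] at hτ
    exact hmid τ hτ.1 hτ.2 w hw (box_mono (by linarith) (box_subset hzw (mem_box_comm.1 ht)))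
  have hn₁ : M.near ((p.subpath 0 s₁).cast p.source.symm rfl) \ M.blobs ρ ⊆ M.near p \ M.blobs ρ :=
    Set.sdiff_subset_sdiff_left (M.near_subpath p 0 s₁)
  have hn₂ : M.near ((p.subpath 1 s₂).cast p.target.symm rfl) \ M.blobs ρ ⊆ M.near p \ M.blobs ρ :=
    Set.sdiff_subset_sdiff_left (M.near_subpath p 1 s₂)
  refine ⟨d, e, _, q₁, q₂.symm, hd, he, hq₁, fun t => hq₂ _, ((hw₁.mono hn₁).trans
    (hmidw.mono hB)).trans (((hw₂.mono hn₂).symm (M.volt_rev A))), ?_⟩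
  have e1 : A.sg (p s₁ : ℂ) (M.pos z₁) * A.sg (M.pos z₁) (p s₁ : ℂ) = 1 := by
    rw [A.sg_symm (M.pos z₁), inv_mul_cancel]
  have e2 : A.G p = A.G (p.subpath 0 s₁) * A.G (p.subpath s₁ s₂) * (A.G (p.subpath 1 s₂))⁻¹ := by
    rw [← A.map_symm, Path.symm_subpath, ← A.map_subpath_trans, ← A.map_subpath_trans,
      A.map_subpath_zero_one]
  rw [A.map_cast] at hG₁ hG₂
  have e3 : γ₂⁻¹ * (M.volt A e)⁻¹ = (A.sg (p s₂ : ℂ) (M.pos z₂))⁻¹ *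
      (A.G (p.subpath 1 s₂))⁻¹ * (A.G q₂)⁻¹ := by
    rw [← mul_inv_rev, hG₂]; group
  calc _ = (M.volt A d * γ₁) * (A.sg (M.pos z₁) (p s₁ : ℂ) * A.G (p.subpath s₁ s₂) *
        A.sg (p s₂ : ℂ) (M.pos z₂)) * (γ₂⁻¹ * (M.volt A e)⁻¹) := by group
    _ = A.G q₁ * A.G (p.subpath 0 s₁) * (A.sg (p s₁ : ℂ) (M.pos z₁) * A.sg (M.pos z₁) (p s₁ : ℂ)) *
        A.G (p.subpath s₁ s₂) * (A.G (p.subpath 1 s₂))⁻¹ * (A.G q₂)⁻¹ := by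
      rw [hG₁, e3]; group
    _ = _ := by rw [e1, e2, A.map_symm]; group

/-- The voltages of the loops around a puncture. -/
def loops (A : Voltage (Punct V) Γ) (u : ℂ) (r : ℝ) (b : Punct V) (hb : (b : ℂ) ∈ pbox u r) :
    Subgroup Γ where
  carrier := {γ | ∃ p : Path b b, (∀ t, (p t : ℂ) ∈ pbox u r) ∧ A.G p = γ}
  mul_mem' := by
    rintro _ _ ⟨p, hp, rfl⟩ ⟨q, hq, rfl⟩
    exact ⟨p.trans q, trans_mem p q hp hq, A.map_trans _ _⟩
  one_mem' := ⟨Path.refl b, fun _ => hb, A.map_refl _⟩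
  inv_mem' := by
    rintro _ ⟨p, hp, rfl⟩
    exact ⟨p.symm, fun t => hp _, A.map_symm _⟩

theorem exists_path_pbox {u : ℂ} {r : ℝ} (hr : pbox u r ⊆ Vᶜ) {x y : Punct V}
    (hx : (x : ℂ) ∈ pbox u r) (hy : (y : ℂ) ∈ pbox u r) :
    ∃ p : Path x y, ∀ t, (p t : ℂ) ∈ pbox u r := by
  obtain ⟨p, hp⟩ := joinedIn_pbox hx hy
  exact ⟨⟨⟨fun t => ⟨p t, hr (hp t)⟩, by fun_prop⟩, Subtype.ext p.source, Subtype.ext p.target⟩, hp⟩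

theorem exists_gauge {r ρ : ℝ} (hr : ∀ v ∈ V, pbox v r ⊆ Vᶜ)
    (hdisj : ∀ w ∈ V, ∀ w' ∈ V, w ≠ w' → Disjoint (box w r) (box w' r)) (hρ : ρ ≤ r)
    (b : V → Punct V) (hb : ∀ v : V, (b v : ℂ) ∈ pbox v r) :
    ∃ h : Vert M.a → Γ, ∀ v : V, ∀ z, M.pos z ∈ box v ρ →
      ∃ p : Path (b v) ⟨M.pos z, M.pos_notMem z⟩, (∀ t, (p t : ℂ) ∈ pbox v r) ∧
        h z = (A.G p)⁻¹ := by
  have key : ∀ z, ∃ γ : Γ, ∀ v : V, M.pos z ∈ box v ρ →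
      ∃ p : Path (b v) ⟨M.pos z, M.pos_notMem z⟩, (∀ t, (p t : ℂ) ∈ pbox v r) ∧ γ = (A.G p)⁻¹ := by
    intro z
    by_cases h : ∃ v : V, M.pos z ∈ box v ρ
    · obtain ⟨v, hv⟩ := h
      have hz : M.pos z ∈ pbox v r :=
        ⟨box_mono hρ hv, fun h => M.pos_notMem z (by rw [Set.mem_singleton_iff.1 h]; exact v.2)⟩
      obtain ⟨p, hp⟩ := exists_path_pbox (hr v v.2) (hb v)
        (y := ⟨M.pos z, M.pos_notMem z⟩) hz
      refine ⟨(A.G p)⁻¹, fun w hw => ?_⟩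
      have : v = w := by
        by_contra hne
        exact Set.disjoint_left.1 (hdisj v v.2 w w.2 fun h => hne (Subtype.ext h))
          (box_mono hρ hv) (box_mono hρ hw)
      subst this
      exact ⟨p, hp, rfl⟩
    · push Not at h
      exact ⟨1, fun v hv => absurd hv (h v)⟩
  choose h hh using key
  exact ⟨h, fun v z => hh z v⟩

end Mesh

section Scales

theorem exists_box_disjoint {K T : Set ℂ} (hK : IsCompact K) (hT : IsClosed T)
    (h : Disjoint K T) : ∃ ρ > 0, ∀ x ∈ K, ∀ y ∈ T, y ∉ box x ρ := by
  obtain ⟨r, hr, H⟩ := Metric.exists_pos_forall_lt_edist hK hT h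
  refine ⟨r / 2, by positivity, fun x hx y hy hxy => ?_⟩
  have h1 := H x hx y hy
  rw [edist_nndist, ENNReal.coe_lt_coe, ← NNReal.coe_lt_coe, coe_nndist, dist_comm,
    dist_eq_norm] at h1
  have h2 := Complex.norm_le_abs_re_add_abs_im (y - x)
  have h3 := hxy.1
  have h4 := hxy.2
  rw [Complex.sub_re, Complex.sub_im] at h2
  linarith

theorem exists_forall_box {α : Type*} {s : Set α} (hs : s.Finite) (P : α → ℝ → Prop)
    (hP : ∀ x, ∀ r r', r' ≤ r → P x r → P x r') (h : ∀ x ∈ s, ∃ r > 0, P x r) :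
    ∃ r > 0, ∀ x ∈ s, P x r := by
  induction s, hs using Set.Finite.induction_on with
  | empty => exact ⟨1, one_pos, fun _ h => h.elim⟩
  | @insert x s _ _ ih =>
    obtain ⟨r, hr, H⟩ := ih fun y hy => h y (Set.mem_insert_of_mem _ hy)
    obtain ⟨r', hr', H'⟩ := h x (Set.mem_insert _ _)
    refine ⟨min r r', lt_min hr hr', ?_⟩
    rintro y (rfl | hy)
    · exact hP _ _ _ (min_le_right _ _) H'
    · exact hP _ _ _ (min_le_left _ _) (H y hy)

theorem exists_disjoint_boxes {V : Set ℂ} (hV : V.Finite) :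
    ∃ r > 0, ∀ w ∈ V, ∀ w' ∈ V, w ≠ w' → Disjoint (box w r) (box w' r) := by
  have key : ∀ p ∈ V ×ˢ V, ∃ r > 0, p.1 ≠ p.2 → Disjoint (box p.1 r) (box p.2 r) := by
    rintro ⟨w, w'⟩ -
    by_cases hww : w = w'
    · exact ⟨1, one_pos, fun h => absurd hww h⟩
    · obtain ⟨ρ, hρ, H⟩ := exists_box_disjoint (isCompact_singleton (x := w))
        (isClosed_singleton (x := w')) (Set.disjoint_singleton.2 hww)
      refine ⟨ρ / 2, half_pos hρ, fun _ => Set.disjoint_left.2 fun z hz hz' => H w rfl w' rfl ?_⟩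
      have := box_subset hz (mem_box_comm.1 hz')
      rwa [add_halves] at this
  obtain ⟨r, hr, H⟩ := exists_forall_box (hV.prod hV) _ (fun p r r' h H hne =>
    (H hne).mono (box_mono h) (box_mono h)) key
  exact ⟨r, hr, fun w hw w' hw' => H (w, w') ⟨hw, hw'⟩⟩

variable {ι : Type*} [Finite ι] (c : ι → C(I, ℂ))

theorem exists_ends {ρ a : ℝ} (hρ : 0 < ρ) (ha : 0 < a) : ∃ b > 0, b < a ∧
    (∀ e (t : I), (t : ℝ) ≤ b → c e t ∈ box (c e 0) ρ) ∧
    ∀ e (t : I), 1 - b ≤ (t : ℝ) → c e t ∈ box (c e 1) ρ := by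
  have key : ∀ e ∈ (Set.univ : Set ι), ∃ b > 0, (∀ t : I, (t : ℝ) ≤ b → c e t ∈ box (c e 0) ρ) ∧
      ∀ t : I, 1 - b ≤ (t : ℝ) → c e t ∈ box (c e 1) ρ := by
    intro e _
    have huc : UniformContinuous (c e) :=
      CompactSpace.uniformContinuous_of_continuous (c e).continuous
    obtain ⟨ε, hε, H⟩ := Metric.uniformContinuous_iff.1 huc ρ hρ
    refine ⟨ε / 2, half_pos hε, fun t ht => ball_subset_box _ _ (H ?_),
      fun t ht => ball_subset_box _ _ (H ?_)⟩
    · rw [Subtype.dist_eq, Real.dist_eq, Set.Icc.coe_zero, sub_zero, abs_of_nonneg t.2.1]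
      linarith
    · rw [Subtype.dist_eq, Real.dist_eq, Set.Icc.coe_one, abs_sub_comm,
        abs_of_nonneg (sub_nonneg.2 t.2.2)]
      linarith
  obtain ⟨b, hb, H⟩ := exists_forall_box Set.finite_univ _ (fun e r r' h H =>
    ⟨fun t ht => H.1 t (ht.trans h), fun t ht => H.2 t (by linarith)⟩) key
  refine ⟨min b (a / 2), lt_min hb (half_pos ha), (min_le_right _ _).trans_lt (half_lt_self ha),
    fun e t ht => (H e trivial).1 t (ht.trans (min_le_left _ _)), fun e t ht =>
    (H e trivial).2 t ?_⟩
  have := min_le_left b (a / 2)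
  linarith

/-- The middle part of a curve. -/
def middle (a : ℝ) (c : C(I, ℂ)) : Set ℂ := c '' {t | a ≤ (t : ℝ) ∧ (t : ℝ) ≤ 1 - a}

theorem isCompact_middle (a : ℝ) (c : C(I, ℂ)) : IsCompact (middle a c) := by
  refine IsCompact.image (IsClosed.isCompact ?_) c.continuous
  exact (isClosed_le continuous_const continuous_subtype_val).inter
    (isClosed_le continuous_subtype_val continuous_const)

theorem middle_ne {a : ℝ} (ha : 0 < a) {t : I} (h : a ≤ (t : ℝ) ∧ (t : ℝ) ≤ 1 - a) :
    t ≠ 0 ∧ t ≠ 1 := by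
  constructor <;> rintro rfl <;> simp at h <;> linarith

theorem exists_margin {V : Set ℂ} (hV : V.Finite)
    (hc : ∀ e t, t ≠ 0 → t ≠ 1 → c e t ∉ V) {a : ℝ} (ha : 0 < a) :
    ∃ ρ > 0, ∀ e, ∀ z ∈ middle a (c e), ∀ w ∈ V, w ∉ box z ρ := by
  obtain ⟨ρ, hρ, H⟩ := exists_forall_box (s := (Set.univ : Set ι)) Set.finite_univ
    (fun e ρ => ∀ z ∈ middle a (c e), ∀ w ∈ V, w ∉ box z ρ)
    (fun e r r' h H z hz w hw hm => H z hz w hw (box_mono h hm)) fun e _ => by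
      refine exists_box_disjoint (isCompact_middle a (c e)) hV.isClosed ?_
      rw [Set.disjoint_left]
      rintro _ ⟨t, ht, rfl⟩
      exact hc e t (middle_ne ha ht).1 (middle_ne ha ht).2
  exact ⟨ρ, hρ, fun e => H e trivial⟩

theorem exists_separation (hc : ∀ e e', e ≠ e' → ∀ t t' : I, t ≠ 0 → t ≠ 1 → t' ≠ 0 → t' ≠ 1 →
    c e t ≠ c e' t') {a : ℝ} (ha : 0 < a) :
    ∃ η > 0, ∀ e e', e ≠ e' → ∀ z ∈ middle a (c e), ∀ w ∈ middle a (c e'), w ∉ box z η := by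
  obtain ⟨ρ, hρ, H⟩ := exists_forall_box (s := (Set.univ : Set (ι × ι))) Set.finite_univ
    (fun p ρ => p.1 ≠ p.2 → ∀ z ∈ middle a (c p.1), ∀ w ∈ middle a (c p.2), w ∉ box z ρ)
    (fun p r r' h H hne z hz w hw hm => H hne z hz w hw (box_mono h hm)) fun p _ => by
      by_cases hp : p.1 = p.2
      · exact ⟨1, one_pos, fun h => absurd hp h⟩
      obtain ⟨ρ, hρ, H⟩ := exists_box_disjoint (isCompact_middle a (c p.1))
        (isCompact_middle a (c p.2)).isClosed (by
          rw [Set.disjoint_left]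
          rintro _ ⟨t, ht, rfl⟩ ⟨t', ht', h⟩
          exact hc _ _ hp t t' (middle_ne ha ht).1 (middle_ne ha ht).2 (middle_ne ha ht').1
            (middle_ne ha ht').2 h.symm)
      exact ⟨ρ, hρ, fun _ => H⟩
  exact ⟨ρ, hρ, fun e e' => H (e, e') trivial⟩

theorem exists_bound {V : Set ℂ} (hV : V.Finite) : ∃ R : ℝ, (∀ w ∈ V, |w.re| < R ∧ |w.im| < R) ∧
    ∀ e t, |(c e t).re| < R ∧ |(c e t).im| < R := by
  have hK : IsCompact (V ∪ ⋃ e, Set.range (c e)) :=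
    hV.isCompact.union (isCompact_iUnion fun e => isCompact_range (c e).continuous)
  obtain ⟨R, hR⟩ := hK.isBounded.exists_norm_le
  have key : ∀ z ∈ V ∪ ⋃ e, Set.range (c e), |z.re| < R + 1 ∧ |z.im| < R + 1 := fun z hz =>
    ⟨(Complex.abs_re_le_norm z).trans_lt ((hR z hz).trans_lt (lt_add_one R)),
      (Complex.abs_im_le_norm z).trans_lt ((hR z hz).trans_lt (lt_add_one R))⟩
  exact ⟨R + 1, fun w hw => key w (Or.inl hw),
    fun e t => key _ (Or.inr (Set.mem_iUnion.2 ⟨e, t, rfl⟩))⟩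

end Scales

/-- Scales at which a loose family of curves is resolved. -/
structure Scales {ι : Type*} (V : Set ℂ) (c : ι → C(I, ℂ)) where
  r : ℝ
  a : ℝ
  ρ : ℝ
  b : ℝ
  ρ' : ℝ
  η : ℝ
  R : ℝ
  r_pos : 0 < r
  disj : ∀ w ∈ V, ∀ w' ∈ V, w ≠ w' → Disjoint (box w r) (box w' r)
  a_lt : a < 1 / 2
  left : ∀ e (t : I), (t : ℝ) ≤ a → c e t ∈ box (c e 0) (r / 2)
  right : ∀ e (t : I), 1 - a ≤ (t : ℝ) → c e t ∈ box (c e 1) (r / 2)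
  ρ_pos : 0 < ρ
  ρ_le : 2 * ρ ≤ r
  mid : ∀ e, ∀ z ∈ middle a (c e), ∀ w ∈ V, z ∉ box w (2 * ρ)
  b_pos : 0 < b
  b_lt : b < a
  left' : ∀ e (t : I), (t : ℝ) ≤ b → c e t ∈ box (c e 0) (ρ / 2)
  right' : ∀ e (t : I), 1 - b ≤ (t : ℝ) → c e t ∈ box (c e 1) (ρ / 2)
  ρ'_pos : 0 < ρ'
  margin : ∀ e, ∀ z ∈ middle b (c e), box z ρ' ⊆ Vᶜ
  η_pos : 0 < η
  sep : ∀ e e', e ≠ e' → ∀ z ∈ middle b (c e), ∀ w ∈ middle b (c e'), w ∉ box z η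
  bound_vert : ∀ w ∈ V, |w.re| < R ∧ |w.im| < R
  bound : ∀ e t, |(c e t).re| < R ∧ |(c e t).im| < R

theorem exists_scales {ι : Type*} [Finite ι] {V : Set ℂ} (hV : V.Finite) (c : ι → C(I, ℂ))
    (hcV : ∀ e t, t ≠ 0 → t ≠ 1 → c e t ∉ V)
    (hc : ∀ e e', e ≠ e' → ∀ t t' : I, t ≠ 0 → t ≠ 1 → t' ≠ 0 → t' ≠ 1 → c e t ≠ c e' t') :
    Nonempty (Scales V c) := by
  obtain ⟨r, hr, hdisj⟩ := exists_disjoint_boxes hV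
  obtain ⟨a, ha, ha', hl, hr'⟩ := exists_ends c (half_pos hr) (a := 1 / 2) (by norm_num)
  obtain ⟨ρ₀, hρ₀, hm⟩ := exists_margin c hV hcV ha
  have hρ : 0 < min ρ₀ r / 2 := half_pos (lt_min hρ₀ hr)
  obtain ⟨b, hb, hba, hl', hr''⟩ := exists_ends c (half_pos hρ) ha
  obtain ⟨ρ', hρ', hm'⟩ := exists_margin c hV hcV hb
  obtain ⟨η, hη, hs⟩ := exists_separation c hc hb
  obtain ⟨R, hR, hR'⟩ := exists_bound c hV
  refine ⟨⟨r, a, min ρ₀ r / 2, b, ρ', η, R, hr, hdisj, ha', hl, hr', hρ, ?_, ?_, hb, hba, hl', hr'',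
    hρ', fun e z hz w hw hwV => hm' e z hz w hwV hw, hη, hs, hR, hR'⟩⟩
  · have := min_le_right ρ₀ r
    linarith
  · intro e z hz w hw hzw
    refine hm e z hz w hw (mem_box_comm.1 (box_mono ?_ hzw))
    have := min_le_left ρ₀ r
    linarith

theorem pbox_subset {V : Set ℂ} {r : ℝ} (hr : 0 < r)
    (hdisj : ∀ w ∈ V, ∀ w' ∈ V, w ≠ w' → Disjoint (box w r) (box w' r)) {v : ℂ} (hv : v ∈ V) :
    pbox v r ⊆ Vᶜ := fun z hz hzV =>
  Set.disjoint_left.1 (hdisj v hv z hzV fun h => hz.2 h.symm) hz.1 (mem_box_self hr)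

theorem coe_unscale {b : ℝ} (hb : 0 ≤ b) (hb' : b ≤ 1 / 2) (t : I) :
    (unscale b t : ℝ) = b + t * (1 - 2 * b) := by
  have h1 := t.2.1
  have h2 := t.2.2
  rw [unscale, Set.coe_projIcc, min_eq_right (by nlinarith), max_eq_right (by nlinarith)]

namespace Scales

variable {ι : Type*} {V : Set ℂ} {c : ι → C(I, ℂ)} (sc : Scales V c)

theorem exists_core (e : ι) : ∃ (x y : Punct V) (F : Path x y) (s₁ s₂ : I),
    F.curve = core sc.b (c e) ∧ (∀ t, (F t : ℂ) ∈ middle sc.b (c e)) ∧ s₁ ≤ s₂ ∧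
    (∀ t ≤ s₁, (F t : ℂ) ∈ box (c e 0) (sc.r / 2)) ∧
    (∀ t, s₂ ≤ t → (F t : ℂ) ∈ box (c e 1) (sc.r / 2)) ∧
    (∀ t, s₁ ≤ t → t ≤ s₂ → ∀ w ∈ V, (F t : ℂ) ∉ box w (2 * sc.ρ)) ∧
    (x : ℂ) ∈ box (c e 0) (sc.ρ / 2) ∧ (y : ℂ) ∈ box (c e 1) (sc.ρ / 2) := by
  have hb := sc.b_pos
  have hba := sc.b_lt
  have ha := sc.a_lt
  have hd : 0 < 1 - 2 * sc.b := by linarith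
  have hu := coe_unscale hb.le (by linarith : sc.b ≤ 1 / 2)
  have hmid : ∀ t, c e (unscale sc.b t) ∈ middle sc.b (c e) := fun t => by
    have h1 := t.2.1
    have h2 := t.2.2
    refine ⟨_, ?_, rfl⟩
    change _ ≤ (unscale sc.b t : ℝ) ∧ (unscale sc.b t : ℝ) ≤ _
    rw [hu]
    constructor <;> nlinarith
  have hV : ∀ t, c e (unscale sc.b t) ∉ V := fun t =>
    sc.margin e _ (hmid t) (mem_box_self sc.ρ'_pos)
  have hs0 : 0 ≤ (sc.a - sc.b) / (1 - 2 * sc.b) := div_nonneg (by linarith) hd.le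
  have hs1 : (sc.a - sc.b) / (1 - 2 * sc.b) ≤ 1 / 2 := by
    rw [div_le_iff₀ hd]; linarith
  let s : I := ⟨(sc.a - sc.b) / (1 - 2 * sc.b), hs0, by linarith⟩
  have hs : (s : ℝ) * (1 - 2 * sc.b) = sc.a - sc.b := div_mul_cancel₀ _ hd.ne'
  refine ⟨⟨c e (unscale sc.b 0), hV 0⟩, ⟨c e (unscale sc.b 1), hV 1⟩,
    ⟨⟨fun t => ⟨c e (unscale sc.b t), hV t⟩, ?_⟩, rfl, rfl⟩, s, σ s, rfl, hmid, ?_,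
    fun t ht => sc.left e _ ?_, fun t ht => sc.right e _ ?_, fun t h1 h2 => sc.mid e _ ⟨_, ?_, rfl⟩,
    sc.left' e _ ?_, sc.right' e _ ?_⟩
  · have := continuous_unscale sc.b
    fun_prop
  · rw [← Subtype.coe_le_coe, unitInterval.coe_symm_eq]
    change (sc.a - sc.b) / (1 - 2 * sc.b) ≤ 1 - (sc.a - sc.b) / (1 - 2 * sc.b)
    linarith
  · rw [← Subtype.coe_le_coe] at ht
    rw [hu]
    nlinarith
  · rw [← Subtype.coe_le_coe, unitInterval.coe_symm_eq] at ht
    rw [hu]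
    nlinarith
  · rw [← Subtype.coe_le_coe] at h1 h2
    rw [unitInterval.coe_symm_eq] at h2
    change _ ≤ (unscale sc.b t : ℝ) ∧ (unscale sc.b t : ℝ) ≤ _
    rw [hu]
    constructor <;> nlinarith
  · rw [hu]; simp
  · rw [hu]; simp; linarith

open Grid Relation in
theorem exists_cover (hV : V.Finite) (h0 : ∀ e, c e 0 ∈ V) (h1 : ∀ e, c e 1 ∈ V) {Γ : Type}
    [Group Γ] (A : Voltage (Punct V) Γ) (b : V → Punct V)
    (hb : ∀ v : V, (b v : ℂ) ∈ pbox v sc.r) {x y : ι → Punct V} (F : ∀ e, Path (x e) (y e))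
    (s₁ s₂ : ι → I) (hF : ∀ e t, (F e t : ℂ) ∈ middle sc.b (c e)) (hs : ∀ e, s₁ e ≤ s₂ e)
    (hleft : ∀ e, ∀ t ≤ s₁ e, (F e t : ℂ) ∈ box (c e 0) (sc.r / 2))
    (hright : ∀ e t, s₂ e ≤ t → (F e t : ℂ) ∈ box (c e 1) (sc.r / 2))
    (hmid : ∀ e t, s₁ e ≤ t → t ≤ s₂ e → ∀ w ∈ V, (F e t : ℂ) ∉ box w (2 * sc.ρ))
    (hx : ∀ e, (x e : ℂ) ∈ box (c e 0) (sc.ρ / 2))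
    (hy : ∀ e, (y e : ℂ) ∈ box (c e 1) (sc.ρ / 2)) :
    ∃ (a : ℕ) (C : ArcCover (sphere a) Γ (Option V) ι),
      (∀ e, C.src e = some ⟨c e 0, h0 e⟩) ∧ (∀ e, C.tgt e = some ⟨c e 1, h1 e⟩) ∧
      (∀ v : V, C.H (some v) = Mesh.loops A v sc.r (b v) (hb v)) ∧
      ∀ e, ∃ (p : Path (b ⟨c e 0, h0 e⟩) (x e)) (q : Path (y e) (b ⟨c e 1, h1 e⟩)),
        (∀ t, (p t : ℂ) ∈ pbox (c e 0) sc.r) ∧ (∀ t, (q t : ℂ) ∈ pbox (c e 1) sc.r) ∧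
        C.total e = A.G p * A.G (F e) * A.G q := by
  obtain ⟨δ, hδ, hδρ, hδρ', hδη⟩ : ∃ δ > 0, 4 * δ ≤ sc.ρ ∧ 3 * δ ≤ sc.ρ' ∧ 6 * δ ≤ sc.η := by
    refine ⟨min sc.ρ (min sc.ρ' sc.η) / 6, ?_, ?_, ?_, ?_⟩
    · exact div_pos (lt_min sc.ρ_pos (lt_min sc.ρ'_pos sc.η_pos)) (by norm_num)
    · linarith [min_le_left sc.ρ (min sc.ρ' sc.η), sc.ρ_pos]
    · linarith [(min_le_right sc.ρ (min sc.ρ' sc.η)).trans (min_le_left _ _), sc.ρ'_pos]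
    · linarith [(min_le_right sc.ρ (min sc.ρ' sc.η)).trans (min_le_right _ _)]
  have hρ := sc.ρ_pos
  have hρr := sc.ρ_le
  have bigger : ∀ z : ℂ, |z.re| < sc.R ∧ |z.im| < sc.R →
      |z.re| < sc.R + sc.ρ ∧ |z.im| < sc.R + sc.ρ := fun z hz =>
    ⟨by linarith [hz.1], by linarith [hz.2]⟩
  obtain ⟨M⟩ := exists_mesh hV (R := sc.R + sc.ρ) hδ fun v hv => bigger v (sc.bound_vert v hv)
  have not_frame : ∀ z : Vert M.a, ∀ p : ℂ, |p.re| < sc.R ∧ |p.im| < sc.R →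
      M.pos z ∈ box p sc.ρ → z ∉ frame M.a := by
    rintro z p ⟨hp1, hp2⟩ ⟨hz1, hz2⟩ hz
    have e1 := abs_add_le ((M.pos z).re - p.re) p.re
    have e2 := abs_add_le ((M.pos z).im - p.im) p.im
    rw [sub_add_cancel] at e1 e2
    rcases M.frame_far hz with h | h <;> linarith
  have hFR : ∀ e t, |(F e t : ℂ).re| < sc.R ∧ |(F e t : ℂ).im| < sc.R := by
    intro e t
    obtain ⟨τ, -, h⟩ := hF e t
    rw [← h]
    exact sc.bound e τ
  have hdisj' : ∀ z : Vert M.a, ∀ v w : V, M.pos z ∈ box v sc.ρ → M.pos z ∈ box w sc.ρ → v = w := by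
    intro z v w hv hw
    by_contra hne
    exact Set.disjoint_left.1 (sc.disj v v.2 w w.2 fun h => hne (Subtype.ext h))
      (box_mono (by linarith) hv) (box_mono (by linarith) hw)
  choose d₁ d₂ γ q₁ q₂ hd₁ hd₂ hq₁ hq₂ hwalk htot using fun e =>
    M.exists_arc A (h0 e) (h1 e) sc.disj hρr hδρ hδρ' (F e) (fun t => sc.margin e _ (hF e t))
      (fun t => bigger _ (hFR e t)) (hs e) (hleft e) (hright e) (hmid e) (hx e) (hy e)
  have hpbox : ∀ v ∈ V, pbox v sc.r ⊆ Vᶜ := fun v hv => pbox_subset sc.r_pos sc.disj hv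
  obtain ⟨h, hh⟩ := M.exists_gauge A hpbox sc.disj (by linarith : sc.ρ ≤ sc.r) b hb
  have volt_rev : ∀ d, M.volt A (rev d) = (M.volt A d)⁻¹ := M.volt_rev A
  let B : Option V → Set (Vert M.a) := fun s =>
    s.elim (frame M.a) fun v => M.pos ⁻¹' box v sc.ρ
  refine ⟨M.a,
    { g := M.volt A
      g_inv := M.volt_rev A
      H := fun s => s.elim ⊤ fun v => Mesh.loops A v sc.r (b v) (hb v)
      B := B
      B_disj := ?_
      B_nonempty := ?_
      B_conn := ?_
      h := h
      h_mem := ?_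
      face := ?_
      P := fun e => M.near (F e) \ M.blobs sc.ρ
      P_disj := ?_
      P_B := ?_
      src := fun e => some ⟨c e 0, h0 e⟩
      tgt := fun e => some ⟨c e 1, h1 e⟩
      d₁ := d₁
      d₂ := fun e => rev (d₂ e)
      G := γ
      d₁_src := hd₁
      d₂_tgt := fun e => ?_
      walk := hwalk }, fun _ => rfl, fun _ => rfl, fun _ => rfl, fun e => ?_⟩
  · rintro z (_ | v) (_ | w) hz hz'
    · rfl
    · exact absurd hz (not_frame z w (sc.bound_vert w w.2) hz')
    · exact absurd hz' (not_frame z v (sc.bound_vert v v.2) hz)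
    · rw [hdisj' z v w hz hz']
  · rintro (_ | v)
    · exact ⟨(0, 0), Or.inl rfl⟩
    · obtain ⟨z, hz⟩ := M.exists_near (bigger v (sc.bound_vert v v.2))
      exact ⟨z, box_mono (by linarith) hz⟩
  · rintro (_ | v) z hz w hw
    · exact frame_conn hz hw
    · exact M.reach_box hz hw
  · rintro (_ | v) d hd hd'
    · trivial
    · obtain ⟨p, hp, hpG⟩ := hh v (src d) hd
      obtain ⟨q, hq, hqG⟩ := hh v (src (rev d)) hd'
      have hseg := (convex_box (v : ℂ) sc.r).segment_subset (box_mono (by linarith) hd)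
        (box_mono (by linarith) hd')
      obtain ⟨e, he, heG⟩ := Mesh.exists_segPath A (x := ⟨M.pos (src d), M.pos_notMem _⟩)
        (y := ⟨M.pos (src (rev d)), M.pos_notMem _⟩) (K := pbox v sc.r) (M.segment_dart d)
        fun z hz => ⟨hseg hz, fun hzv => M.segment_dart d hz (by
          rw [Set.mem_singleton_iff.1 hzv]; exact v.2)⟩
      refine ⟨(p.trans e).trans q.symm,
        Mesh.trans_mem _ _ (Mesh.trans_mem _ _ hp he) fun t => hq (σ t), ?_⟩
      change _ = (h (src d))⁻¹ * M.volt A d * h (src (rev d))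
      rw [A.map_trans, A.map_trans, A.map_symm, heG, hpG, hqG, inv_inv]
      rfl
  · intro l hl
    obtain ⟨f, rfl⟩ := mem_faces.1 hl
    rcases M.face A f with h | ⟨v, hv, h⟩ | h
    · exact Or.inl ⟨none, h⟩
    · exact Or.inl ⟨some ⟨v, hv⟩, fun d hd =>
        ⟨box_mono (by linarith) (h d hd).1, box_mono (by linarith) (h d hd).2⟩⟩
    · exact Or.inr h
  · rintro z e e' ⟨⟨t, ht⟩, -⟩ ⟨⟨t', ht'⟩, -⟩
    by_contra hne
    refine sc.sep e e' hne _ (hF e t) _ (hF e' t') (box_mono ?_ (box_subset ht (mem_box_comm.1 ht')))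
    linarith
  · rintro z e (_ | v) ⟨⟨t, ht⟩, hz⟩ hz'
    · exact not_frame z _ (hFR e t) (box_mono (by linarith) ht) hz'
    · exact hz ⟨v, v.2, hz'⟩
  · change src (rev (rev (d₂ e))) ∈ _
    rw [rev_rev]
    exact hd₂ e
  · obtain ⟨p, hp, hpG⟩ := hh ⟨c e 0, h0 e⟩ _ (hd₁ e)
    obtain ⟨q, hq, hqG⟩ := hh ⟨c e 1, h1 e⟩ _ (hd₂ e)
    refine ⟨p.trans (q₁ e), (q₂ e).trans q.symm, Mesh.trans_mem _ _ hp (hq₁ e),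
      Mesh.trans_mem _ _ (hq₂ e) fun t => hq (σ t), ?_⟩
    change (h (src (d₁ e)))⁻¹ * (M.volt A (d₁ e) * γ e * M.volt A (rev (d₂ e))) *
      h (src (rev (rev (d₂ e)))) = _
    rw [volt_rev, htot, rev_rev, hpG, hqG, A.map_trans, A.map_trans, A.map_symm]
    group

end Scales

/-- A family of pairwise disjoint curves with ends in `V`, no two of them homotopic up to reversal
and none of them contractible, is bounded by an Euler characteristic argument. -/
theorem card_curves_le {ι : Type} [Fintype ι] {V : Set ℂ} (hV : V.Finite) (c : ι → C(I, ℂ))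
    (h0 : ∀ e, c e 0 ∈ V) (h1 : ∀ e, c e 1 ∈ V) (hcV : ∀ e t, t ≠ 0 → t ≠ 1 → c e t ∉ V)
    (hc : ∀ e e', e ≠ e' → ∀ t t' : I, t ≠ 0 → t ≠ 1 → t' ≠ 0 → t' ≠ 1 → c e t ≠ c e' t')
    (hne : ∀ e e', e ≠ e' → ¬ EdgeHomotopic V (c e) (c e')) (hnt : ∀ e, ¬ IsTrivialLoop V (c e)) :
    (2 ≤ V.ncard → Fintype.card ι + 6 ≤ 3 * (V.ncard + 1)) ∧
      (V.ncard = 1 → ∀ e, c e 0 ≠ c e 1) := by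
  classical
  obtain ⟨sc⟩ := exists_scales hV c hcV hc
  have := pathConnectedSpace_punct hV
  obtain ⟨Γ, _, ⟨A⟩⟩ := Voltage.exists_voltage (Punct V)
  have hpbox : ∀ v ∈ V, pbox v sc.r ⊆ Vᶜ := fun v hv => pbox_subset sc.r_pos sc.disj hv
  have hr := sc.r_pos
  have hb := sc.b_pos
  have hb' : sc.b < 1 / 2 := sc.b_lt.trans sc.a_lt
  have hbase : ∀ v : ℂ, v + (sc.r / 2 : ℝ) ∈ pbox v sc.r := fun v => by
    refine ⟨⟨?_, ?_⟩, ?_⟩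
    · simp only [Complex.add_re, Complex.ofReal_re, add_sub_cancel_left]
      rw [abs_of_pos (by positivity)]
      linarith
    · simpa using hr
    · simpa using hr.ne'
  let b : V → Punct V := fun v => ⟨_, hpbox v v.2 (hbase v)⟩
  choose x y F s₁ s₂ hcore hF hs hleft hright hmid hx hy using sc.exists_core
  obtain ⟨a, C, hsrc, htgt, hH, htot⟩ := sc.exists_cover hV h0 h1 A b (fun v => hbase v) F s₁ s₂ hF
    hs hleft hright hmid hx hy
  choose p q hp hq htot using htot
  have good : ∀ e, GoodCurve V (c e 0) (c e 1) sc.b sc.r (c e) := fun e =>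
    ⟨⟨rfl, rfl, hcV e⟩,
      fun t ht => box_mono (by linarith) (sc.left e t (ht.trans sc.b_lt.le)),
      fun t ht => box_mono (by linarith) (sc.right e t (by linarith [sc.b_lt]))⟩
  let rv : C(I, ℂ) → C(I, ℂ) := fun c => c.comp ⟨σ, continuous_symm⟩
  have good' : ∀ e, GoodCurve V (c e 1) (c e 0) sc.b sc.r (rv (c e)) := fun e =>
    ⟨⟨by simp [rv], by simp [rv], fun t h0 h1 => hcV e _ (by simpa using h1) (by simpa using h0)⟩,
      fun t ht => (good e).right (σ t) (by rw [coe_symm_eq]; linarith),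
      fun t ht => (good e).left (σ t) (by rw [coe_symm_eq]; linarith)⟩
  have hcore' : ∀ e, (F e).symm.curve = core sc.b (rv (c e)) := fun e => by
    ext t
    change (F e).curve (σ t) = c e (σ (unscale sc.b t))
    rw [hcore]
    change c e _ = _
    congr 1
    apply Subtype.ext
    change (unscale sc.b (σ t) : ℝ) = (σ (unscale sc.b t) : ℝ)
    rw [coe_symm_eq, coe_unscale hb.le hb'.le, coe_unscale hb.le hb'.le, coe_symm_eq]
    ring
  let N : V → (y z : Punct V) → Γ → Prop := fun v y z γ =>
    ∃ p : Path y z, (∀ t, (p t : ℂ) ∈ pbox v sc.r) ∧ A.G p = γ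
  have N_mul : ∀ {v y z w g h}, N v y z g → N v z w h → N v y w (g * h) := by
    rintro v y z w _ _ ⟨p, hp, rfl⟩ ⟨q, hq, rfl⟩
    exact ⟨p.trans q, Mesh.trans_mem p q hp hq, A.map_trans _ _⟩
  have N_inv : ∀ {v y z g}, N v y z g → N v z y g⁻¹ := by
    rintro v y z _ ⟨p, hp, rfl⟩
    exact ⟨p.symm, fun t => hp _, A.map_symm _⟩
  let u : ι → V := fun e => ⟨c e 0, h0 e⟩
  let w : ι → V := fun e => ⟨c e 1, h1 e⟩
  have Np : ∀ e, N (u e) (b (u e)) (x e) (A.G (p e)) := fun e => ⟨p e, hp e, rfl⟩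
  have Nq : ∀ e, N (w e) (y e) (b (w e)) (A.G (q e)) := fun e => ⟨q e, hq e, rfl⟩
  have : Fintype V := hV.fintype
  have hcard : Fintype.card (Option V) = V.ncard + 1 := by
    rw [Fintype.card_option, ← Nat.card_eq_fintype_card, Nat.card_coe_set_eq]
  have bound := C.card_bound ?_ ?_ ?_
  · rw [hcard] at bound
    refine ⟨fun h => bound.1 (by omega), fun h e hee => bound.2 (by omega) e ?_⟩
    rw [hsrc, htgt]
    exact congrArg some (Subtype.ext hee)
  · intro e he hmem
    rw [hsrc, htgt, Option.some_inj] at he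
    rw [hsrc, hH, htot] at hmem
    have hmem' : N (u e) (b (u e)) (b (u e)) (A.G (p e) * A.G (F e) * A.G (q e)) := hmem
    have Nq' := Nq e
    have he' : u e = w e := he
    rw [← he'] at Nq'
    obtain ⟨l, hl, hlG⟩ := N_mul (N_mul (N_inv (Np e)) hmem') (N_inv Nq')
    have hg := good e
    rw [← show c e 0 = c e 1 from congrArg Subtype.val he'] at hg
    exact hnt e (Or.inl (homotopicIn_const A hb hb' (hpbox _ (h0 e)) (h0 e) hg (hcore e) l hl
      (by rw [hlG]; group)))
  · intro e e' hee hs ht α hα β hβ h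
    rw [hsrc, hsrc, Option.some_inj] at hs
    rw [htgt, htgt, Option.some_inj] at ht
    rw [hsrc, hH] at hα
    rw [htgt, hH] at hβ
    rw [htot, htot] at h
    have hα' : N (u e) (b (u e)) (b (u e)) α := hα
    have hβ' : N (w e) (b (w e)) (b (w e)) β := hβ
    have Np' := Np e'
    have Nq' := Nq e'
    rw [← show u e = u e' from hs] at Np'
    rw [← show w e = w e' from ht] at Nq'
    obtain ⟨l, hl, hlG⟩ := N_mul (N_mul (N_inv Np') hα') (Np e)
    obtain ⟨k, hk, hkG⟩ := N_mul (N_mul (Nq e) hβ') (N_inv Nq')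
    have hg := good e'
    rw [← show c e 0 = c e' 0 from congrArg Subtype.val hs,
      ← show c e 1 = c e' 1 from congrArg Subtype.val ht] at hg
    refine hne e' e (Ne.symm hee) (Or.inl (homotopicIn_of_voltage A hb hb' (hpbox _ (h0 e))
      (hpbox _ (h1 e)) (h0 e) (h1 e) (good e) hg (hcore e) (hcore e') l k hl hk ?_))
    rw [hlG, hkG]
    calc A.G (F e') = (A.G (p e'))⁻¹ * (A.G (p e') * A.G (F e') * A.G (q e')) * (A.G (q e'))⁻¹ := by
          group
      _ = _ := by rw [h]; group
  · intro e e' hee hs ht α hα β hβ h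
    rw [hsrc, htgt, Option.some_inj] at hs
    rw [htgt, hsrc, Option.some_inj] at ht
    rw [hsrc, hH] at hα
    rw [htgt, hH] at hβ
    rw [htot, htot] at h
    have hα' : N (u e) (b (u e)) (b (u e)) α := hα
    have hβ' : N (w e) (b (w e)) (b (w e)) β := hβ
    have Np' := Np e'
    have Nq' := Nq e'
    rw [← show u e = w e' from hs] at Nq'
    rw [← show w e = u e' from ht] at Np'
    obtain ⟨l, hl, hlG⟩ := N_mul (N_mul Nq' hα') (Np e)
    obtain ⟨k, hk, hkG⟩ := N_mul (N_mul (Nq e) hβ') Np'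
    have hg := good' e'
    rw [← show c e 0 = c e' 1 from congrArg Subtype.val hs,
      ← show c e 1 = c e' 0 from congrArg Subtype.val ht] at hg
    refine hne e' e (Ne.symm hee) (Or.inr (homotopicIn_of_voltage A hb hb' (hpbox _ (h0 e))
      (hpbox _ (h1 e)) (h0 e) (h1 e) (good e) hg (hcore e) (hcore' e') l k hl hk ?_))
    rw [hlG, hkG, A.map_symm]
    calc (A.G (F e'))⁻¹ = A.G (q e') * (A.G (p e') * A.G (F e') * A.G (q e'))⁻¹ * A.G (p e') := by
          group
      _ = _ := by rw [h]; group

/-- Every loose non-homotopic drawing in the plane with `n ≥ 1`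
vertices and `m` edges satisfies `m ≤ 3n - 3`. -/
theorem loose_plane_edge_bound (n m : ℕ) (hn : 1 ≤ n)
    (D : PlaneDrawing n m) (hloose : D.Loose) (hD : D.NonHomotopic) :
    m ≤ 3 * n - 3 := by
  have key := card_curves_le D.finV (fun e => ⟨D.f e, D.cont e⟩) D.source_mem D.target_mem
    D.interior_not_mem hloose hD.1 hD.2
  rw [D.cardV, Fintype.card_fin] at key
  rcases hn.eq_or_lt with rfl | h
  · obtain ⟨v, hv⟩ := Set.ncard_eq_one.1 D.cardV
    by_contra hm
    have h0 := D.source_mem ⟨0, by omega⟩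
    have h1 := D.target_mem ⟨0, by omega⟩
    rw [hv, Set.mem_singleton_iff] at h0 h1
    exact key.2 rfl ⟨0, by omega⟩ (h0.trans h1.symm)
  · have := key.1 h
    omega
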